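/- arXiv:2109.04246 — 4 statements merged into one kernel-verified Lean document; each statement's English description precedes it below -/
import Mathlib

section
/- Let X be a continuum and f : X → X a homeomorphism such that X \ Ω(f) ≠ ∅. Then h_top(2^f) = +∞. -/
open TopologicalSpace

/-- The induced map on the hyperspace of nonempty compact subsets, `A ↦ f(A)`. -/
noncomputable def inducedHyper {X : Type*} [MetricSpace X] (f : X → X) (hf : Continuous f) :
    NonemptyCompacts X → NonemptyCompacts X :=
  fun A => ⟨⟨f '' (A : Set X), A.isCompact.image hf⟩, A.nonempty.image f⟩

/-- The set of nonwandering points of `f`. -/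
def nonwandering {X : Type*} [TopologicalSpace X] (f : X → X) : Set X :=
  {x : X | ∀ U ∈ nhds x, ∃ n : ℕ, 0 < n ∧ ((f^[n] ⁻¹' U) ∩ U).Nonempty}


lemma inducedHyper_iterate_coe {X : Type*} [MetricSpace X] (f : X → X) (hf : Continuous f)
    (n : ℕ) (A : NonemptyCompacts X) :
    (((inducedHyper f hf)^[n] A : NonemptyCompacts X) : Set X) = f^[n] '' (A : Set X) := by
  induction n with
  | zero => simp
  | succ n ih =>
    rw [Function.iterate_succ_apply', Function.iterate_succ', Set.image_comp, ← ih]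
    rfl

/-- The finite set `{f⁻ʲ (s j) : j ≤ m}` coding the word `s`. -/
noncomputable def wordSet {X : Type*} [MetricSpace X] (g : X → X) (m : ℕ)
    (s : Fin (m + 1) → X) : NonemptyCompacts X :=
  ⟨⟨Set.range (fun j : Fin (m + 1) => g^[(j : ℕ)] (s j)), (Set.finite_range _).isCompact⟩,
    Set.range_nonempty _⟩

lemma wandering_index {X : Type*} [MetricSpace X] (f : X ≃ₜ X) (U : Set X)
    (hU : ∀ n : ℕ, 0 < n → ∀ x ∈ U, f^[n] x ∉ U) (j m : ℕ) (p : X) (hp : p ∈ U)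
    (h : f^[j] (f.symm^[m] p) ∈ U) : j = m := by
  have hl : ∀ n : ℕ, Function.LeftInverse f^[n] f.symm^[n] := fun n =>
    Function.LeftInverse.iterate f.apply_symm_apply n
  rcases lt_trichotomy j m with hjm | hjm | hjm
  · exfalso
    refine hU (m - j) (by omega) _ h ?_
    rw [← Function.iterate_add_apply, Nat.sub_add_cancel hjm.le, hl m p]
    exact hp
  · exact hjm
  · exfalso
    refine hU (j - m) (by omega) p hp ?_
    have : f^[j] (f.symm^[m] p) = f^[j - m] p := by
      conv_lhs => rw [← Nat.sub_add_cancel hjm.le, Function.iterate_add_apply, hl m p]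
    rwa [this] at h

lemma word_eq_of_close {X : Type*} [MetricSpace X] (f : X ≃ₜ X) (U : Set X)
    (hU : ∀ n : ℕ, 0 < n → ∀ x ∈ U, f^[n] x ∉ U) (P : Finset X) (hP : (P : Set X) ⊆ U)
    (ε : ℝ) (hε : ∀ p ∈ P, ∀ y, dist p y < ε → y ∈ U ∧ (y ∈ P → y = p))
    (m : ℕ) (s t : Fin (m + 1) → P)
    (h : ∀ j < m + 1, dist ((inducedHyper f f.continuous)^[j] (wordSet f.symm m (fun i => s i)))
      ((inducedHyper f f.continuous)^[j] (wordSet f.symm m (fun i => t i))) < ε) : s = t := by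
  have hl : ∀ n : ℕ, Function.LeftInverse f^[n] f.symm^[n] := fun n =>
    Function.LeftInverse.iterate f.apply_symm_apply n
  funext j
  have hj := h j j.2
  rw [Metric.NonemptyCompacts.dist_eq] at hj
  have hmem : (s j : X) ∈ (((inducedHyper f f.continuous)^[(j : ℕ)]
      (wordSet f.symm m (fun i => s i)) : NonemptyCompacts X) : Set X) := by
    rw [inducedHyper_iterate_coe]
    exact ⟨_, ⟨j, rfl⟩, hl j _⟩
  obtain ⟨y, hy, hd⟩ := Metric.exists_dist_lt_of_hausdorffDist_lt hmem hj
    (Metric.hausdorffEDist_ne_top_of_nonempty_of_bounded (NonemptyCompacts.nonempty _)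
      (NonemptyCompacts.nonempty _) (NonemptyCompacts.isCompact _).isBounded
      (NonemptyCompacts.isCompact _).isBounded)
  obtain ⟨hyU, hyP⟩ := hε _ (s j).2 y hd
  rw [inducedHyper_iterate_coe] at hy
  obtain ⟨_, ⟨i, rfl⟩, rfl⟩ := hy
  have hji : j = i := Fin.ext (wandering_index f U hU j i _ (hP (t i).2) hyU)
  subst hji
  have he : f^[(j : ℕ)] (f.symm^[(j : ℕ)] (t j : X)) = t j := hl j _
  simp only [he] at hyP
  exact Subtype.ext (hyP (t j).2).symm

lemma log_card_le_entropy {X : Type*} [MetricSpace X] (f : X ≃ₜ X) (U : Set X)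
    (hU : ∀ n : ℕ, 0 < n → ∀ x ∈ U, f^[n] x ∉ U) (P : Finset X) (hP : (P : Set X) ⊆ U)
    (ε : ℝ) (hε0 : 0 < ε) (hε : ∀ p ∈ P, ∀ y, dist p y < ε → y ∈ U ∧ (y ∈ P → y = p)) :
    ENNReal.log (P.card : ENNReal) ≤
      Dynamics.coverEntropy (inducedHyper f f.continuous) Set.univ := by
  classical
  let V : SetRel (NonemptyCompacts X) (NonemptyCompacts X) := {p | dist p.1 p.2 < ε / 2}
  have hV : V ∈ uniformity (NonemptyCompacts X) := Metric.dist_mem_uniformity (half_pos hε0)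
  refine le_trans ?_ (Dynamics.netEntropyEntourage_le_coverEntropy _ _ hV)
  rw [← ExpGrowth.expGrowthSup_pow]
  refine ExpGrowth.expGrowthSup_eventually_monotone ?_
  filter_upwards [Filter.eventually_gt_atTop 0] with n hn
  obtain ⟨m, rfl⟩ : ∃ m, n = m + 1 := ⟨n - 1, by omega⟩
  let A : (Fin (m + 1) → P) → NonemptyCompacts X := fun s => wordSet f.symm m (fun i => s i)
  have key : ∀ s t, ∀ B, B ∈ UniformSpace.ball (A s) (Dynamics.dynEntourage
      (inducedHyper f f.continuous) V (m + 1)) → B ∈ UniformSpace.ball (A t)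
      (Dynamics.dynEntourage (inducedHyper f f.continuous) V (m + 1)) → s = t := by
    intro s t B hs ht
    rw [Dynamics.mem_ball_dynEntourage] at hs ht
    refine word_eq_of_close f U hU P hP ε hε m s t fun j hj => ?_
    have h1 : dist _ _ < ε / 2 := hs j hj
    have h2 : dist _ _ < ε / 2 := ht j hj
    have h3 := dist_triangle_right ((inducedHyper f f.continuous)^[j] (A s))
      ((inducedHyper f f.continuous)^[j] (A t)) ((inducedHyper f f.continuous)^[j] B)
    dsimp only at h1 h2
    change dist ((inducedHyper f f.continuous)^[j] (A s))
      ((inducedHyper f f.continuous)^[j] (A t)) < ε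
    linarith
  have hself : ∀ s, A s ∈ UniformSpace.ball (A s) (Dynamics.dynEntourage
      (inducedHyper f f.continuous) V (m + 1)) := by
    intro s
    rw [Dynamics.mem_ball_dynEntourage]
    intro j _
    change dist _ _ < ε / 2
    rw [dist_self]
    exact half_pos hε0
  have hinj : Function.Injective A := fun s t hst =>
    key s t (A s) (hself s) (hst ▸ hself s)
  have hnet : Dynamics.IsDynNetIn (inducedHyper f f.continuous) Set.univ V (m + 1)
      ((Finset.univ.image A : Finset (NonemptyCompacts X)) : Set (NonemptyCompacts X)) := by
    refine ⟨Set.subset_univ _, ?_⟩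
    intro a ha b hb hab
    simp only [Finset.coe_image, Finset.coe_univ, Set.image_univ, Set.mem_range] at ha hb
    obtain ⟨s, rfl⟩ := ha
    obtain ⟨t, rfl⟩ := hb
    refine Set.disjoint_left.2 fun B hs ht => hab ?_
    rw [key s t B hs ht]
  have hc := hnet.card_le_netMaxcard
  rw [Finset.card_image_of_injective _ hinj] at hc
  simp only [Finset.card_univ, Fintype.card_fun, Fintype.card_fin, Fintype.card_coe] at hc
  have := ENat.toENNReal_mono hc
  simpa using this

lemma exists_eps {X : Type*} [MetricSpace X] (U : Set X) (hU : IsOpen U) (P : Finset X)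
    (hP : (P : Set X) ⊆ U) :
    ∃ ε : ℝ, 0 < ε ∧ ∀ p ∈ P, ∀ y, dist p y < ε → y ∈ U ∧ (y ∈ P → y = p) := by
  classical
  have h : ∀ p : X, ∃ e : ℝ, 0 < e ∧ (p ∈ P → ∀ y, dist p y < e → y ∈ U ∧ (y ∈ P → y = p)) := by
    intro p
    by_cases hp : p ∈ P
    · have ho : IsOpen (U ∩ ((P.erase p : Finset X) : Set X)ᶜ) :=
        hU.inter (Finset.finite_toSet _).isClosed.isOpen_compl
      obtain ⟨e, he, hb⟩ := Metric.isOpen_iff.1 ho p ⟨hP hp, by simp⟩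
      refine ⟨e, he, fun _ y hy => ?_⟩
      have hy' := hb (show y ∈ Metric.ball p e by rwa [Metric.mem_ball, dist_comm])
      refine ⟨hy'.1, fun hyP => ?_⟩
      by_contra hne
      exact hy'.2 (by simp [hne, hyP])
    · exact ⟨1, one_pos, fun h => absurd h hp⟩
  choose e he hb using h
  rcases P.eq_empty_or_nonempty with rfl | hne
  · exact ⟨1, one_pos, by simp⟩
  · refine ⟨P.inf' hne e, (Finset.lt_inf'_iff hne).2 fun p _ => he p, fun p hp y hy => ?_⟩
    exact hb p hp y (hy.trans_le (Finset.inf'_le e hp))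

/-- If `f` is a homeomorphism of a continuum `X` with `X \ Ω(f) ≠ ∅`, then the topological
entropy of the induced map `2^f` is infinite. -/
theorem entropy_inducedHyper_top_of_wandering {X : Type*}
    [MetricSpace X] [CompactSpace X] [ConnectedSpace X] [Nonempty X]
    (f : X ≃ₜ X) (h : ((nonwandering (⇑f))ᶜ).Nonempty) :
    Dynamics.coverEntropy (inducedHyper (⇑f) f.continuous) Set.univ = ⊤ := by
  obtain ⟨x, hx⟩ := h
  simp only [nonwandering, Set.mem_compl_iff, Set.mem_ofPred_eq, not_forall] at hx
  obtain ⟨U₀, hU₀, hw₀⟩ := hx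
  obtain ⟨U, hUU₀, hUo, hxU⟩ := mem_nhds_iff.1 hU₀
  have hw : ∀ n : ℕ, 0 < n → ∀ y ∈ U, f^[n] y ∉ U := fun n hn y hy hfy =>
    hw₀ ⟨n, hn, y, hUU₀ hfy, hUU₀ hy⟩
  have hnt : Nontrivial X := ⟨⟨x, f x, fun hxf => hw 1 one_pos x hxU (by
    rw [Function.iterate_one, ← hxf]; exact hxU)⟩⟩
  have hinf : U.Infinite := infinite_of_mem_nhds x (hUo.mem_nhds hxU)
  have hk : ∀ k : ℕ, ENNReal.log (k : ENNReal) ≤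
      Dynamics.coverEntropy (inducedHyper (⇑f) f.continuous) Set.univ := by
    intro k
    obtain ⟨P, hP, rfl⟩ := hinf.exists_subset_card_eq k
    obtain ⟨ε, hε0, hε⟩ := exists_eps U hUo P hP
    exact log_card_le_entropy f U hw P hP ε hε0 hε
  have ht : Filter.Tendsto (fun k : ℕ => ENNReal.log (k : ENNReal)) Filter.atTop (nhds ⊤) := by
    have h1 := (ENNReal.continuous_log.tendsto ⊤).comp ENNReal.tendsto_nat_nhds_top
    rwa [ENNReal.log_top] at h1
  exact top_le_iff.1 (le_of_tendsto' ht hk)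
end

section
/- Let f : X → X be a homeomorphism of a regular curve X and let D be a connected component of X \ Ω(f). Then the closure of D intersects Ω(f) in at most two points. -/
section RcAux

open Set Filter Topology

def RegC (X : Type*) [MetricSpace X] : Prop :=
  ∀ x : X, ∀ ε > (0 : ℝ), ∃ U : Set X,
      IsOpen U ∧ x ∈ U ∧ U ⊆ Metric.ball x ε ∧ (frontier U).Finite

lemma rc_meets {X : Type*} [TopologicalSpace X] {Z U : Set X} (hZ : IsPreconnected Z)
    {x y : X} (hx : x ∈ Z) (hxU : x ∈ U) (hy : y ∈ Z) (hyU : y ∉ U) :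
    ∃ q ∈ Z, q ∈ frontier U := by
  by_contra h
  push Not at h
  have h1 : Z ⊆ interior U ∪ (closure U)ᶜ := by
    intro z hz
    by_cases hc : z ∈ closure U
    · left
      by_contra hi
      exact h z hz ⟨hc, hi⟩
    · right; exact hc
  obtain ⟨z, hz, hz1, hz2⟩ := hZ _ _ isOpen_interior isClosed_closure.isOpen_compl h1
    ⟨x, hx, by
      rcases h1 hx with h | h
      · exact h
      · exact absurd (subset_closure hxU) h⟩
    ⟨y, hy, by
      rcases h1 hy with h | h
      · exact absurd (interior_subset h) hyU
      · exact h⟩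
  exact hz2 (subset_closure (interior_subset hz1))

/-- small connected compact neighborhoods -/
lemma rc_nhd {X : Type*} [MetricSpace X] [CompactSpace X] [ConnectedSpace X]
    (hreg : RegC X) (x : X) {O : Set X} (hO : O ∈ 𝓝 x) :
    ∃ W ∈ 𝓝 x, W ⊆ O ∧ IsPreconnected W ∧ IsClosed W := by
  obtain ⟨ε, hε, hball⟩ := Metric.mem_nhds_iff.1 hO
  obtain ⟨U, hUo, hxU, hUb, hF⟩ := hreg x (ε/2) (by linarith)
  have hUO : closure U ⊆ O := by
    intro y hy
    apply hball
    have : y ∈ Metric.closedBall x (ε/2) :=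
      closure_minimal (hUb.trans Metric.ball_subset_closedBall) Metric.isClosed_closedBall hy
    rw [Metric.mem_closedBall] at this
    rw [Metric.mem_ball]; linarith
  let Y := closure U
  haveI : CompactSpace Y := isCompact_iff_compactSpace.1 isClosed_closure.isCompact
  let x' : Y := ⟨x, subset_closure hxU⟩
  let C : Set Y := connectedComponent x'
  have hsep : ∀ y : Y, y ∉ C → ∃ K : Set Y, IsClopen K ∧ x' ∈ K ∧ y ∉ K := by
    intro y hy
    have := connectedComponent_eq_iInter_isClopen x'
    simp only [C] at hy
    rw [this, mem_iInter] at hy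
    push Not at hy
    obtain ⟨⟨K, hK1, hK2⟩, h⟩ := hy
    exact ⟨K, hK1, hK2, h⟩
  let F' : Set Y := {y | (y : X) ∈ frontier U ∧ y ∉ C}
  have hF' : F'.Finite := by
    have : (Subtype.val ⁻¹' (frontier U) : Set Y).Finite :=
      hF.preimage Subtype.val_injective.injOn
    exact this.subset fun y hy => hy.1
  choose! K hK using hsep
  let L : Set Y := ⋂ y ∈ F', K y
  have hL : IsClopen L := hF'.isClopen_biInter fun y hy => (hK y hy.2).1
  have hxL : x' ∈ L := mem_iInter₂.2 fun y hy => (hK y hy.2).2.1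
  have hLF : ∀ y ∈ L, (y : X) ∈ frontier U → y ∈ C := by
    intro y hy hyF
    by_contra hyC
    exact (hK y hyC).2.2 (mem_iInter₂.1 hy y ⟨hyF, hyC⟩)
  have hLC : L ⊆ C := by
    intro z hz
    by_contra hzC
    have hKz := hK z hzC
    let R : Set Y := L \ K z
    have hR : IsClopen R := hL.diff hKz.1
    have hRF : ∀ y ∈ R, (y : X) ∈ U := by
      intro y hy
      by_contra hyU
      have h1 : (y : X) ∈ frontier U := ⟨y.2, by rwa [hUo.interior_eq]⟩
      have h2 := hLF y hy.1 h1
      have h3 : C ⊆ K z := hKz.1.connectedComponent_subset hKz.2.1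
      exact hy.2 (h3 h2)
    have hcl : IsClosed (Subtype.val '' R) :=
      isClosed_closure.isClosedEmbedding_subtypeVal.isClosedMap _ hR.1
    have hop : IsOpen (Subtype.val '' R) := by
      obtain ⟨O', hO', hRO⟩ := isOpen_induced_iff.1 hR.2
      have : Subtype.val '' R = O' ∩ U := by
        ext y; constructor
        · rintro ⟨y, hy, rfl⟩
          refine ⟨?_, hRF y hy⟩
          rw [← hRO] at hy; exact hy
        · rintro ⟨h1, h2⟩
          refine ⟨⟨y, subset_closure h2⟩, ?_, rfl⟩
          rw [← hRO]; exact h1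
      rw [this]; exact hO'.inter hUo
    rcases isClopen_iff.1 ⟨hcl, hop⟩ with h | h
    · have : (z : X) ∈ Subtype.val '' R := ⟨z, ⟨hz, hKz.2.2⟩, rfl⟩
      rw [h] at this; exact this
    · have : x ∈ Subtype.val '' R := by rw [h]; trivial
      obtain ⟨y, hy, hyx⟩ := this
      have : y = x' := Subtype.ext hyx
      exact hy.2 (this ▸ hKz.2.1)
  have hLC' : L = C := Subset.antisymm hLC (hL.connectedComponent_subset hxL)
  refine ⟨Subtype.val '' C, ?_, ?_, ?_, ?_⟩
  · obtain ⟨O', hO', hRO⟩ := isOpen_induced_iff.1 (hLC' ▸ hL.2 : IsOpen C)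
    have hx' : x ∈ O' ∩ U := ⟨by
      have : x' ∈ C := mem_connectedComponent
      rw [← hRO] at this; exact this, hxU⟩
    filter_upwards [(hO'.inter hUo).mem_nhds hx'] with y hy
    refine ⟨⟨y, subset_closure hy.2⟩, ?_, rfl⟩
    rw [← hRO]; exact hy.1
  · rintro _ ⟨y, hy, rfl⟩; exact hUO y.2
  · exact isPreconnected_connectedComponent.image _ continuous_subtype_val.continuousOn
  · exact isClosed_closure.isClosedEmbedding_subtypeVal.isClosedMap _ isClosed_connectedComponent

lemma rc_loc {X : Type*} [MetricSpace X] [CompactSpace X] [ConnectedSpace X]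
    (hreg : RegC X) : LocallyConnectedSpace X := by
  refine locallyConnectedSpace_of_connected_bases (fun _ (s : Set X) => s)
    (fun x s => s ∈ 𝓝 x ∧ IsPreconnected s) ?_ (fun x s h => h.2)
  intro x
  rw [hasBasis_iff]
  intro t
  constructor
  · intro ht
    obtain ⟨W, h1, h2, h3, _⟩ := rc_nhd hreg x ht
    exact ⟨W, ⟨h1, h3⟩, h2⟩
  · rintro ⟨W, ⟨h1, _⟩, h2⟩
    exact mem_of_superset h1 h2

/-- finite separators -/
lemma rc_sep {X : Type*} [MetricSpace X] [CompactSpace X]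
    (hreg : RegC X) {ε : ℝ} (hε : 0 < ε) :
    ∃ S : Set X, S.Finite ∧ ∀ Z : Set X, IsPreconnected Z → (∀ s ∈ S, s ∉ Z) →
      ∀ x ∈ Z, ∀ y ∈ Z, dist x y < ε := by
  choose U hU using fun x : X => hreg x (ε/2) (by linarith)
  obtain ⟨t, ht⟩ := isCompact_univ.elim_finite_subcover U (fun x => (hU x).1)
    (fun x _ => mem_iUnion.2 ⟨x, (hU x).2.1⟩)
  refine ⟨⋃ x ∈ t, frontier (U x), t.finite_toSet.biUnion fun x _ => (hU x).2.2.2, ?_⟩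
  intro Z hZ hS x hx y hy
  obtain ⟨i, hi, hxi⟩ := mem_iUnion₂.1 (ht (mem_univ x))
  have hyi : y ∈ U i := by
    by_contra hyi
    obtain ⟨q, hq, hqF⟩ := rc_meets hZ hx hxi hy hyi
    exact hS q (mem_iUnion₂.2 ⟨i, hi, hqF⟩) hq
  have h1 := (hU i).2.2.1 hxi
  have h2 := (hU i).2.2.1 hyi
  rw [Metric.mem_ball] at h1 h2
  have := dist_triangle_right x y i
  linarith

lemma rc_iter {X : Type*} [TopologicalSpace X] (f : X ≃ₜ X) (n : ℕ) (x : X) :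
    (⇑f)^[n] x = (f ^ n) x := by
  induction n generalizing x with
  | zero => rfl
  | succ n ih => rw [Function.iterate_succ_apply, ih, pow_succ]; rfl

lemma rc_zadd {X : Type*} [TopologicalSpace X] (f : X ≃ₜ X) (m n : ℤ) (x : X) :
    (f ^ (m + n)) x = (f ^ m) ((f ^ n) x) := by
  rw [zpow_add]; rfl

lemma rc_zz {X : Type*} [TopologicalSpace X] (f : X ≃ₜ X) (x : X) :
    (f ^ (0 : ℤ)) x = x := by
  rw [zpow_zero]; rfl

def Recu {X : Type*} [TopologicalSpace X] (f : X ≃ₜ X) (c : X) : Prop :=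
  ∀ U ∈ 𝓝 c, ∀ N : ℕ, ∃ n : ℕ, N ≤ n ∧ (f ^ (n : ℤ)) c ∈ U

lemma rc_recA {X : Type*} [MetricSpace X] [CompactSpace X] [ConnectedSpace X]
    (hreg : RegC X) (f : X ≃ₜ X) {c : X} (hc : c ∈ nonwandering (⇑f)) {U : Set X}
    (hU : U ∈ 𝓝 c) : ∃ n : ℕ, 0 < n ∧ (f ^ (n : ℤ)) c ∈ U := by
  by_contra h
  push Not at h
  obtain ⟨ε, hε, hball⟩ := Metric.mem_nhds_iff.1 hU
  obtain ⟨V, hVo, hcV, hVb, hVF⟩ := hreg c (ε/2) (by linarith)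
  have hVU : closure V ⊆ U := by
    intro y hy
    apply hball
    have : y ∈ Metric.closedBall c (ε/2) :=
      closure_minimal (hVb.trans Metric.ball_subset_closedBall) Metric.isClosed_closedBall hy
    rw [Metric.mem_closedBall] at this
    rw [Metric.mem_ball]; linarith
  set A : Set X := (closure V)ᶜ with hA
  have hAo : IsOpen A := isClosed_closure.isOpen_compl
  have hAF : (frontier A).Finite := by
    rw [hA, frontier_compl]; exact hVF.subset frontier_closure_subset
  have hcA : ∀ n : ℕ, 0 < n → (f ^ (n : ℤ)) c ∈ A := fun n hn hcl => h n hn (hVU hcl)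
  have key : ∀ N : ℕ, ∃ i, N ≤ i ∧ ∃ q ∈ frontier A, (f ^ (-(i : ℤ))) q ∈ V ∧
      ∀ l : ℕ, 0 < l → l < i → (f ^ (-(l : ℤ))) q ∈ A := by
    intro N
    have hO : V ∩ ⋂ j ∈ Icc 1 N, (f ^ (j : ℤ)) ⁻¹' A ∈ 𝓝 c := by
      refine inter_mem (hVo.mem_nhds hcV) ?_
      rw [biInter_mem (finite_Icc 1 N)]
      intro j hj
      exact (f ^ (j : ℤ)).continuous.continuousAt.preimage_mem_nhds (hAo.mem_nhds (hcA j hj.1))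
    obtain ⟨W, hW, hWO, hWc, -⟩ := rc_nhd hreg c hO
    have hex : ∃ i : ℕ, 0 < i ∧ ∃ w ∈ W, (f ^ (i : ℤ)) w ∉ A := by
      obtain ⟨n, hn, w, hw1, hw2⟩ := hc W hW
      refine ⟨n, hn, w, hw2, ?_⟩
      rw [mem_preimage, rc_iter] at hw1
      rw [zpow_natCast]
      intro hh
      exact hh (subset_closure (hWO hw1).1)
    classical
    set i := Nat.find hex with hi
    obtain ⟨hi0, w, hw, hwA⟩ := Nat.find_spec hex
    rw [← hi] at hi0 hwA
    have hmin : ∀ j : ℕ, 0 < j → j < i → ∀ w ∈ W, (f ^ (j : ℤ)) w ∈ A := by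
      intro j hj hji w hw
      by_contra hh
      exact Nat.find_min hex hji ⟨hj, w, hw, hh⟩
    have hNi : N ≤ i := by
      by_contra hlt
      push Not at hlt
      have := (hWO hw).2
      exact hwA (mem_iInter₂.1 this i ⟨hi0, hlt.le⟩)
    have hWi : IsPreconnected ((f ^ (i : ℤ)) '' W) :=
      hWc.image _ (f ^ (i : ℤ)).continuous.continuousOn
    obtain ⟨q, ⟨w', hw', rfl⟩, hqF⟩ := rc_meets hWi (mem_image_of_mem _ (mem_of_mem_nhds hW))
      (hcA i hi0) (mem_image_of_mem _ hw) hwA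
    refine ⟨i, hNi, _, hqF, ?_, ?_⟩
    · rw [← rc_zadd, neg_add_cancel, rc_zz]; exact (hWO hw').1
    · intro l hl hli
      have := hmin (i - l) (by omega) (by omega) w' hw'
      rw [← rc_zadd]
      convert this using 3
      omega
  have hfreq : ∃ᶠ i : ℕ in atTop, ∃ q ∈ frontier A, (f ^ (-(i : ℤ))) q ∈ V ∧
      ∀ l : ℕ, 0 < l → l < i → (f ^ (-(l : ℤ))) q ∈ A := by
    rw [frequently_atTop]; exact key
  rw [frequently_exists_finite hAF] at hfreq
  obtain ⟨q, -, hq⟩ := hfreq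
  rw [frequently_atTop] at hq
  obtain ⟨i, hi, hiV, -⟩ := hq 1
  obtain ⟨i', hi', -, hA'⟩ := hq (i + 1)
  exact hA' i (by omega) (by omega) (subset_closure hiV)

lemma rc_rec {X : Type*} [MetricSpace X] [CompactSpace X] [ConnectedSpace X]
    (hreg : RegC X) (f : X ≃ₜ X) {c : X} (hc : c ∈ nonwandering (⇑f)) : Recu f c := by
  intro U hU N
  by_cases hp : ∃ i : ℕ, 0 < i ∧ (f ^ (i : ℤ)) c = c
  · obtain ⟨i, hi, hic⟩ := hp
    refine ⟨i * N, by nlinarith, ?_⟩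
    have : ∀ N : ℕ, (f ^ ((i * N : ℕ) : ℤ)) c = c := by
      intro N
      induction N with
      | zero => simp
      | succ k ih =>
        rw [Nat.mul_succ, Nat.cast_add, rc_zadd, hic, ih]
    rw [this]; exact mem_of_mem_nhds hU
  · push Not at hp
    have hO : U ∩ ⋂ j ∈ Icc 1 N, {(f ^ (j : ℤ)) c}ᶜ ∈ 𝓝 c := by
      refine inter_mem hU ?_
      rw [biInter_mem (finite_Icc 1 N)]
      intro j hj
      exact isOpen_compl_singleton.mem_nhds (fun h => hp j hj.1 h.symm)
    obtain ⟨n, hn, h1, h2⟩ := rc_recA hreg f hc hO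
    refine ⟨n, ?_, h1⟩
    by_contra hlt
    push Not at hlt
    exact mem_iInter₂.1 h2 n ⟨hn, hlt.le⟩ rfl

lemma rc_B {X : Type*} [MetricSpace X] [CompactSpace X] [ConnectedSpace X]
    (hreg : RegC X) (f : X ≃ₜ X) {a b s : X} (hb : ∀ t : ℤ, t ≠ 0 → (f ^ t) b ≠ b)
    (h : ∀ δ > (0 : ℝ), ∃ n : ℤ, dist ((f ^ n) b) a < δ ∧ dist ((f ^ (-n)) s) b < δ)
    {ε : ℝ} (hε : 0 < ε) : {m : ℤ | ε ≤ dist ((f ^ m) s) ((f ^ m) a)}.Finite := by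
  by_contra hinf
  obtain ⟨S, hS, hsep⟩ := rc_sep hreg (half_pos hε)
  obtain ⟨T, hT, hcard⟩ := Set.Infinite.exists_subset_card_eq hinf (hS.toFinset.card + 1)
  have hN : ∀ t : ℤ, ∃ N ∈ 𝓝 b, t ≠ 0 → ∀ w ∈ N, (f ^ t) w ∉ N := by
    intro t
    by_cases ht : t = 0
    · exact ⟨univ, univ_mem, fun h => absurd ht h⟩
    · obtain ⟨u, v, hu, hv, hbu, hbv, hd⟩ := t2_separation (hb t ht)
      refine ⟨v ∩ (f ^ t) ⁻¹' u, inter_mem (hv.mem_nhds hbv)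
        ((f ^ t).continuous.continuousAt.preimage_mem_nhds (hu.mem_nhds hbu)), fun _ w hw hw2 => ?_⟩
      exact Set.disjoint_left.1 hd hw.2 hw2.1
  choose N hN1 hN2 using hN
  have hO : ⋂ p ∈ (T ×ˢ T : Finset (ℤ × ℤ)), N (p.1 - p.2) ∈ 𝓝 b := by
    rw [biInter_finset_mem]
    intro p _
    exact hN1 _
  obtain ⟨W, hW, hWO, hWc, -⟩ := rc_nhd hreg b hO
  obtain ⟨δ₁, hδ₁, hball⟩ := Metric.mem_nhds_iff.1 hW
  have hO2 : ⋂ m ∈ T, (f ^ m) ⁻¹' (Metric.ball ((f ^ m) a) (ε/2)) ∈ 𝓝 a := by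
    rw [biInter_finset_mem]
    intro m _
    exact (f ^ m).continuous.continuousAt.preimage_mem_nhds (Metric.ball_mem_nhds _ (half_pos hε))
  obtain ⟨δ₂, hδ₂, hball2⟩ := Metric.mem_nhds_iff.1 hO2
  obtain ⟨n, hn1, hn2⟩ := h (min δ₁ δ₂) (lt_min hδ₁ hδ₂)
  have hsW : (f ^ (-n)) s ∈ W := hball (hn2.trans_le (min_le_left _ _))
  have hnb := hball2 (show (f ^ n) b ∈ Metric.ball a δ₂ from hn1.trans_le (min_le_right _ _))
  have hq : ∀ m ∈ T, ∃ q ∈ S, (f ^ (-(m + n))) q ∈ W := by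
    intro m hm
    by_contra hno
    push Not at hno
    have hWi : IsPreconnected ((f ^ (m + n)) '' W) :=
      hWc.image _ (f ^ (m + n)).continuous.continuousOn
    have h1 := hsep _ hWi (by
      rintro q hqS ⟨w, hw, rfl⟩
      apply hno _ hqS
      rw [← rc_zadd, neg_add_cancel, rc_zz]; exact hw) _ (mem_image_of_mem _ hsW)
      _ (mem_image_of_mem _ (mem_of_mem_nhds hW))
    rw [← rc_zadd, show m + n + -n = m by ring] at h1
    have h2 : dist ((f ^ m) ((f ^ n) b)) ((f ^ m) a) < ε/2 := mem_iInter₂.1 hnb m hm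
    rw [← rc_zadd] at h2
    have h3 : ε ≤ dist ((f ^ m) s) ((f ^ m) a) := hT hm
    have := dist_triangle ((f ^ m) s) ((f ^ (m + n)) b) ((f ^ m) a)
    linarith
  choose! q hqS hqW using hq
  obtain ⟨m, hm, m', hm', hne, heq⟩ := Finset.exists_ne_map_eq_of_card_lt_of_maps_to
    (s := T) (t := hS.toFinset) (by omega) (f := q)
    (fun m hm => by simpa using hqS m hm)
  have e1 := hqW m hm
  have e2 := hqW m' hm'
  rw [← heq] at e2
  have hNm : N (m - m') ∈ 𝓝 b := hN1 _
  have hWN : W ⊆ N (m - m') := fun w hw =>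
    mem_iInter₂.1 (hWO hw) (m, m') (Finset.mem_product.2 ⟨hm, hm'⟩)
  refine hN2 (m - m') (by omega) _ (hWN e1) (hWN ?_)
  rw [← rc_zadd, show m - m' + -(m + n) = -(m' + n) by ring]
  exact e2

lemma rc_P {X : Type*} [MetricSpace X] (f : X ≃ₜ X) {a b : X} {p : ℕ} (hp : 0 < p)
    (hb : (f ^ (p : ℤ)) b = b) (ha : Recu f a)
    (has : Tendsto (fun n : ℕ => dist ((f ^ (n : ℤ)) a) ((f ^ (n : ℤ)) b)) atTop (𝓝 0)) :
    a = b := by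
  have hper : ∀ y, (f ^ (p : ℤ)) y = y → ∀ N : ℕ, (f ^ ((p * N : ℕ) : ℤ)) y = y := by
    intro y hy N
    induction N with
    | zero => simp
    | succ k ih =>
      rw [Nat.mul_succ, Nat.cast_add, rc_zadd, hy, ih]
  have hsmall : ∀ ε > (0 : ℝ), ∃ N : ℕ, ∀ n ≥ N,
      dist ((f ^ (n : ℤ)) a) ((f ^ (n : ℤ)) b) < ε := by
    intro ε hε
    exact eventually_atTop.1 (has.eventually (gt_mem_nhds hε))
  let O : Set X := (fun j : ℕ => (f ^ (j : ℤ)) b) '' Iio p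
  have hO : O.Finite := (finite_Iio p).image _
  have hbO : ∀ n : ℕ, (f ^ (n : ℤ)) b ∈ O := by
    intro n
    refine ⟨n % p, Nat.mod_lt _ hp, ?_⟩
    conv_rhs => rw [← Nat.mod_add_div n p, Nat.cast_add, rc_zadd, hper b hb]
  have haO : a ∈ O := by
    rw [← hO.isClosed.closure_eq, Metric.mem_closure_iff]
    intro δ hδ
    obtain ⟨N, hN⟩ := hsmall (δ/2) (by linarith)
    obtain ⟨n, hn, hna⟩ := ha _ (Metric.ball_mem_nhds a (half_pos hδ)) N
    refine ⟨_, hbO n, ?_⟩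
    have h1 := hN n hn
    rw [Metric.mem_ball] at hna
    have := dist_triangle_left a ((f ^ (n : ℤ)) b) ((f ^ (n : ℤ)) a)
    linarith
  have hap : (f ^ (p : ℤ)) a = a := by
    obtain ⟨j, -, rfl⟩ := haO
    simp only
    rw [← rc_zadd, add_comm, rc_zadd, hb]
  by_contra hne
  obtain ⟨N, hN⟩ := hsmall (dist a b) (dist_pos.2 hne)
  have := hN (p * N) (by nlinarith)
  rw [hper a hap, hper b hb] at this
  exact lt_irrefl _ this

lemma rc_C1 {X : Type*} [MetricSpace X] [CompactSpace X] [ConnectedSpace X]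
    (hreg : RegC X) (f : X ≃ₜ X) {a b : X} {r : ℝ} (hr : 0 < r) (hrab : 2 * r ≤ dist a b)
    {U : Set X} (hU : IsOpen U) (haU : a ∈ U) (hUr : U ⊆ Metric.ball a r) (hrb : Recu f b)
    (has : Tendsto (fun n : ℕ => dist ((f ^ (n : ℤ)) a) ((f ^ (n : ℤ)) b)) atTop (𝓝 0))
    {δ : ℝ} (hδ : 0 < δ) :
    ∃ η > (0 : ℝ), ∃ N : ℕ, ∀ n : ℕ, N ≤ n → dist ((f ^ (n : ℤ)) a) a < η →
      dist ((f ^ (n : ℤ)) b) a < δ ∧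
        ∃ s ∈ frontier U, dist ((f ^ (-(n : ℤ))) s) b < δ := by
  have hsmall : ∀ ε > (0 : ℝ), ∃ N : ℕ, ∀ n ≥ N,
      dist ((f ^ (n : ℤ)) a) ((f ^ (n : ℤ)) b) < ε := by
    intro ε hε
    exact eventually_atTop.1 (has.eventually (gt_mem_nhds hε))
  obtain ⟨W, hW, hWO, hWc, -⟩ := rc_nhd hreg b (Metric.ball_mem_nhds b hδ)
  obtain ⟨N₀, hN₀⟩ := hsmall (r/2) (by linarith)
  obtain ⟨m, hm, hmW, hmr⟩ := hrb _ (inter_mem hW (Metric.ball_mem_nhds b (half_pos hr))) N₀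
  have hma : (f ^ (m : ℤ)) a ∈ (Metric.closedBall a r)ᶜ := by
    have h1 := hN₀ m hm
    rw [Metric.mem_ball] at hmr
    rw [mem_compl_iff, Metric.mem_closedBall]
    intro h2
    have h3 := dist_triangle4 a ((f ^ (m : ℤ)) a) ((f ^ (m : ℤ)) b) b
    rw [dist_comm a ((f ^ (m : ℤ)) a)] at h3
    linarith
  have hO : U ∩ (f ^ (m : ℤ)) ⁻¹' (Metric.closedBall a r)ᶜ ∈ 𝓝 a :=
    inter_mem (hU.mem_nhds haU) ((f ^ (m : ℤ)).continuous.continuousAt.preimage_mem_nhds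
      (Metric.isClosed_closedBall.isOpen_compl.mem_nhds hma))
  obtain ⟨η₀, hη₀, hball⟩ := Metric.mem_nhds_iff.1 hO
  have hη : 0 < min η₀ δ / 2 := half_pos (lt_min hη₀ hδ)
  obtain ⟨N, hN⟩ := hsmall _ hη
  refine ⟨_, hη, N, fun n hn hna => ?_⟩
  have hnb : dist ((f ^ (n : ℤ)) b) a < min η₀ δ := by
    have h1 := hN n hn
    have := dist_triangle_left ((f ^ (n : ℤ)) b) a ((f ^ (n : ℤ)) a)
    linarith
  refine ⟨hnb.trans_le (min_le_right _ _), ?_⟩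
  have h1 := hball (show (f ^ (n : ℤ)) b ∈ Metric.ball a η₀ from hnb.trans_le (min_le_left _ _))
  have hWi : IsPreconnected ((f ^ (n : ℤ)) '' W) :=
    hWc.image _ (f ^ (n : ℤ)).continuous.continuousOn
  obtain ⟨q, ⟨w, hw, rfl⟩, hqF⟩ := rc_meets hWi (mem_image_of_mem _ (mem_of_mem_nhds hW)) h1.1
    (mem_image_of_mem _ hmW) (by
      intro h2
      rw [← rc_zadd, add_comm, rc_zadd] at h2
      exact h1.2 (Metric.ball_subset_closedBall (hUr h2)))
  refine ⟨_, hqF, ?_⟩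
  rw [← rc_zadd, neg_add_cancel, rc_zz]
  exact hWO hw

lemma rc_nonper {X : Type*} [MetricSpace X] (f : X ≃ₜ X) {a b : X} (hne : a ≠ b)
    (ha : Recu f a)
    (has : Tendsto (fun n : ℕ => dist ((f ^ (n : ℤ)) a) ((f ^ (n : ℤ)) b)) atTop (𝓝 0)) :
    ∀ t : ℤ, t ≠ 0 → (f ^ t) b ≠ b := by
  intro t ht h
  refine hne (rc_P f (p := t.natAbs) (by omega) ?_ ha has)
  rcases Int.natAbs_eq t with h1 | h1
  · rw [← h1]; exact h
  · have h2 : ((t.natAbs : ℕ) : ℤ) = -t := by omega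
    rw [h2]
    conv_lhs => rw [← h, ← rc_zadd, neg_add_cancel, rc_zz]

lemma rc_C {X : Type*} [MetricSpace X] [CompactSpace X] [ConnectedSpace X]
    (hreg : RegC X) (f : X ≃ₜ X) {a b c : X} (hab : a ≠ b) (hac : a ≠ c) (hbc : b ≠ c)
    (ha : Recu f a) (hb : Recu f b) (hc : Recu f c)
    (asb : Tendsto (fun n : ℕ => dist ((f ^ (n : ℤ)) a) ((f ^ (n : ℤ)) b)) atTop (𝓝 0))
    (asc : Tendsto (fun n : ℕ => dist ((f ^ (n : ℤ)) a) ((f ^ (n : ℤ)) c)) atTop (𝓝 0)) :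
    False := by
  set r := min (dist a b) (dist a c) / 2 with hr
  have hr0 : 0 < r := half_pos (lt_min (dist_pos.2 hab) (dist_pos.2 hac))
  have hrb : 2 * r ≤ dist a b := by rw [hr]; linarith [min_le_left (dist a b) (dist a c)]
  have hrc : 2 * r ≤ dist a c := by rw [hr]; linarith [min_le_right (dist a b) (dist a c)]
  obtain ⟨U, hU, haU, hUr, hUF⟩ := hreg a r hr0
  have hfreq : ∃ᶠ k : ℕ in atTop, ∃ p ∈ frontier U ×ˢ frontier U, ∃ n : ℕ, k ≤ n ∧
      dist ((f ^ (n : ℤ)) b) a < 1 / ((k : ℝ) + 1) ∧ dist ((f ^ (n : ℤ)) c) a < 1 / ((k : ℝ) + 1) ∧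
      dist ((f ^ (-(n : ℤ))) p.1) b < 1 / ((k : ℝ) + 1) ∧
      dist ((f ^ (-(n : ℤ))) p.2) c < 1 / ((k : ℝ) + 1) := by
    refine Eventually.frequently (Eventually.of_forall fun k => ?_)
    have hk : (0 : ℝ) < 1 / ((k : ℝ) + 1) := by positivity
    obtain ⟨η₁, hη₁, N₁, h₁⟩ := rc_C1 hreg f hr0 hrb hU haU hUr hb asb hk
    obtain ⟨η₂, hη₂, N₂, h₂⟩ := rc_C1 hreg f hr0 hrc hU haU hUr hc asc hk
    obtain ⟨n, hn, hna⟩ := ha _ (Metric.ball_mem_nhds a (lt_min hη₁ hη₂)) (N₁ + N₂ + k)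
    rw [Metric.mem_ball] at hna
    obtain ⟨e1, s, hs, e2⟩ := h₁ n (by omega) (hna.trans_le (min_le_left _ _))
    obtain ⟨e3, s', hs', e4⟩ := h₂ n (by omega) (hna.trans_le (min_le_right _ _))
    exact ⟨(s, s'), ⟨hs, hs'⟩, n, by omega, e1, e3, e2, e4⟩
  rw [frequently_exists_finite (hUF.prod hUF)] at hfreq
  obtain ⟨⟨s, s'⟩, -, hss⟩ := hfreq
  simp only at hss
  have hss2 : ∀ δ > (0 : ℝ), ∀ N : ℕ, ∃ n : ℕ, N ≤ n ∧
      dist ((f ^ (n : ℤ)) b) a < δ ∧ dist ((f ^ (n : ℤ)) c) a < δ ∧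
      dist ((f ^ (-(n : ℤ))) s) b < δ ∧ dist ((f ^ (-(n : ℤ))) s') c < δ := by
    intro δ hδ N
    have hev : ∀ᶠ k : ℕ in atTop, 1 / ((k : ℝ) + 1) < δ ∧ N ≤ k :=
      (tendsto_one_div_add_atTop_nhds_zero_nat.eventually (gt_mem_nhds hδ)).and
        (eventually_ge_atTop N)
    obtain ⟨k, ⟨n, hn, e1, e2, e3, e4⟩, h1, h2⟩ := (hss.and_eventually hev).exists
    exact ⟨n, by omega, e1.trans h1, e2.trans h1, e3.trans h1, e4.trans h1⟩
  have hd : 0 < dist b c / 4 := by have := dist_pos.2 hbc; linarith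
  have B1 := rc_B hreg f (s := s) (a := a) (rc_nonper f hab ha asb) (fun δ hδ => by
    obtain ⟨n, -, e1, -, e3, -⟩ := hss2 δ hδ 0
    exact ⟨n, e1, e3⟩) hd
  have B2 := rc_B hreg f (s := s') (a := a) (rc_nonper f hac ha asc) (fun δ hδ => by
    obtain ⟨n, -, -, e2, -, e4⟩ := hss2 δ hδ 0
    exact ⟨n, e2, e4⟩) hd
  have hinj : Function.Injective (fun n : ℕ => -(n : ℤ)) := fun x y h => by
    simpa using h
  have E1 := (B1.preimage hinj.injOn).eventually_cofinite_notMem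
  have E2 := (B2.preimage hinj.injOn).eventually_cofinite_notMem
  rw [Nat.cofinite_eq_atTop] at E1 E2
  obtain ⟨N, hN⟩ := eventually_atTop.1 (E1.and E2)
  obtain ⟨n, hn, -, -, e3, e4⟩ := hss2 _ hd N
  obtain ⟨h1, h2⟩ := hN n hn
  simp only [mem_preimage, mem_ofPred_eq, not_le] at h1 h2
  have t1 := dist_triangle_left b c ((f ^ (-(n : ℤ))) s)
  have t2 := dist_triangle ((f ^ (-(n : ℤ))) s) ((f ^ (-(n : ℤ))) s') c
  have t3 := dist_triangle_right ((f ^ (-(n : ℤ))) s) ((f ^ (-(n : ℤ))) s') ((f ^ (-(n : ℤ))) a)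
  linarith

lemma rc_fin {X : Type*} [MetricSpace X] (hreg : RegC X) (x : X) {O : Set X} (hO : O ∈ 𝓝 x) :
    ∃ U : Set X, IsOpen U ∧ x ∈ U ∧ closure U ⊆ O ∧ (frontier U).Finite := by
  obtain ⟨ε, hε, hball⟩ := Metric.mem_nhds_iff.1 hO
  obtain ⟨V, hVo, hcV, hVb, hVF⟩ := hreg x (ε/2) (by linarith)
  refine ⟨V, hVo, hcV, ?_, hVF⟩
  intro y hy
  apply hball
  have : y ∈ Metric.closedBall x (ε/2) :=
    closure_minimal (hVb.trans Metric.ball_subset_closedBall) Metric.isClosed_closedBall hy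
  rw [Metric.mem_closedBall] at this
  rw [Metric.mem_ball]; linarith

lemma rc_2a {X : Type*} [TopologicalSpace X] (g : X ≃ₜ X) {D : Set X}
    (hw : ∀ y ∈ D, ∃ U ∈ 𝓝 y, ∀ n : ℤ, n ≠ 0 → ∀ u ∈ U, (g ^ n) u ∉ U)
    {K : Set X} (hK : IsCompact K) (hKD : K ⊆ D) (q : X) :
    ∀ᶠ n : ℕ in atTop, (g ^ (-(n : ℤ))) q ∉ K := by
  by_contra hno
  rw [not_eventually] at hno
  have hw' : ∀ y, ∃ U : Set X, y ∈ K → U ∈ 𝓝 y ∧ ∀ n : ℤ, n ≠ 0 → ∀ u ∈ U, (g ^ n) u ∉ U := by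
    intro y
    by_cases hy : y ∈ K
    · obtain ⟨U, h1, h2⟩ := hw y (hKD hy)
      exact ⟨U, fun _ => ⟨h1, h2⟩⟩
    · exact ⟨univ, fun h => absurd h hy⟩
  choose U hU using hw'
  obtain ⟨t, htK, ht⟩ := hK.elim_nhds_subcover U (fun y hy => (hU y hy).1)
  have hf : ∃ᶠ n : ℕ in atTop, ∃ y ∈ (t : Set X), (g ^ (-(n : ℤ))) q ∈ U y := by
    refine hno.mono fun n hn => ?_
    rw [not_not] at hn
    obtain ⟨y, hy, h⟩ := mem_iUnion₂.1 (ht hn)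
    exact ⟨y, hy, h⟩
  rw [frequently_exists_finite t.finite_toSet] at hf
  obtain ⟨y, hy, hfy⟩ := hf
  rw [frequently_atTop] at hfy
  obtain ⟨n, -, hn⟩ := hfy 0
  obtain ⟨n', hn', hn''⟩ := hfy (n + 1)
  refine (hU y (htK y hy)).2 ((n : ℤ) - n') (by omega) _ hn ?_
  rw [← rc_zadd, show (n : ℤ) - n' + -(n : ℤ) = -(n' : ℤ) by ring]
  exact hn''

lemma rc_2a2 {X : Type*} [TopologicalSpace X] (g : X ≃ₜ X) {D : Set X}
    (hw : ∀ y ∈ D, ∃ U ∈ 𝓝 y, ∀ n : ℤ, n ≠ 0 → ∀ u ∈ U, (g ^ n) u ∉ U)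
    {K : Set X} (hK : IsCompact K) (hKc : IsPreconnected K) (hKD : K ⊆ D) {U : Set X}
    (hU : (frontier U).Finite) :
    ∀ᶠ n : ℕ in atTop, ∀ u ∈ K, ∀ v ∈ K, (g ^ (n : ℤ)) u ∈ U → (g ^ (n : ℤ)) v ∈ U := by
  have h1 : ∀ᶠ n : ℕ in atTop, ∀ q ∈ frontier U, (g ^ (-(n : ℤ))) q ∉ K := by
    rw [eventually_all_finite hU]
    intro q _
    exact rc_2a g hw hK hKD q
  filter_upwards [h1] with n hn u hu v hv huU
  by_contra hvU
  obtain ⟨q, ⟨w, hw, rfl⟩, hq⟩ := rc_meets (hKc.image _ (g ^ (n : ℤ)).continuous.continuousOn)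
    (mem_image_of_mem _ hu) huU (mem_image_of_mem _ hv) hvU
  apply hn _ hq
  rw [← rc_zadd, neg_add_cancel, rc_zz]; exact hw

lemma rc_chain {X : Type*} [MetricSpace X] [CompactSpace X] [ConnectedSpace X]
    (hreg : RegC X) {D : Set X} (hD : IsOpen D) (hDc : IsPreconnected D) {x y : X}
    (hx : x ∈ D) (hy : y ∈ D) :
    ∃ K : Set X, IsCompact K ∧ IsPreconnected K ∧ K ⊆ D ∧ x ∈ K ∧ y ∈ K := by
  refine hDc.induction₂ (fun x y => ∃ K : Set X, IsCompact K ∧ IsPreconnected K ∧ K ⊆ D ∧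
    x ∈ K ∧ y ∈ K) ?_ ?_ ?_ hx hy
  · intro z hz
    obtain ⟨W, hW, hWD, hWc, hWcl⟩ := rc_nhd hreg z (hD.mem_nhds hz)
    filter_upwards [mem_nhdsWithin_of_mem_nhds hW] with y hy
    exact ⟨W, hWcl.isCompact, hWc, hWD, mem_of_mem_nhds hW, hy⟩
  · rintro u v w - - - ⟨K, h1, h2, h3, h4, h5⟩ ⟨L, k1, k2, k3, k4, k5⟩
    exact ⟨K ∪ L, h1.union k1, h2.union v h5 k4 k2, union_subset h3 k3, Or.inl h4, Or.inr k5⟩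
  · rintro u v - - ⟨K, h1, h2, h3, h4, h5⟩
    exact ⟨K, h1, h2, h3, h5, h4⟩

lemma rc_2b {X : Type*} [MetricSpace X] [CompactSpace X] [ConnectedSpace X]
    (hreg : RegC X) (g : X ≃ₜ X) {D : Set X} (hD : IsOpen D) (hDc : IsPreconnected D)
    (hgD : ∀ n : ℤ, ∀ y ∈ D, (g ^ n) y ∈ D)
    (hw : ∀ y ∈ D, ∃ U ∈ 𝓝 y, ∀ n : ℤ, n ≠ 0 → ∀ u ∈ U, (g ^ n) u ∉ U)
    {x : X} (hx : x ∈ D) :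
    ∃ a, ∀ y ∈ D, Tendsto (fun n : ℕ => (g ^ (n : ℤ)) y) atTop (𝓝 a) := by
  obtain ⟨a, ha⟩ := exists_clusterPt_of_compactSpace
    (map (fun n : ℕ => (g ^ (n : ℤ)) x) atTop)
  have ha' : ∀ s ∈ 𝓝 a, ∃ᶠ n : ℕ in atTop, (g ^ (n : ℤ)) x ∈ s :=
    mapClusterPt_iff_frequently.1 ha
  refine ⟨a, fun y hy => ?_⟩
  rw [tendsto_def]
  intro O hO
  obtain ⟨U, hU, haU, hUO, hUF⟩ := rc_fin hreg a hO
  obtain ⟨K, h1, h2, h3, h4, h5⟩ := rc_chain hreg hD hDc hx (hgD 1 x hx)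
  obtain ⟨L, k1, k2, k3, k4, k5⟩ := rc_chain hreg hD hDc hx hy
  have e1 := rc_2a2 g hw h1 h2 h3 hUF
  have e2 := rc_2a2 g hw k1 k2 k3 hUF
  obtain ⟨N, hN⟩ := eventually_atTop.1 e1
  obtain ⟨n, hn, hnU⟩ := frequently_atTop.1 (ha' U (hU.mem_nhds haU)) N
  have hall : ∀ k : ℕ, n ≤ k → (g ^ (k : ℤ)) x ∈ U := by
    intro k hk
    induction k, hk using Nat.le_induction with
    | base => exact hnU
    | succ k hk ih =>
      have := hN k (by omega) _ h4 _ h5 ih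
      rw [← rc_zadd] at this
      exact_mod_cast this
  filter_upwards [e2, eventually_ge_atTop n] with k hk hnk
  exact hUO (subset_closure (hk _ k4 _ k5 (hall k hnk)))

lemma rc_2c {X : Type*} [MetricSpace X] [CompactSpace X] [ConnectedSpace X]
    (hreg : RegC X) (g : X ≃ₜ X) {D : Set X} (hD : IsOpen D) (hDc : IsPreconnected D)
    (hgD : ∀ n : ℤ, ∀ y ∈ D, (g ^ n) y ∈ D) {a b c x : X} (hx : x ∈ D)
    (ha : ∀ y ∈ D, Tendsto (fun n : ℕ => (g ^ (n : ℤ)) y) atTop (𝓝 a))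
    (hb : ∀ y ∈ D, Tendsto (fun n : ℕ => (g ^ (-(n : ℤ))) y) atTop (𝓝 b))
    (hc : c ∈ closure D) (hcD : c ∉ D) (hcb : c ≠ b) :
    Tendsto (fun n : ℕ => (g ^ (n : ℤ)) c) atTop (𝓝 a) := by
  have hO : ({b}ᶜ ∩ {x}ᶜ : Set X) ∈ 𝓝 c :=
    inter_mem (isOpen_compl_singleton.mem_nhds hcb)
      (isOpen_compl_singleton.mem_nhds (fun h => hcD (h ▸ hx)))
  obtain ⟨U, hU, hcU, hUO, hUF⟩ := rc_fin hreg c hO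
  have hbU : b ∉ closure U := fun h => (hUO h).1 rfl
  have hxU : x ∉ U := fun h => (hUO (subset_closure h)).2 rfl
  obtain ⟨U', hU', hcU', hUU', hUF'⟩ := rc_fin hreg c (hU.mem_nhds hcU)
  have := rc_loc hreg
  have hDU : IsOpen (D ∩ U) := hD.inter hU
  have hV : ∀ y ∈ D ∩ U', ∃ s ∈ frontier U', y ∈ connectedComponentIn (D ∩ U) s := by
    intro y hy
    have hyU : y ∈ D ∩ U := ⟨hy.1, hUU' (subset_closure hy.2)⟩
    have hyV : y ∈ connectedComponentIn (D ∩ U) y := mem_connectedComponentIn hyU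
    by_contra hno
    push Not at hno
    have hVU : connectedComponentIn (D ∩ U) y ⊆ U' := by
      intro z hz
      by_contra hzU
      obtain ⟨q, hq, hqF⟩ := rc_meets isPreconnected_connectedComponentIn hyV hy.2 hz hzU
      apply hno q hqF
      rw [← connectedComponentIn_eq hq]; exact hyV
    obtain ⟨q, hqD, hqF⟩ := rc_meets hDc hy.1 hyV hx
      (fun h => hxU (connectedComponentIn_subset _ _ h).2)
    have hqU : q ∈ U := hUU' (closure_mono hVU hqF.1)
    have hpre : IsPreconnected (insert q (connectedComponentIn (D ∩ U) y)) :=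
      isPreconnected_connectedComponentIn.subset_closure (subset_insert _ _)
        (insert_subset hqF.1 subset_closure)
    have hsub : insert q (connectedComponentIn (D ∩ U) y) ⊆ connectedComponentIn (D ∩ U) y :=
      hpre.subset_connectedComponentIn (mem_insert_of_mem _ hyV)
        (insert_subset ⟨hqD, hqU⟩ (connectedComponentIn_subset _ _))
    apply hqF.2
    rw [hDU.connectedComponentIn.interior_eq]
    exact hsub (mem_insert _ _)
  have hc1 : c ∈ closure (⋃ s ∈ frontier U', connectedComponentIn (D ∩ U) s) := by
    have h1 : c ∈ closure (D ∩ U') := by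
      rw [mem_closure_iff_nhds] at hc ⊢
      intro t ht
      obtain ⟨z, hz, hzD⟩ := hc (t ∩ U') (inter_mem ht (hU'.mem_nhds hcU'))
      exact ⟨z, hz.1, hzD, hz.2⟩
    refine closure_mono ?_ h1
    intro y hy
    obtain ⟨s, hs, h⟩ := hV y hy
    exact mem_iUnion₂.2 ⟨s, hs, h⟩
  rw [hUF'.closure_biUnion] at hc1
  obtain ⟨s, -, hcs⟩ := mem_iUnion₂.1 hc1
  set V := connectedComponentIn (D ∩ U) s with hVdef
  have hVc : IsPreconnected V := isPreconnected_connectedComponentIn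
  have hVD : V ⊆ D ∩ U := connectedComponentIn_subset _ _
  obtain ⟨y, hy⟩ : V.Nonempty := closure_nonempty_iff.1 ⟨c, hcs⟩
  by_contra hnt
  rw [not_tendsto_iff_exists_frequently_notMem] at hnt
  obtain ⟨O, hOa, hfr⟩ := hnt
  obtain ⟨A, hA, haA, hAO, hAF⟩ := rc_fin hreg a hOa
  have hev := (ha y (hVD hy).1).eventually (hA.mem_nhds haA)
  have hfr2 : ∃ᶠ n : ℕ in atTop, ∃ q ∈ frontier A, (g ^ (-(n : ℤ))) q ∈ V := by
    refine (hfr.and_eventually hev).mono ?_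
    rintro n ⟨hn1, hn2⟩
    have hex : ∃ v ∈ V, (g ^ (n : ℤ)) v ∉ A := by
      by_contra hno
      push Not at hno
      exact hn1 (hAO (map_mem_closure (g ^ (n : ℤ)).continuous hcs hno))
    obtain ⟨v, hv, hvA⟩ := hex
    obtain ⟨q, ⟨w, hw, rfl⟩, hq⟩ := rc_meets
      (hVc.image _ (g ^ (n : ℤ)).continuous.continuousOn)
      (mem_image_of_mem _ hy) hn2 (mem_image_of_mem _ hv) hvA
    refine ⟨_, hq, ?_⟩
    rw [← rc_zadd, neg_add_cancel, rc_zz]; exact hw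
  rw [frequently_exists_finite hAF] at hfr2
  obtain ⟨q, -, hq⟩ := hfr2
  obtain ⟨n₀, hn₀⟩ := hq.exists
  have hqD : q ∈ D := by
    have := hgD n₀ _ (hVD hn₀).1
    rwa [← rc_zadd, add_neg_cancel, rc_zz] at this
  have hev2 := (hb q hqD).eventually (isClosed_closure.isOpen_compl.mem_nhds hbU)
  obtain ⟨n, h1, h2⟩ := (hq.and_eventually hev2).exists
  exact h2 (subset_closure (hVD h1).2)

lemma rc_wand {X : Type*} [TopologicalSpace X] (f : X ≃ₜ X) (y : X) :
    y ∈ (nonwandering (⇑f))ᶜ ↔ ∃ U ∈ 𝓝 y, ∀ n : ℤ, n ≠ 0 → ∀ u ∈ U, (f ^ n) u ∉ U := by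
  constructor
  · intro hy
    simp only [nonwandering, mem_compl_iff, mem_ofPred_eq] at hy
    push Not at hy
    obtain ⟨U, hU, h⟩ := hy
    have h' : ∀ n : ℕ, 0 < n → ∀ u ∈ U, (f ^ (n : ℤ)) u ∉ U := by
      intro n hn u hu hh
      have : u ∈ (⇑f)^[n] ⁻¹' U ∩ U := ⟨by rw [mem_preimage, rc_iter, ← zpow_natCast]; exact hh, hu⟩
      rw [h n hn] at this
      exact this
    refine ⟨U, hU, fun n hn u hu hh => ?_⟩
    rcases lt_or_gt_of_ne hn with h1 | h1
    · apply h' n.natAbs (by omega) _ hh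
      rw [← rc_zadd, show ((n.natAbs : ℕ) : ℤ) + n = 0 by omega, rc_zz]
      exact hu
    · apply h' n.natAbs (by omega) _ hu
      rw [show ((n.natAbs : ℕ) : ℤ) = n by omega]
      exact hh
  · rintro ⟨U, hU, h⟩ hy
    obtain ⟨n, hn, u, hu1, hu2⟩ := hy U hU
    rw [mem_preimage, rc_iter, ← zpow_natCast] at hu1
    exact h n (by omega) u hu2 hu1

lemma rc_open {X : Type*} [TopologicalSpace X] (f : X ≃ₜ X) :
    IsOpen (nonwandering (⇑f))ᶜ := by
  rw [isOpen_iff_mem_nhds]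
  intro y hy
  obtain ⟨U, hU, h⟩ := (rc_wand f y).1 hy
  filter_upwards [interior_mem_nhds.2 hU] with z hz
  exact (rc_wand f z).2 ⟨U, mem_interior_iff_mem_nhds.1 hz, h⟩

lemma rc_inv {X : Type*} [TopologicalSpace X] (f : X ≃ₜ X) (t : ℤ) {y : X}
    (hy : y ∈ (nonwandering (⇑f))ᶜ) : (f ^ t) y ∈ (nonwandering (⇑f))ᶜ := by
  obtain ⟨U, hU, h⟩ := (rc_wand f y).1 hy
  refine (rc_wand f _).2 ⟨(f ^ (-t)) ⁻¹' U, ?_, ?_⟩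
  · apply (f ^ (-t)).continuous.continuousAt.preimage_mem_nhds
    rw [← rc_zadd, neg_add_cancel, rc_zz]; exact hU
  · intro n hn u hu hh
    apply h n hn _ hu
    rw [← rc_zadd, add_comm, rc_zadd]
    exact hh

lemma rc_comp {X : Type*} [TopologicalSpace X] (f : X ≃ₜ X) (t : ℤ) {x y : X}
    (hx : x ∈ (nonwandering (⇑f))ᶜ)
    (hy : y ∈ connectedComponentIn (nonwandering (⇑f))ᶜ x)
    (hty : (f ^ t) y ∈ connectedComponentIn (nonwandering (⇑f))ᶜ x) :
    ∀ z ∈ connectedComponentIn (nonwandering (⇑f))ᶜ x,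
      (f ^ t) z ∈ connectedComponentIn (nonwandering (⇑f))ᶜ x := by
  intro z hz
  have hpre : IsPreconnected ((f ^ t) '' connectedComponentIn (nonwandering (⇑f))ᶜ x) :=
    isPreconnected_connectedComponentIn.image _ (f ^ t).continuous.continuousOn
  have hsub : (f ^ t) '' connectedComponentIn (nonwandering (⇑f))ᶜ x ⊆ (nonwandering (⇑f))ᶜ := by
    rintro _ ⟨w, hw, rfl⟩
    exact rc_inv f t (connectedComponentIn_subset _ _ hw)
  have := hpre.subset_connectedComponentIn (mem_image_of_mem _ hy) hsub
  rw [← connectedComponentIn_eq hty] at this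
  exact this (mem_image_of_mem _ hz)

lemma rc_case1 {X : Type*} [MetricSpace X] [CompactSpace X]
    (hreg : RegC X) (f : X ≃ₜ X) {D : Set X} (hDc : IsPreconnected D)
    (hdis : ∀ m : ℕ, 0 < m → ∀ y ∈ D, (f ^ (m : ℤ)) y ∉ D) {u v : X}
    (hu : u ∈ closure D) (hv : v ∈ closure D) :
    Tendsto (fun n : ℕ => dist ((f ^ (n : ℤ)) u) ((f ^ (n : ℤ)) v)) atTop (𝓝 0) := by
  rw [Metric.tendsto_atTop]
  intro ε hε
  obtain ⟨S, hS, hsep⟩ := rc_sep hreg (half_pos hε)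
  have hev : ∀ᶠ n : ℕ in atTop, ∀ s ∈ S, s ∉ (f ^ (n : ℤ)) '' D := by
    rw [eventually_all_finite hS]
    intro s _
    by_cases hs : ∃ n : ℕ, s ∈ (f ^ (n : ℤ)) '' D
    · obtain ⟨n, w, hw, rfl⟩ := hs
      filter_upwards [eventually_gt_atTop n] with k hk
      rintro ⟨z, hz, hzw⟩
      apply hdis (k - n) (by omega) z hz
      have : (f ^ (-(n : ℤ))) ((f ^ (k : ℤ)) z) = w := by
        rw [hzw, ← rc_zadd, neg_add_cancel, rc_zz]
      rw [← rc_zadd] at this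
      rw [show ((k - n : ℕ) : ℤ) = -(n : ℤ) + k by omega, this]
      exact hw
    · push Not at hs
      exact Eventually.of_forall hs
  obtain ⟨N, hN⟩ := eventually_atTop.1 hev
  refine ⟨N, fun n hn => ?_⟩
  have h1 := hsep _ (hDc.image _ (f ^ (n : ℤ)).continuous.continuousOn) (hN n hn)
  have h2 : ∀ v ∈ D, ∀ u ∈ closure D, dist ((f ^ (n : ℤ)) u) ((f ^ (n : ℤ)) v) ≤ ε/2 := by
    intro v hv
    have hcl : IsClosed {u | dist ((f ^ (n : ℤ)) u) ((f ^ (n : ℤ)) v) ≤ ε/2} :=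
      isClosed_le ((f ^ (n : ℤ)).continuous.dist continuous_const) continuous_const
    exact closure_minimal (fun u hu => (h1 _ (mem_image_of_mem _ hu) _
      (mem_image_of_mem _ hv)).le) hcl
  have h3 : dist ((f ^ (n : ℤ)) u) ((f ^ (n : ℤ)) v) ≤ ε/2 := by
    have hcl : IsClosed {v | dist ((f ^ (n : ℤ)) u) ((f ^ (n : ℤ)) v) ≤ ε/2} :=
      isClosed_le (continuous_const.dist (f ^ (n : ℤ)).continuous) continuous_const
    exact closure_minimal (fun v hv => h2 v hv u hu) hcl hv
  rw [Real.dist_eq, sub_zero, abs_of_nonneg dist_nonneg]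
  linarith

lemma rc_resid {X : Type*} [MetricSpace X] (f : X ≃ₜ X) {m : ℕ} (hm : 0 < m) {a c : X}
    (ha : (f ^ (m : ℤ)) a = a)
    (hc : Tendsto (fun n : ℕ => ((f ^ (m : ℤ)) ^ (n : ℤ)) c) atTop (𝓝 a)) :
    Tendsto (fun n : ℕ => dist ((f ^ (n : ℤ)) c) ((f ^ (n : ℤ)) a)) atTop (𝓝 0) := by
  have hper : ∀ N : ℕ, (f ^ ((m * N : ℕ) : ℤ)) a = a := by
    intro N
    induction N with
    | zero => simp
    | succ k ih =>
      rw [Nat.mul_succ, Nat.cast_add, rc_zadd, ha, ih]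
  rw [Metric.tendsto_atTop]
  intro ε hε
  have hO : ⋂ r ∈ Iio m, (f ^ (r : ℤ)) ⁻¹' Metric.ball ((f ^ (r : ℤ)) a) ε ∈ 𝓝 a := by
    rw [biInter_mem (finite_Iio m)]
    intro r _
    exact (f ^ (r : ℤ)).continuous.continuousAt.preimage_mem_nhds (Metric.ball_mem_nhds _ hε)
  obtain ⟨N, hN⟩ := eventually_atTop.1 (hc.eventually hO)
  refine ⟨m * N, fun n hn => ?_⟩
  rw [Real.dist_eq, sub_zero, abs_of_nonneg dist_nonneg]
  have h1 := hN (n / m) ((Nat.le_div_iff_mul_le hm).2 (by rw [mul_comm]; exact hn))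
  have h2 : dist ((f ^ ((n % m : ℕ) : ℤ)) (((f ^ (m : ℤ)) ^ ((n / m : ℕ) : ℤ)) c))
      ((f ^ ((n % m : ℕ) : ℤ)) a) < ε := mem_iInter₂.1 h1 (n % m) (Nat.mod_lt _ hm)
  rw [← zpow_mul, ← rc_zadd] at h2
  have e1 : ((n % m : ℕ) : ℤ) + (m : ℤ) * ((n / m : ℕ) : ℤ) = n := by
    exact_mod_cast Nat.mod_add_div n m
  have e2 : (f ^ (n : ℤ)) a = (f ^ ((n % m : ℕ) : ℤ)) a := by
    rw [← e1, rc_zadd]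
    have := hper (n / m)
    push_cast at this ⊢
    rw [this]
  rw [e1] at h2
  rw [e2]
  exact h2

lemma rc_main {X : Type*} [MetricSpace X] [CompactSpace X] [ConnectedSpace X]
    (hreg : RegC X) (f : X ≃ₜ X) (x : X) (hx : x ∈ (nonwandering (⇑f))ᶜ) :
    ∃ a b : X, closure (connectedComponentIn (nonwandering (⇑f))ᶜ x) ∩ nonwandering (⇑f)
      ⊆ {a, b} := by
  have := rc_loc hreg
  set D := connectedComponentIn (nonwandering (⇑f))ᶜ x with hDdef
  have hD : IsOpen D := (rc_open f).connectedComponentIn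
  have hDc : IsPreconnected D := isPreconnected_connectedComponentIn
  have hxD : x ∈ D := mem_connectedComponentIn hx
  have hDO : D ⊆ (nonwandering (⇑f))ᶜ := connectedComponentIn_subset _ _
  by_cases hcase : ∃ m : ℕ, 0 < m ∧ ∃ y ∈ D, (f ^ (m : ℤ)) y ∈ D
  · obtain ⟨m, hm, y, hy, hmy⟩ := hcase
    set g := f ^ (m : ℤ) with hg
    have hgD1 : ∀ z ∈ D, g z ∈ D := rc_comp f m hx hy hmy
    have hgD2 : ∀ z ∈ D, (f ^ (-(m : ℤ))) z ∈ D := by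
      refine rc_comp f (-(m : ℤ)) hx hmy ?_
      rw [← rc_zadd, neg_add_cancel, rc_zz]; exact hy
    have hgD : ∀ n : ℤ, ∀ y ∈ D, (g ^ n) y ∈ D := by
      intro n
      induction n using Int.induction_on with
      | zero => intro y hy; rw [rc_zz]; exact hy
      | succ k ih =>
        intro y hy
        rw [rc_zadd]; exact ih _ (by rw [zpow_one]; exact hgD1 y hy)
      | pred k ih =>
        intro y hy
        rw [sub_eq_add_neg, rc_zadd]
        refine ih _ ?_
        rw [hg, ← zpow_mul, mul_neg_one]
        exact hgD2 y hy
    have hw : ∀ y ∈ D, ∃ U ∈ 𝓝 y, ∀ n : ℤ, n ≠ 0 → ∀ u ∈ U, (g ^ n) u ∉ U := by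
      intro y hy
      obtain ⟨U, hU, h⟩ := (rc_wand f y).1 (hDO hy)
      refine ⟨U, hU, fun n hn u hu => ?_⟩
      rw [hg, ← zpow_mul]
      exact h _ (mul_ne_zero (by omega) hn) u hu
    obtain ⟨a, ha⟩ := rc_2b hreg g hD hDc hgD hw hxD
    obtain ⟨b, hb⟩ := rc_2b hreg g⁻¹ hD hDc
      (fun n y hy => by rw [inv_zpow']; exact hgD (-n) y hy)
      (fun y hy => by
        obtain ⟨U, hU, h⟩ := hw y hy
        exact ⟨U, hU, fun n hn u hu => by
          rw [inv_zpow']; exact h (-n) (neg_ne_zero.2 hn) u hu⟩) hxD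
    simp only [inv_zpow'] at hb
    have hga : g a = a := by
      have h1 := ha _ (hgD1 x hxD)
      have h2 : Tendsto (fun n : ℕ => g ((g ^ (n : ℤ)) x)) atTop (𝓝 (g a)) :=
        (g.continuous.tendsto a).comp (ha x hxD)
      refine tendsto_nhds_unique h2 (h1.congr fun n => ?_)
      have e1 := rc_zadd g n 1 x
      have e2 := rc_zadd g 1 n x
      rw [zpow_one] at e1 e2
      rw [← e1, ← e2, add_comm]
    refine ⟨a, b, ?_⟩
    rintro c ⟨hc, hcO⟩
    by_cases hcb : c = b
    · right; exact hcb
    · left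
      have hcD : c ∉ D := fun h => hDO h hcO
      have h1 := rc_2c hreg g hD hDc hgD hxD ha hb hc hcD hcb
      exact rc_P f hm hga (rc_rec hreg f hcO) (rc_resid f hm hga h1)
  · push Not at hcase
    by_contra hno
    push Not at hno
    obtain ⟨a, ha, -⟩ := not_subset.1 (hno x x)
    obtain ⟨b, hb, hba⟩ := not_subset.1 (hno a a)
    obtain ⟨c, hc, hcab⟩ := not_subset.1 (hno a b)
    simp only [mem_insert_iff, mem_singleton_iff, not_or] at hba hcab
    exact rc_C hreg f (Ne.symm hba.1) (Ne.symm hcab.1) (Ne.symm hcab.2)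
      (rc_rec hreg f ha.2) (rc_rec hreg f hb.2) (rc_rec hreg f hc.2)
      (rc_case1 hreg f hDc hcase ha.1 hb.1) (rc_case1 hreg f hDc hcase ha.1 hc.1)

end RcAux

/-- If `f` is a homeomorphism of a regular curve `X` and `D` is a connected component of
`X \ Ω(f)`, then `closure D` meets `Ω(f)` in at most two points. -/
theorem closure_component_meets_nonwandering_in_at_most_two {X : Type*}
    [MetricSpace X] [CompactSpace X] [ConnectedSpace X] [Nonempty X]
    (hreg : ∀ x : X, ∀ ε > (0 : ℝ), ∃ U : Set X,
      IsOpen U ∧ x ∈ U ∧ U ⊆ Metric.ball x ε ∧ (frontier U).Finite)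
    (f : X ≃ₜ X) (x : X) (hx : x ∈ (nonwandering (⇑f))ᶜ) :
    ∃ a b : X, closure (connectedComponentIn (nonwandering (⇑f))ᶜ x) ∩ nonwandering (⇑f)
      ⊆ {a, b} := by
  exact rc_main hreg f x hx
end

section
/- Let f : X → X be a homeomorphism of a regular curve X and D a connected component of X \ Ω(f) whose closure contains a non-periodic point of Ω(f). Then the family {fⁿ(closure(D)) : n ∈ ℤ} is pairwise disjoint, and hence its diameters tend to 0 as |n| → ∞. -/
open Filter

open Topology Set

/-- A preconnected set that meets an open set and misses its frontier is contained in it. -/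
lemma preconn_subset_of_frontier {X : Type*} [TopologicalSpace X] {S U : Set X}
    (hS : IsPreconnected S) (hU : IsOpen U) (h1 : (S ∩ U).Nonempty)
    (h2 : Disjoint S (frontier U)) : S ⊆ U := by
  apply hS.subset_left_of_subset_union hU (isClosed_closure (s := U)).isOpen_compl
    (Set.disjoint_left.2 fun x hx hx' => hx' (subset_closure hx)) _ h1
  intro x hx
  by_cases hxU : x ∈ U
  · exact Or.inl hxU
  · right
    intro hc
    exact Set.disjoint_left.1 h2 hx ⟨hc, by rwa [hU.interior_eq]⟩

/-- Finite set meeting all connected sets of diameter larger than `ε`. -/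
lemma mesh {X : Type*} [MetricSpace X] [CompactSpace X]
    (hreg : ∀ x : X, ∀ ε > (0 : ℝ), ∃ U : Set X,
      IsOpen U ∧ x ∈ U ∧ U ⊆ Metric.ball x ε ∧ (frontier U).Finite)
    (ε : ℝ) (hε : 0 < ε) :
    ∃ F : Set X, F.Finite ∧ ∀ S : Set X, IsPreconnected S → Disjoint S F →
      ∀ x ∈ S, ∀ y ∈ S, dist x y ≤ ε := by
  choose U hUo hxU hUb hUf using fun x => hreg x (ε / 2) (by positivity)
  obtain ⟨t, ht⟩ := isCompact_univ.elim_finite_subcover U hUo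
    (fun x _ => Set.mem_iUnion.2 ⟨x, hxU x⟩)
  refine ⟨⋃ i ∈ t, frontier (U i), t.finite_toSet.biUnion fun i _ => hUf i, ?_⟩
  intro S hS hd x hx y hy
  obtain ⟨i, hi, hxi⟩ : ∃ i ∈ t, x ∈ U i := by simpa using ht (Set.mem_univ x)
  have hsub : S ⊆ U i := preconn_subset_of_frontier hS (hUo i) ⟨x, hx, hxi⟩
    (hd.mono_right (Set.subset_biUnion_of_mem (u := fun i => frontier (U i)) hi))
  have h1 := hUb i (hsub hx)
  have h2 := hUb i (hsub hy)
  rw [Metric.mem_ball] at h1 h2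
  have := dist_triangle_right x y i
  linarith

/-- Regular curves are locally connected. -/
lemma loc_conn {X : Type*} [MetricSpace X] [CompactSpace X] [ConnectedSpace X]
    (hreg : ∀ x : X, ∀ ε > (0 : ℝ), ∃ U : Set X,
      IsOpen U ∧ x ∈ U ∧ U ⊆ Metric.ball x ε ∧ (frontier U).Finite)
    (x : X) (W : Set X) (hW : W ∈ 𝓝 x) : ∃ V ∈ 𝓝 x, IsPreconnected V ∧ V ⊆ W := by
  obtain ⟨ε, hε, hεW⟩ := Metric.nhds_basis_closedBall.mem_iff.1 hW
  obtain ⟨U, hUo, hxU, hUb, hUf⟩ := hreg x ε hε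
  have hcl : closure U ⊆ W := by
    refine (closure_mono hUb).trans (Metric.closure_ball_subset_closedBall.trans hεW)
  -- relatively clopen subsets of `closure U` containing `x`
  let P : Set X → Prop := fun Q => IsClosed Q ∧ Q ⊆ closure U ∧ x ∈ Q ∧
    IsClosed (closure U \ Q)
  have hP0 : ∃ k, ∃ Q, P Q ∧ (Q ∩ frontier U).ncard = k :=
    ⟨_, closure U, ⟨isClosed_closure, Subset.rfl, subset_closure hxU, by simp⟩, rfl⟩
  classical
  obtain ⟨Q, ⟨hQc, hQs, hxQ, hQc'⟩, hQk⟩ := Nat.find_spec hP0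
  have hmin : ∀ Q', P Q' → (Q ∩ frontier U).ncard ≤ (Q' ∩ frontier U).ncard := by
    intro Q' hQ'
    rw [hQk]
    exact Nat.find_min' hP0 ⟨Q', hQ', rfl⟩
  refine ⟨Q, ?_, ?_, hQs.trans hcl⟩
  · have : U ∩ (closure U \ Q)ᶜ ∈ 𝓝 x :=
      (hUo.inter hQc'.isOpen_compl).mem_nhds ⟨hxU, fun h => h.2 hxQ⟩
    refine mem_of_superset this ?_
    rintro y ⟨hyU, hy⟩
    by_contra hyQ
    exact hy ⟨subset_closure hyU, hyQ⟩
  · -- a splitting with `x ∈ A` is impossible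
    have key : ∀ A B : Set X, IsClosed A → IsClosed B → Q = A ∪ B → Disjoint A B →
        x ∈ A → B = ∅ := by
      intro A B hA hB hAB hd hxA
      by_contra hBne
      have hBn : B.Nonempty := Set.nonempty_iff_ne_empty.2 hBne
      have hPA : P A := by
        refine ⟨hA, fun y hy => hQs (hAB ▸ Or.inl hy), hxA, ?_⟩
        have : closure U \ A = (closure U \ Q) ∪ B := by
          ext y
          constructor
          · rintro ⟨h1, h2⟩
            by_cases hyQ : y ∈ Q
            · rw [hAB] at hyQ
              exact Or.inr (hyQ.resolve_left h2)
            · exact Or.inl ⟨h1, hyQ⟩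
          · rintro (⟨h1, h2⟩ | h)
            · exact ⟨h1, fun h => h2 (hAB ▸ Or.inl h)⟩
            · exact ⟨hQs (hAB ▸ Or.inr h), fun h' => Set.disjoint_left.1 hd h' h⟩
        rw [this]
        exact hQc'.union hB
      have h1 := hmin A hPA
      by_cases hBf : (B ∩ frontier U).Nonempty
      · obtain ⟨b, hbB, hbU⟩ := hBf
        have hss : A ∩ frontier U ⊂ Q ∩ frontier U := by
          refine ⟨fun y hy => ⟨hAB ▸ Or.inl hy.1, hy.2⟩, fun h => ?_⟩
          exact Set.disjoint_left.1 hd (h ⟨hAB ▸ Or.inr hbB, hbU⟩).1 hbB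
        have := Set.ncard_lt_ncard hss (hUf.subset Set.inter_subset_right)
        omega
      · have hBo : IsOpen B := by
          have : B = U ∩ ((closure U \ Q) ∪ A)ᶜ := by
            ext y
            constructor
            · intro hy
              have hyQ : y ∈ Q := hAB ▸ Or.inr hy
              refine ⟨?_, ?_⟩
              · by_contra hyU
                exact hBf ⟨y, hy, hQs hyQ, by rwa [hUo.interior_eq]⟩
              · rintro (h | h)
                · exact h.2 hyQ
                · exact Set.disjoint_left.1 hd h hy
            · rintro ⟨hyU, hy⟩
              have hyQ : y ∈ Q := by
                by_contra hyQ
                exact hy (Or.inl ⟨subset_closure hyU, hyQ⟩)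
              rw [hAB] at hyQ
              exact hyQ.resolve_left fun h => hy (Or.inr h)
          rw [this]
          exact hUo.inter (hQc'.union hA).isOpen_compl
        have : B = univ := IsClopen.eq_univ ⟨hB, hBo⟩ hBn
        exact Set.disjoint_left.1 hd hxA (this ▸ Set.mem_univ x)
    rw [isPreconnected_closed_iff]
    intro A B hA hB hQAB hQA hQB
    by_contra hne
    have hd : Disjoint (Q ∩ A) (Q ∩ B) := by
      rw [Set.disjoint_left]
      rintro y ⟨h1, h2⟩ ⟨_, h3⟩
      exact hne ⟨y, h1, h2, h3⟩
    have hu : Q = (Q ∩ A) ∪ (Q ∩ B) := by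
      rw [← Set.inter_union_distrib_left]
      exact (Set.inter_eq_left.2 hQAB).symm
    rcases hQAB hxQ with h | h
    · exact hQB.ne_empty (key _ _ (hQc.inter hA) (hQc.inter hB) hu hd ⟨hxQ, h⟩)
    · exact hQA.ne_empty (key _ _ (hQc.inter hB) (hQc.inter hA) (by rw [Set.union_comm]; exact hu)
        hd.symm ⟨hxQ, h⟩)

/-- Pairwise disjoint families of connected sets are null. -/
lemma null_family {X : Type*} [MetricSpace X] [CompactSpace X]
    (hreg : ∀ x : X, ∀ ε > (0 : ℝ), ∃ U : Set X,
      IsOpen U ∧ x ∈ U ∧ U ⊆ Metric.ball x ε ∧ (frontier U).Finite)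
    (E : ℤ → Set X) (hE : ∀ n, IsPreconnected (E n))
    (hd : ∀ m k, m ≠ k → Disjoint (E m) (E k)) (ε : ℝ) (hε : 0 < ε) :
    ∀ᶠ n in cofinite, ∀ x ∈ E n, ∀ y ∈ E n, dist x y ≤ ε := by
  obtain ⟨F, hF, hFS⟩ := mesh hreg ε hε
  have : {n | ¬ Disjoint (E n) F}.Finite := by
    have h2 : {n | ¬ Disjoint (E n) F} ⊆ ⋃ c ∈ F, {n | c ∈ E n} := by
      intro n hn
      obtain ⟨c, hc, hcF⟩ := Set.not_disjoint_iff.1 hn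
      simp only [Set.mem_iUnion]
      exact ⟨c, hcF, hc⟩
    refine (hF.biUnion fun c _ => Set.Subsingleton.finite ?_).subset h2
    intro m hm k hk
    by_contra hmk
    exact Set.disjoint_left.1 (hd m k hmk) hm hk
  have h3 : ∀ᶠ n in cofinite, Disjoint (E n) F := by
    rw [Filter.eventually_cofinite]
    exact this
  filter_upwards [h3] with n hn
  exact hFS _ (hE n) hn

/-- Along an ultrafilter of iterates, `ε`-equicontinuity holds off a finite set. -/
lemma equi_off_finite {X : Type*} [MetricSpace X] [CompactSpace X] [ConnectedSpace X]
    (hreg : ∀ x : X, ∀ ε > (0 : ℝ), ∃ U : Set X,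
      IsOpen U ∧ x ∈ U ∧ U ⊆ Metric.ball x ε ∧ (frontier U).Finite)
    (T : ℤ → X → X) (hc : ∀ n, Continuous (T n))
    (hinv : ∀ n x, T (-n) (T n x) = x)
    {ι : Type*} (𝒰 : Ultrafilter ι) (n : ι → ℤ) (ε : ℝ) (hε : 0 < ε) :
    ∃ Z : Set X, Z.Finite ∧ ∀ x ∉ Z, ∃ N ∈ 𝓝 x, ∀ᶠ i in (𝒰 : Filter ι),
      ∀ y ∈ N, ∀ z ∈ N, dist (T (n i) y) (T (n i) z) ≤ ε := by
  obtain ⟨F, hF, hFS⟩ := mesh hreg ε hε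
  have hlim : ∀ c : X, ∃ z, Tendsto (fun i => T (-(n i)) c) (𝒰 : Filter ι) (𝓝 z) := by
    intro c
    obtain ⟨z, -, hz⟩ := isCompact_univ.ultrafilter_le_nhds
      (𝒰.map fun i => T (-(n i)) c) (by simp)
    exact ⟨z, hz⟩
  choose z hz using hlim
  refine ⟨z '' F, hF.image z, ?_⟩
  intro x hx
  have hO : (z '' F)ᶜ ∈ 𝓝 x := (hF.image z).isClosed.isOpen_compl.mem_nhds hx
  obtain ⟨W, hW, hWc, hWO⟩ := exists_mem_nhds_isClosed_subset hO
  obtain ⟨N, hN, hNc, hNW⟩ := loc_conn hreg x W hW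
  refine ⟨N, hN, ?_⟩
  have h1 : ∀ᶠ i in (𝒰 : Filter ι), ∀ c ∈ F, T (-(n i)) c ∉ W := by
    rw [Filter.eventually_all_finite hF]
    intro c hcF
    have : Wᶜ ∈ 𝓝 (z c) :=
      hWc.isOpen_compl.mem_nhds fun h => hWO h ⟨c, hcF, rfl⟩
    exact hz c this
  filter_upwards [h1] with i hi y hy w hw
  refine hFS (T (n i) '' N) (hNc.image _ (hc _).continuousOn) ?_ _ ⟨y, hy, rfl⟩ _ ⟨w, hw, rfl⟩
  rw [Set.disjoint_left]
  rintro _ ⟨u, hu, rfl⟩ huF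
  have := hi _ huF
  rw [hinv] at this
  exact this (hNW hu)

/-- Nonwandering, nonperiodic points are recurrent (in one of the two directions). -/
lemma recurrent_of_nonwandering {X : Type*} [MetricSpace X] [CompactSpace X] [ConnectedSpace X]
    (hreg : ∀ x : X, ∀ ε > (0 : ℝ), ∃ U : Set X,
      IsOpen U ∧ x ∈ U ∧ U ⊆ Metric.ball x ε ∧ (frontier U).Finite)
    (T : ℤ → X → X) (hc : ∀ n, Continuous (T n))
    (h0 : ∀ x, T 0 x = x) (hadd : ∀ m n x, T (m + n) x = T m (T n x))
    (a : X) (hnp : ∀ n, n ≠ 0 → T n a ≠ a)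
    (hnw : ∀ U ∈ 𝓝 a, ∃ n, n ≠ 0 ∧ ∃ v ∈ U, T n v ∈ U) :
    ∃ 𝒱 : Ultrafilter ℤ, (𝒱 : Filter ℤ) ≤ cofinite ∧ Tendsto (fun n => T n a) 𝒱 (𝓝 a) := by
  have hinv : ∀ n x, T (-n) (T n x) = x := by
    intro n x; rw [← hadd, neg_add_cancel, h0]
  have hinv' : ∀ n x, T n (T (-n) x) = x := by
    intro n x; rw [← hadd, add_neg_cancel, h0]
  have hinj : Function.Injective fun n => T n a := by
    intro m k hmk
    by_contra hne
    apply hnp (-k + m) (by omega)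
    rw [hadd]
    simp only at hmk
    rw [hmk, hinv]
  by_contra hcon
  -- `a` is isolated from its orbit
  have hr : ∃ r > 0, ∀ᶠ n in cofinite, r ≤ dist (T n a) a := by
    by_contra hr
    push Not at hr
    apply hcon
    have : MapClusterPt a cofinite (fun n => T n a) := by
      rw [mapClusterPt_iff_frequently]
      intro s hs
      obtain ⟨r, hr0, hrs⟩ := Metric.mem_nhds_iff.1 hs
      exact (hr r hr0).mono fun n hn => hrs hn
    obtain ⟨𝒱, h1, h2⟩ := mapClusterPt_iff_ultrafilter.1 this
    exact ⟨𝒱, h1, h2⟩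
  obtain ⟨r, hr0, hr⟩ := hr
  -- the ultrafilter of returns
  have hfar : ∀ n, n ≠ 0 → ∃ V ∈ 𝓝 a, ∀ v ∈ V, T n v ∉ V := by
    intro n hn
    obtain ⟨A, B, hA', hB', hAB'⟩ := t2_separation_nhds (hnp n hn)
    refine ⟨B ∩ T n ⁻¹' A, inter_mem hB' ((hc n).continuousAt.preimage_mem_nhds hA'), ?_⟩
    rintro v ⟨_, h1⟩ ⟨h2, _⟩
    exact Set.disjoint_left.1 hAB' h1 h2
  choose! V hV hVT using hfar
  have hret : ∀ U ∈ 𝓝 a, ∀ Q : Set ℤ, Q.Finite → ∃ n ∉ Q, ∃ v ∈ U, T n v ∈ U := by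
    intro U hU Q hQ
    have : U ∩ ⋂ n ∈ Q \ {0}, V n ∈ 𝓝 a := by
      refine inter_mem hU ((biInter_mem (hQ.subset Set.sdiff_subset)).2 ?_)
      exact fun n hn => hV n hn.2
    obtain ⟨n, hn, v, ⟨hvU, hv⟩, hnvU, hnv⟩ := hnw _ this
    refine ⟨n, fun hnQ => ?_, v, hvU, hnvU⟩
    have hm : n ∈ Q \ {0} := ⟨hnQ, hn⟩
    exact hVT n hn v (Set.mem_iInter₂.1 hv n hm) (Set.mem_iInter₂.1 hnv n hm)
  let G : Filter (ℤ × X) := (cofinite ×ˢ 𝓝 a) ⊓ comap (fun p => T p.1 p.2) (𝓝 a)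
  have hG : G.NeBot := by
    rw [Filter.inf_neBot_iff]
    intro S hS S' hS'
    obtain ⟨t, ht, ht'⟩ := Filter.mem_comap.1 hS'
    obtain ⟨Q, hQ, U, hU, hQU⟩ := Filter.mem_prod_iff.1 hS
    obtain ⟨n, hn, v, hv, hnv⟩ := hret (U ∩ t) (inter_mem hU ht) Qᶜ hQ
    exact ⟨(n, v), hQU ⟨not_not.1 hn, hv.1⟩, ht' hnv.2⟩
  let 𝒰 : Ultrafilter (ℤ × X) := Ultrafilter.of G
  have h𝒰 : (𝒰 : Filter (ℤ × X)) ≤ G := Ultrafilter.of_le G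
  have hfst : Tendsto (fun p : ℤ × X => p.1) 𝒰 cofinite :=
    tendsto_fst.mono_left (h𝒰.trans inf_le_left)
  have hsnd : Tendsto (fun p : ℤ × X => p.2) 𝒰 (𝓝 a) :=
    tendsto_snd.mono_left (h𝒰.trans inf_le_left)
  have hT : Tendsto (fun p : ℤ × X => T p.1 p.2) 𝒰 (𝓝 a) :=
    tendsto_comap.mono_left (h𝒰.trans inf_le_right)
  have hneg : Tendsto (fun p : ℤ × X => -p.1) 𝒰 cofinite :=
    (neg_injective.tendsto_cofinite).comp hfst
  -- a point `c` whose backward orbit accumulates at `a`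
  obtain ⟨F, hF, hFS⟩ := mesh hreg (r / 4) (by positivity)
  have hcc : ∃ c ∈ F, Tendsto (fun p : ℤ × X => T (-p.1) c) 𝒰 (𝓝 a) := by
    by_contra hno
    have hno' : ∀ c ∈ F, ∃ W ∈ 𝓝 a, ∀ᶠ p in (𝒰 : Filter (ℤ × X)), T (-p.1) c ∉ W := by
      intro c hcF
      by_contra h
      push Not at h
      refine hno ⟨c, hcF, fun W hW => ?_⟩
      exact h W hW
    choose! W hW hWT using hno'
    obtain ⟨N, hN, hNc, hNW⟩ := loc_conn hreg a ((⋂ c ∈ F, W c) ∩ Metric.ball a (r / 4))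
      (inter_mem ((biInter_mem hF).2 hW) (Metric.ball_mem_nhds a (by positivity)))
    have h1 : ∀ᶠ p in (𝒰 : Filter (ℤ × X)), ∀ c ∈ F, T (-p.1) c ∉ W c := by
      rw [Filter.eventually_all_finite hF]
      exact hWT
    obtain ⟨p, hp1, hp2, hp3, hp4⟩ :=
      (h1.and ((hsnd.eventually_mem hN).and ((hT.eventually_mem hN).and (hfst.eventually hr)))).exists
    have hdis : Disjoint (T p.1 '' N) F := by
      rw [Set.disjoint_left]
      rintro _ ⟨u, hu, rfl⟩ huF
      have := hp1 _ huF
      rw [hinv] at this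
      exact this (Set.mem_iInter₂.1 (hNW hu).1 _ huF)
    have h2 := hFS _ (hNc.image _ (hc _).continuousOn) hdis _ ⟨a, mem_of_mem_nhds hN, rfl⟩
      _ ⟨p.2, hp2, rfl⟩
    have h3 : dist (T p.1 p.2) a < r / 4 := (hNW hp3).2
    have := dist_triangle (T p.1 a) (T p.1 p.2) a
    linarith
  obtain ⟨c, -, hca⟩ := hcc
  obtain ⟨Z, hZ, hZN⟩ := equi_off_finite hreg T hc hinv 𝒰 (fun p => p.1) (r / 8) (by positivity)
  have hclose : ∀ s, T s a ∉ Z → dist (T s c) (T s a) ≤ r / 4 := by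
    intro s hs
    obtain ⟨N, hN, hNe⟩ := hZN _ hs
    have hN' : T s ⁻¹' N ∈ 𝓝 a := (hc s).continuousAt.preimage_mem_nhds hN
    have hB : T s ⁻¹' (Metric.ball (T s a) (r / 8)) ∈ 𝓝 a :=
      (hc s).continuousAt.preimage_mem_nhds (Metric.ball_mem_nhds _ (by positivity))
    obtain ⟨p, h1, h2, h3, h4⟩ :=
      (hNe.and ((hsnd.eventually_mem hN').and ((hT.eventually_mem hB).and (hca.eventually_mem hN')))).exists
    have h5 := h1 _ h4 _ h2
    have e1 : T p.1 (T s (T (-p.1) c)) = T s c := by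
      rw [← hadd, ← hadd]; congr 1; ring
    have e2 : T p.1 (T s p.2) = T s (T p.1 p.2) := by
      rw [← hadd, ← hadd, add_comm]
    rw [e1, e2] at h5
    have h6 : dist (T s (T p.1 p.2)) (T s a) < r / 8 := h3
    have := dist_triangle (T s c) (T s (T p.1 p.2)) (T s a)
    linarith
  have hZ' : ∀ᶠ s in cofinite, T s a ∉ Z := by
    rw [Filter.eventually_cofinite]
    simp only [not_not]
    exact hZ.preimage hinj.injOn
  obtain ⟨p, h1, h2, h3⟩ := ((hneg.eventually hZ').and ((hneg.eventually hr).and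
    (hca.eventually_mem (Metric.ball_mem_nhds a (show 0 < r / 4 by positivity))))).exists
  have h4 := hclose _ h1
  have h5 : dist (T (-p.1) c) a < r / 4 := h3
  have := dist_triangle_left (T (-p.1) a) a (T (-p.1) c)
  linarith

/-- Two-sided asymptotic pairs. -/
def Asymp {X : Type*} [MetricSpace X] (T : ℤ → X → X) (x y : X) : Prop :=
  Tendsto (fun n => dist (T n x) (T n y)) cofinite (𝓝 0)

lemma Asymp.symm {X : Type*} [MetricSpace X] {T : ℤ → X → X} {x y : X} (h : Asymp T x y) :
    Asymp T y x := by
  unfold Asymp at *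
  simpa only [dist_comm] using h

lemma Asymp.trans {X : Type*} [MetricSpace X] {T : ℤ → X → X} {x y z : X} (h : Asymp T x y)
    (h' : Asymp T y z) : Asymp T x z := by
  unfold Asymp at *
  have := h.add h'
  rw [add_zero] at this
  exact squeeze_zero (fun _ => dist_nonneg) (fun _ => dist_triangle _ _ _) this

lemma Asymp.shift {X : Type*} [MetricSpace X] {T : ℤ → X → X}
    (hadd : ∀ m n x, T (m + n) x = T m (T n x)) {x y : X} (h : Asymp T x y) (m : ℤ) :
    Asymp T (T m x) (T m y) := by
  unfold Asymp at *
  have h2 : Tendsto (fun n : ℤ => n + m) cofinite cofinite :=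
    (add_left_injective m).tendsto_cofinite
  have := h.comp h2
  refine this.congr fun n => ?_
  simp only [Function.comp, hadd]

lemma asymp_of_eventually {X : Type*} [MetricSpace X] {T : ℤ → X → X} {x y : X}
    (h : ∀ ε > 0, ∀ᶠ n in cofinite, dist (T n x) (T n y) ≤ ε) : Asymp T x y := by
  unfold Asymp
  rw [Metric.tendsto_nhds]
  intro ε hε
  filter_upwards [h (ε / 2) (by positivity)] with n hn
  rw [Real.dist_0_eq_abs, abs_of_nonneg dist_nonneg]
  linarith

/-- Points close to a wandering point are asymptotic to it. -/
lemma wander_asymp {X : Type*} [MetricSpace X] [CompactSpace X] [ConnectedSpace X]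
    (hreg : ∀ x : X, ∀ ε > (0 : ℝ), ∃ U : Set X,
      IsOpen U ∧ x ∈ U ∧ U ⊆ Metric.ball x ε ∧ (frontier U).Finite)
    (T : ℤ → X → X) (hc : ∀ n, Continuous (T n))
    (h0 : ∀ x, T 0 x = x) (hadd : ∀ m n x, T (m + n) x = T m (T n x))
    (x : X) (U : Set X) (hU : U ∈ 𝓝 x) (hw : ∀ n, n ≠ 0 → ∀ v ∈ U, T n v ∉ U) :
    ∀ᶠ y in 𝓝 x, Asymp T x y := by
  obtain ⟨N, hN, hNc, hNU⟩ := loc_conn hreg x U hU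
  filter_upwards [hN] with y hy
  apply asymp_of_eventually
  intro ε hε
  have := null_family hreg (fun n => T n '' N) (fun n => hNc.image _ (hc n).continuousOn) ?_ ε hε
  · filter_upwards [this] with n hn
    exact hn _ ⟨x, mem_of_mem_nhds hN, rfl⟩ _ ⟨y, hy, rfl⟩
  · intro m k hmk
    rw [Set.disjoint_left]
    rintro _ ⟨u, hu, rfl⟩ ⟨v, hv, huv⟩
    apply hw (-m + k) (by omega) v (hNU hv)
    rw [hadd, huv, ← hadd, neg_add_cancel, h0]
    exact hNU hu

/-- A recurrent point asymptotic to its image by `T j` is fixed by `T j`. -/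
lemma fixed_of_asymp {X : Type*} [MetricSpace X] {T : ℤ → X → X} (hc : ∀ n, Continuous (T n))
    (hadd : ∀ m n x, T (m + n) x = T m (T n x)) {a : X} {𝒱 : Ultrafilter ℤ}
    (h𝒱 : (𝒱 : Filter ℤ) ≤ cofinite) (ha : Tendsto (fun n => T n a) 𝒱 (𝓝 a)) (j : ℤ)
    (h : Asymp T a (T j a)) : T j a = a := by
  have h1 : Tendsto (fun n => T n (T j a)) 𝒱 (𝓝 (T j a)) := by
    refine (((hc j).tendsto a).comp ha).congr fun n => ?_
    simp only [Function.comp]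
    rw [← hadd, ← hadd, add_comm]
  have h2 := ha.dist h1
  have h3 := tendsto_nhds_unique h2 (h.mono_left h𝒱)
  exact (dist_eq_zero.1 h3).symm

/-- The case of a component returning to itself. -/
lemma fixed_of_return {X : Type*} [MetricSpace X] [CompactSpace X] [ConnectedSpace X]
    (hreg : ∀ x : X, ∀ ε > (0 : ℝ), ∃ U : Set X,
      IsOpen U ∧ x ∈ U ∧ U ⊆ Metric.ball x ε ∧ (frontier U).Finite)
    (T : ℤ → X → X) (hc : ∀ n, Continuous (T n))
    (h0 : ∀ x, T 0 x = x) (hadd : ∀ m n x, T (m + n) x = T m (T n x))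
    (a : X) (hnp : ∀ n, n ≠ 0 → T n a ≠ a) {𝒱 : Ultrafilter ℤ}
    (h𝒱 : (𝒱 : Filter ℤ) ≤ cofinite) (ha : Tendsto (fun n => T n a) 𝒱 (𝓝 a))
    (D : Set X) (haD : a ∈ closure D) (m : ℤ) (hD : ∀ d ∈ D, Asymp T d (T m d)) :
    T m a = a := by
  have hinv : ∀ n x, T (-n) (T n x) = x := by
    intro n x; rw [← hadd, neg_add_cancel, h0]
  have hcomm : ∀ k l x, T k (T l x) = T l (T k x) := by
    intro k l x; rw [← hadd, ← hadd, add_comm]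
  have hinj : Function.Injective fun n => T n a := by
    intro m k hmk
    by_contra hne
    apply hnp (-k + m) (by omega)
    rw [hadd]
    simp only at hmk
    rw [hmk, hinv]
  have hlim : ∀ s, Tendsto (fun n => T n (T s a)) 𝒱 (𝓝 (T s a)) := by
    intro s
    refine (((hc s).tendsto a).comp ha).congr fun n => ?_
    simp only [Function.comp]
    rw [hcomm]
  suffices h : ∀ η > 0, dist (T m a) a ≤ 3 * η by
    apply dist_le_zero.1
    apply le_of_forall_pos_le_add
    intro η hη
    have := h (η / 3) (by positivity)
    linarith
  intro η hη
  have huc : UniformContinuous (T m) := CompactSpace.uniformContinuous_of_continuous (hc m)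
  obtain ⟨δ, hδ, hδm⟩ := Metric.uniformContinuous_iff.1 huc η hη
  obtain ⟨Z, hZ, hZN⟩ := equi_off_finite hreg T hc hinv 𝒱 (fun n => n) (min η (δ / 2))
    (by positivity)
  have hclose : ∀ s, T s a ∉ Z → dist (T m (T s a)) (T s a) ≤ 3 * η := by
    intro s hs
    obtain ⟨N, hN, hNe⟩ := hZN _ hs
    have hN' : T s ⁻¹' N ∈ 𝓝 a := (hc s).continuousAt.preimage_mem_nhds hN
    obtain ⟨d, hdN, hdD⟩ := mem_closure_iff_nhds.1 haD _ hN'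
    have hd := (((hD d hdD).shift hadd s).mono_left h𝒱).eventually_le_const hη
    have hl : Tendsto (fun n => dist (T m (T n (T s a))) (T n (T s a))) 𝒱
        (𝓝 (dist (T m (T s a)) (T s a))) :=
      (((hc m).tendsto _).comp (hlim s)).dist (hlim s)
    refine le_of_tendsto hl ?_
    filter_upwards [hNe, hd] with n h1 h2
    have h3 := h1 _ (mem_of_mem_nhds hN) _ hdN
    have h4 : dist (T n (T s a)) (T n (T s d)) ≤ η := h3.trans (min_le_left _ _)
    have h5 : dist (T n (T s a)) (T n (T s d)) < δ := by
      have := h3.trans (min_le_right _ _)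
      linarith
    have h6 := hδm h5
    rw [hcomm s m d, hcomm n m] at h2
    have h7 := dist_triangle4 (T m (T n (T s a))) (T m (T n (T s d))) (T n (T s d)) (T n (T s a))
    rw [dist_comm (T m (T n (T s d)))  (T n (T s d)), dist_comm (T n (T s d)) (T n (T s a))] at h7
    linarith
  have hZ' : ∀ᶠ s in cofinite, T s a ∉ Z := by
    rw [Filter.eventually_cofinite]
    simp only [not_not]
    exact hZ.preimage hinj.injOn
  have hl : Tendsto (fun n => dist (T m (T n a)) (T n a)) 𝒱 (𝓝 (dist (T m a) a)) :=
    (((hc m).tendsto _).comp ha).dist ha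
  refine le_of_tendsto hl ?_
  filter_upwards [h𝒱 hZ'] with n hn
  exact hclose n hn

/-- Let `f` be a homeomorphism of a regular curve `X` and `D` a connected component of
`X \ Ω(f)` whose closure contains a non-periodic point of `Ω(f)`. Then the family
`{fⁿ(closure D) : n ∈ ℤ}` is pairwise disjoint, and the diameters `diam (fⁿ(closure D))`
tend to `0` as `|n| → ∞`. -/
theorem component_iterates_pairwise_disjoint {X : Type*}
    [MetricSpace X] [CompactSpace X] [ConnectedSpace X] [Nonempty X]
    (hreg : ∀ x : X, ∀ ε > (0 : ℝ), ∃ U : Set X,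
      IsOpen U ∧ x ∈ U ∧ U ⊆ Metric.ball x ε ∧ (frontier U).Finite)
    (f : X ≃ₜ X) (x : X) (hx : x ∈ (nonwandering (⇑f))ᶜ)
    (D : Set X) (hD : D = connectedComponentIn (nonwandering (⇑f))ᶜ x)
    (hnp : ∃ a ∈ closure D ∩ nonwandering (⇑f), ∀ n : ℕ, 0 < n → (⇑f)^[n] a ≠ a) :
    (∀ m k : ℤ, m ≠ k →
      ⇑(f.toEquiv ^ m) '' closure D ∩ ⇑(f.toEquiv ^ k) '' closure D = ∅) ∧
    Tendsto (fun n : ℤ => Metric.diam (⇑(f.toEquiv ^ n) '' closure D)) cofinite (nhds 0) := by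
  classical
  obtain ⟨a, ⟨haD, haΩ⟩, hap⟩ := hnp
  set T : ℤ → X → X := fun n => ⇑(f.toEquiv ^ n) with hTdef
  have hTnat : ∀ n : ℕ, T n = (⇑f)^[n] := by
    intro n
    simp only [hTdef, zpow_natCast]
    exact (Equiv.Perm.iterate_eq_pow f.toEquiv n).symm
  have hTneg : ∀ n : ℕ, T (-n) = (⇑f.symm)^[n] := by
    intro n
    simp only [hTdef, zpow_neg, zpow_natCast, ← inv_pow]
    exact (Equiv.Perm.iterate_eq_pow f.symm.toEquiv n).symm
  have hc : ∀ n, Continuous (T n) := by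
    intro n
    obtain ⟨k, rfl | rfl⟩ := n.eq_nat_or_neg
    · rw [hTnat]; exact f.continuous.iterate k
    · rw [hTneg]; exact f.symm.continuous.iterate k
  have h0 : ∀ x, T 0 x = x := fun x => by simp [hTdef]
  have hadd : ∀ m n x, T (m + n) x = T m (T n x) := fun m n x => by
    simp [hTdef, zpow_add]
  have hinv : ∀ n x, T (-n) (T n x) = x := by
    intro n x; rw [← hadd, neg_add_cancel, h0]
  have hnpT : ∀ n, n ≠ 0 → T n a ≠ a := by
    intro n hn h
    obtain ⟨k, rfl | rfl⟩ := n.eq_nat_or_neg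
    · rw [hTnat] at h
      exact hap k (by omega) h
    · apply hap k (by omega)
      have := hinv (-(k : ℤ)) a
      rw [h, neg_neg, hTnat] at this
      exact this
  have hnw : ∀ U ∈ 𝓝 a, ∃ n, n ≠ 0 ∧ ∃ v ∈ U, T n v ∈ U := by
    intro U hU
    obtain ⟨n, hn, v, hv1, hv2⟩ := haΩ U hU
    exact ⟨n, by omega, v, hv2, by rw [hTnat]; exact hv1⟩
  obtain ⟨𝒱, h𝒱, ha𝒱⟩ := recurrent_of_nonwandering hreg T hc h0 hadd a hnpT hnw
  have hDc : IsPreconnected D := hD ▸ isPreconnected_connectedComponentIn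
  have hDΩ : D ⊆ (nonwandering (⇑f))ᶜ := hD ▸ connectedComponentIn_subset _ _
  have hDas : ∀ d ∈ D, ∀ e ∈ D, Asymp T d e := by
    intro d hd e he
    refine hDc.induction₂ (Asymp T) ?_ (fun _ _ _ _ _ _ h h' => h.trans h')
      (fun _ _ _ _ h => h.symm) hd he
    intro y hy
    refine Filter.Eventually.filter_mono nhdsWithin_le_nhds ?_
    have hy' : ∃ U ∈ 𝓝 y, ∀ n : ℕ, 0 < n → ¬ ((⇑f)^[n] ⁻¹' U ∩ U).Nonempty := by
      have := hDΩ hy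
      simpa only [nonwandering, Set.mem_compl_iff, Set.mem_ofPred_eq, not_forall, not_exists,
        not_and, exists_prop] using this
    obtain ⟨U, hU, hUn⟩ := hy'
    refine wander_asymp hreg T hc h0 hadd y U hU ?_
    intro n hn v hv hnv
    obtain ⟨k, rfl | rfl⟩ := n.eq_nat_or_neg
    · rw [hTnat] at hnv
      exact hUn k (by omega) ⟨v, hnv, hv⟩
    · refine hUn k (by omega) ⟨T (-k) v, ?_, hnv⟩
      have := hinv (-(k : ℤ)) v
      rw [neg_neg, hTnat] at this
      rw [Set.mem_preimage, this]
      exact hv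
  have hDdis : ∀ j, j ≠ 0 → ∀ d ∈ D, T j d ∉ D := by
    intro j hj d hd hjd
    apply hnpT j hj
    refine fixed_of_return hreg T hc h0 hadd a hnpT h𝒱 ha𝒱 D haD j ?_
    intro e he
    exact ((hDas e he d hd).trans (hDas d hd _ hjd)).trans ((hDas d hd e he).shift hadd j)
  have hnull : ∀ ε > 0, ∀ᶠ n in cofinite, ∀ p ∈ closure D, ∀ q ∈ closure D,
      dist (T n p) (T n q) ≤ ε := by
    intro ε hε
    have := null_family hreg (fun n => T n '' D) (fun n => hDc.image _ (hc n).continuousOn) ?_ ε hε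
    · filter_upwards [this] with n hn p hp q hq
      have h1 : ∀ p ∈ D, ∀ q ∈ closure D, dist (T n p) (T n q) ≤ ε := by
        intro p hp q hq
        exact closure_minimal (s := D) (t := {q | dist (T n p) (T n q) ≤ ε})
          (fun q hq => hn _ ⟨p, hp, rfl⟩ _ ⟨q, hq, rfl⟩)
          (isClosed_le (continuous_const.dist (hc n)) continuous_const) hq
      exact closure_minimal (s := D) (t := {p | dist (T n p) (T n q) ≤ ε})
        (fun p hp => h1 p hp q hq)
        (isClosed_le ((hc n).dist continuous_const) continuous_const) hp
    · intro m k hmk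
      rw [Set.disjoint_left]
      rintro _ ⟨u, hu, rfl⟩ ⟨v, hv, huv⟩
      apply hDdis (-m + k) (by omega) v hv
      rw [hadd, huv, hinv]
      exact hu
  have hcas : ∀ p ∈ closure D, ∀ q ∈ closure D, Asymp T p q := by
    intro p hp q hq
    apply asymp_of_eventually
    intro ε hε
    filter_upwards [hnull ε hε] with n hn
    exact hn p hp q hq
  refine ⟨?_, ?_⟩
  · intro m k hmk
    rw [Set.eq_empty_iff_forall_notMem]
    rintro _ ⟨⟨p, hp, rfl⟩, ⟨q, hq, hpq⟩⟩
    change T k q = T m p at hpq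
    apply hnpT (-m + k) (by omega)
    refine fixed_of_asymp hc hadd h𝒱 ha𝒱 _ ?_
    have h1 : Asymp T (T m a) (T k a) := by
      have e1 := (hcas a haD p hp).shift hadd m
      have e2 := (hcas q hq a haD).shift hadd k
      rw [hpq] at e2
      exact e1.trans e2
    have h2 := h1.shift hadd (-m)
    rw [hinv, ← hadd] at h2
    exact h2
  · rw [Metric.tendsto_nhds]
    intro ε hε
    filter_upwards [hnull (ε / 2) (by positivity)] with n hn
    rw [Real.dist_0_eq_abs, abs_of_nonneg Metric.diam_nonneg]
    refine lt_of_le_of_lt (Metric.diam_le_of_forall_dist_le (by positivity) ?_)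
      (half_lt_self hε)
    rintro _ ⟨p, hp, rfl⟩ _ ⟨q, hq, rfl⟩
    exact hn p hp q hq
end

section
/- Let f : X → X be a homeomorphism of a regular curve X with P(f) ≠ ∅, and let D be a connected component of X \ Ω(f) whose closure intersects Ω(f) in a non-periodic point. Then closure(D) ∩ Ω(f) is a single point. -/
section Helpers
open Set Filter Topology
set_option linter.unusedSectionVars false

theorem preconn_sub {X : Type*} [TopologicalSpace X] {C U : Set X} (hC : IsPreconnected C)
    (h1 : (C ∩ U).Nonempty) (h2 : ∀ y ∈ C, y ∉ frontier U) : C ⊆ U := by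
  have key : C ⊆ interior U ∪ (closure U)ᶜ := by
    intro y hy
    by_contra h
    simp only [mem_union, mem_compl_iff, not_or, not_not] at h
    exact h2 y hy ⟨h.2, h.1⟩
  obtain ⟨y, hyC, hyU⟩ := h1
  have := hC.subset_left_of_subset_union isOpen_interior isClosed_closure.isOpen_compl
    (by
      rw [Set.disjoint_left]; intro a ha hb
      exact hb (subset_closure (interior_subset ha))) key
    ⟨y, hyC, by
      rcases key hyC with h | h
      · exact h
      · exact absurd (subset_closure hyU) h⟩
  exact this.trans interior_subset

theorem preconn_meets {X : Type*} [TopologicalSpace X] {C U : Set X} (hC : IsPreconnected C)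
    (h1 : (C ∩ U).Nonempty) (h2 : ∃ y ∈ C, y ∉ U) : ∃ y ∈ C, y ∈ frontier U := by
  by_contra h
  push Not at h
  obtain ⟨y, hy, hyU⟩ := h2
  exact hyU (preconn_sub hC h1 h hy)

section
variable {X : Type*} [MetricSpace X] [CompactSpace X]

theorem finite_net (hreg : RegC X) {ε : ℝ} (hε : 0 < ε) :
    ∃ F : Set X, F.Finite ∧ ∀ C : Set X, IsPreconnected C → (∀ y ∈ C, y ∉ F) →
      ∀ y ∈ C, ∀ z ∈ C, dist y z < ε := by
  choose U hUo hxU hUb hUf using fun x : X => hreg x (ε / 2) (half_pos hε)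
  obtain ⟨t, ht⟩ := isCompact_univ.elim_finite_subcover U hUo
    (fun x _ => mem_iUnion.2 ⟨x, hxU x⟩)
  refine ⟨⋃ i ∈ t, frontier (U i), t.finite_toSet.biUnion (fun i _ => hUf i), ?_⟩
  intro C hC hCF y hy z hz
  have := ht (mem_univ y)
  simp only [mem_iUnion] at this
  obtain ⟨i, hi, hyi⟩ := this
  have hsub : C ⊆ U i := preconn_sub hC ⟨y, hy, hyi⟩ (fun w hw hwf =>
    hCF w hw (by simp only [mem_iUnion]; exact ⟨i, hi, hwf⟩))
  have h1 := hUb i (hsub hy)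
  have h2 := hUb i (hsub hz)
  rw [Metric.mem_ball] at h1 h2
  have := dist_triangle_right y z i
  linarith

theorem locConn [ConnectedSpace X] (hreg : RegC X) : LocallyConnectedSpace X := by
  rw [locallyConnectedSpace_iff_connected_subsets]
  intro x U hU
  obtain ⟨ε, hε, hεU⟩ := Metric.mem_nhds_iff.1 hU
  obtain ⟨W, hWo, hxW, hWb, hWf⟩ := hreg x (ε / 2) (half_pos hε)
  have hclW : closure W ⊆ U := by
    refine (closure_mono hWb).trans (Metric.closure_ball_subset_closedBall.trans ?_)
    refine (Metric.closedBall_subset_ball ?_).trans hεU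
    linarith
  let P : ℕ → Prop := fun n => ∃ Z : Set X, IsClosed Z ∧ IsClosed (closure W \ Z) ∧
    Z ⊆ closure W ∧ x ∈ Z ∧ (Z ∩ frontier W).ncard = n
  have hP : ∃ n, P n := ⟨_, closure W, isClosed_closure, by simp, le_rfl, subset_closure hxW, rfl⟩
  classical
  obtain ⟨Z, hZ1, hZ2, hZ3, hxZ, hZn⟩ := Nat.find_spec hP
  refine ⟨Z, ?_, ?_, hZ3.trans hclW⟩
  · refine mem_of_superset ((hWo.inter hZ2.isOpen_compl).mem_nhds ⟨hxW, fun h => h.2 hxZ⟩) ?_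
    rintro y ⟨hyW, hy⟩
    by_contra h
    exact hy ⟨subset_closure hyW, h⟩
  · rw [isPreconnected_iff_subset_of_fully_disjoint_closed hZ1]
    have main : ∀ u v : Set X, IsClosed u → IsClosed v → Z ⊆ u ∪ v → Disjoint u v → x ∈ u →
        Z ⊆ u := by
      intro u v hu hv huv hd hxu
      by_contra hne
      obtain ⟨y, hyZ, hyu⟩ := not_subset.1 hne
      have hyv : y ∈ v := (huv hyZ).resolve_left hyu
      have hcl2 : IsClosed (Z ∩ v) := hZ1.inter hv
      have hcl1 : IsClosed (Z ∩ u) := hZ1.inter hu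
      have hrest : closure W \ (Z ∩ u) = (closure W \ Z) ∪ (Z ∩ v) := by
        ext w
        constructor
        · rintro ⟨h1, h2⟩
          by_cases hwZ : w ∈ Z
          · exact Or.inr ⟨hwZ, (huv hwZ).resolve_left (fun h => h2 ⟨hwZ, h⟩)⟩
          · exact Or.inl ⟨h1, hwZ⟩
        · rintro (h | h)
          · exact ⟨h.1, fun h' => h.2 h'.1⟩
          · exact ⟨hZ3 h.1, fun h' => Set.disjoint_left.1 hd h'.2 h.2⟩
      have hmeet : ∃ w ∈ Z ∩ v, w ∈ frontier W := by
        by_contra hno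
        push Not at hno
        have hop : IsOpen (Z ∩ v) := by
          have : (Z ∩ v)ᶜ = (closure W \ Z) ∪ (Z ∩ u) ∪ Wᶜ := by
            ext w
            constructor
            · intro hw
              by_cases hwW : w ∈ W
              · left
                by_cases hwZ : w ∈ Z
                · exact Or.inr ⟨hwZ, (huv hwZ).resolve_right (fun h => hw ⟨hwZ, h⟩)⟩
                · exact Or.inl ⟨subset_closure hwW, hwZ⟩
              · exact Or.inr hwW
            · rintro ((h | h) | h) hw
              · exact h.2 hw.1
              · exact Set.disjoint_left.1 hd h.2 hw.2
              · apply hno w hw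
                rw [hWo.frontier_eq]
                exact ⟨hZ3 hw.1, h⟩
          rw [← isClosed_compl_iff, this]
          exact (hZ2.union hcl1).union hWo.isClosed_compl
        have := IsClopen.eq_univ ⟨hcl2, hop⟩ ⟨y, hyZ, hyv⟩
        have hx' : x ∈ Z ∩ v := this ▸ mem_univ x
        exact Set.disjoint_left.1 hd hxu hx'.2
      obtain ⟨w, hw, hwf⟩ := hmeet
      have hlt : (Z ∩ u ∩ frontier W).ncard < Nat.find hP := by
        rw [← hZn]
        apply Set.ncard_lt_ncard _ (hWf.subset inter_subset_right)
        refine ⟨fun a ha => ⟨ha.1.1, ha.2⟩, fun h => ?_⟩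
        exact Set.disjoint_left.1 hd (h ⟨hw.1, hwf⟩).1.2 hw.2
      exact Nat.find_min hP hlt ⟨Z ∩ u, hcl1, by rw [hrest]; exact hZ2.union hcl2,
        fun a ha => hZ3 ha.1, ⟨hxZ, hxu⟩, rfl⟩
    intro u v hu hv huv hd
    rcases huv hxZ with h | h
    · exact Or.inl (main u v hu hv huv hd h)
    · exact Or.inr (main v u hv hu (by rwa [union_comm]) hd.symm h)
end

/-- submodularity -/
theorem frontier_submod {X : Type*} [TopologicalSpace X] {U W : Set X} (hU : IsOpen U)
    (hW : IsOpen W) (hUf : (frontier U).Finite) (hWf : (frontier W).Finite) :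
    (frontier (U ∩ W)).Finite ∧ (frontier (U ∪ W)).Finite ∧
    (frontier (U ∩ W)).ncard + (frontier (U ∪ W)).ncard ≤
      (frontier U).ncard + (frontier W).ncard := by
  have h1 : frontier (U ∩ W) ⊆ frontier U ∪ frontier W := by
    intro y hy
    rcases frontier_inter_subset U W hy with h | h
    · exact Or.inl h.1
    · exact Or.inr h.2
  have h2 : frontier (U ∪ W) ⊆ frontier U ∪ frontier W := by
    intro y hy
    rcases frontier_union_subset U W hy with h | h
    · exact Or.inl h.1
    · exact Or.inr h.2
  have hf1 := (hUf.union hWf).subset h1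
  have hf2 := (hUf.union hWf).subset h2
  refine ⟨hf1, hf2, ?_⟩
  rw [← Set.ncard_union_add_ncard_inter _ _ hf1 hf2, ← Set.ncard_union_add_ncard_inter _ _ hUf hWf]
  apply add_le_add
  · exact Set.ncard_le_ncard (union_subset h1 h2) (hUf.union hWf)
  · apply Set.ncard_le_ncard _ (hUf.inter_of_left _)
    rw [(hU.inter hW).frontier_eq, (hU.union hW).frontier_eq, hU.frontier_eq, hW.frontier_eq]
    rintro y ⟨⟨ha, hb⟩, ⟨hc, hd⟩⟩
    have := closure_inter_subset_inter_closure U W ha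
    exact ⟨⟨this.1, fun h => hd (Or.inl h)⟩, ⟨this.2, fun h => hd (Or.inr h)⟩⟩

/-- (fully) invariant set -/
def IsInv {X : Type*} [TopologicalSpace X] (f : X ≃ₜ X) (S : Set X) : Prop :=
  ∀ x, f x ∈ S ↔ x ∈ S

section
variable {X : Type*} [TopologicalSpace X] {f : X ≃ₜ X} {S T : Set X}

theorem zp_add (f : X ≃ₜ X) (m n : ℤ) (x : X) : (f ^ (m + n)) x = (f ^ m) ((f ^ n) x) := by
  rw [zpow_add]; rfl

theorem zp_zero (f : X ≃ₜ X) (x : X) : (f ^ (0 : ℤ)) x = x := by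
  rw [zpow_zero]; rfl

theorem zp_one (f : X ≃ₜ X) (x : X) : (f ^ (1 : ℤ)) x = f x := by
  rw [zpow_one]

theorem zp_neg (f : X ≃ₜ X) (m : ℤ) (x : X) : (f ^ (-m)) ((f ^ m) x) = x := by
  rw [← zp_add, neg_add_cancel, zp_zero]

theorem zp_neg' (f : X ≃ₜ X) (m : ℤ) (x : X) : (f ^ m) ((f ^ (-m)) x) = x := by
  rw [← zp_add, add_neg_cancel, zp_zero]

theorem zp_mul (f : X ≃ₜ X) (m n : ℤ) (x : X) : (f ^ (m * n)) x = ((f ^ m) ^ n) x := by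
  rw [zpow_mul]

theorem zp_nat (f : X ≃ₜ X) (n : ℕ) (x : X) : (f ^ (n : ℤ)) x = f^[n] x := by
  induction n generalizing x with
  | zero => simp
  | succ k ih => 
    rw [Function.iterate_succ_apply, ← ih]
    push_cast
    rw [zp_add, zp_one]

theorem IsInv.inv (h : IsInv f S) : IsInv f⁻¹ S := by
  intro x
  rw [← h]
  have : f (f⁻¹ x) = x := f.apply_symm_apply x
  rw [this]

theorem IsInv.npow (h : IsInv f S) (n : ℕ) : IsInv (f ^ n) S := by
  induction n with
  | zero => intro x; rw [pow_zero]; rfl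
  | succ k ih => intro x; rw [pow_succ]; exact (ih _).trans (h x)

theorem IsInv.zpow (h : IsInv f S) (n : ℤ) : IsInv (f ^ n) S := by
  cases n with
  | ofNat n => simpa using h.npow n
  | negSucc n => rw [zpow_negSucc]; exact (h.npow _).inv

theorem IsInv.mem (h : IsInv f S) (n : ℤ) (x : X) : (f ^ n) x ∈ S ↔ x ∈ S := h.zpow n x

theorem IsInv.pre (h : IsInv f S) : f ⁻¹' S = S := by
  ext x; exact h x

theorem inv_of_pre (h : f ⁻¹' S = S) : IsInv f S := by
  intro x; rw [← mem_preimage, h]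

theorem IsInv.compl (h : IsInv f S) : IsInv f Sᶜ := fun x => not_congr (h x)
theorem IsInv.cl (h : IsInv f S) : IsInv f (closure S) :=
  inv_of_pre (by rw [f.preimage_closure, h.pre])
theorem IsInv.fr (h : IsInv f S) : IsInv f (frontier S) :=
  inv_of_pre (by rw [f.preimage_frontier, h.pre])
theorem IsInv.union (h : IsInv f S) (h' : IsInv f T) : IsInv f (S ∪ T) := fun x => or_congr (h x) (h' x)
theorem IsInv.inter (h : IsInv f S) (h' : IsInv f T) : IsInv f (S ∩ T) := fun x => and_congr (h x) (h' x)

theorem inv_of_image (h : ∀ x ∈ S, f x ∈ S) (h' : ∀ x ∈ S, f⁻¹ x ∈ S) : IsInv f S := by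
  intro x
  refine ⟨fun hx => ?_, h x⟩
  have := h' _ hx
  have e : f⁻¹ (f x) = x := f.symm_apply_apply x
  rwa [e] at this

theorem finite_inv_periodic (hS : S.Finite) (h : IsInv f S) :
    ∃ r : ℕ, 0 < r ∧ ∀ k : ℤ, ∀ s ∈ S, (f ^ ((r : ℤ) * k)) s = s := by
  have pt : ∀ s ∈ S, ∃ r : ℕ, 0 < r ∧ (f ^ (r : ℤ)) s = s := by
    intro s hs
    obtain ⟨a, -, b, -, hab, he⟩ := Set.infinite_univ.exists_ne_map_eq_of_mapsTo
      (f := fun n : ℕ => (f ^ (n : ℤ)) s) (t := S) (fun n _ => (h.mem _ _).2 hs) hS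
    rcases lt_or_gt_of_ne hab with hl | hl
    · refine ⟨b - a, by omega, ?_⟩
      have : ((b - a : ℕ) : ℤ) = -a + b := by omega
      rw [this, zp_add, ← he, zp_neg]
    · refine ⟨a - b, by omega, ?_⟩
      have : ((a - b : ℕ) : ℤ) = -b + a := by omega
      rw [this, zp_add, he, zp_neg]
  choose! r hr0 hr using pt
  lift S to Finset X using hS
  refine ⟨∏ s ∈ S, r s, Finset.prod_pos (fun s hs => hr0 s hs), ?_⟩
  intro k s hs
  obtain ⟨c, hc⟩ := Finset.dvd_prod_of_mem r hs
  rw [hc]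
  have hfix : ∀ g : X ≃ₜ X, g s = s → ∀ k : ℤ, (g ^ k) s = s := by
    intro g hg k
    have hI : IsInv g {s} := by
      intro x
      simp only [mem_singleton_iff]
      constructor
      · intro hx; apply g.injective; rw [hx, hg]
      · rintro rfl; exact hg
    exact (hI.mem k s).2 rfl
  push_cast
  rw [mul_assoc, zp_mul]
  exact hfix _ (hr s hs) _
end

theorem ncard_frontier_pre {X : Type*} [TopologicalSpace X] (f : X ≃ₜ X) (U : Set X) :
    (frontier (f ⁻¹' U)).ncard = (frontier U).ncard := by
  rw [← f.preimage_frontier]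
  exact Set.ncard_preimage_of_injective_subset_range f.injective (by simp [f.surjective.range_eq])

theorem finite_frontier_pre {X : Type*} [TopologicalSpace X] (f : X ≃ₜ X) {U : Set X}
    (h : (frontier U).Finite) : (frontier (f ⁻¹' U)).Finite := by
  rw [← f.preimage_frontier]
  exact h.preimage f.injective.injOn

section
variable {X : Type*} [MetricSpace X] [CompactSpace X]

theorem exists_cut (hreg : RegC X) {K V : Set X} (hK : IsClosed K) (hV : IsOpen V) (hKV : K ⊆ V) :
    ∃ U : Set X, IsOpen U ∧ K ⊆ U ∧ closure U ⊆ V ∧ (frontier U).Finite := by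
  have h1 : ∀ x : X, ∃ U : Set X, IsOpen U ∧ x ∈ U ∧ (x ∈ V → closure U ⊆ V) ∧
      (frontier U).Finite := by
    intro x
    by_cases hx : x ∈ V
    · obtain ⟨ε, hε, hb⟩ := Metric.isOpen_iff.1 hV x hx
      obtain ⟨U, h1, h2, h3, h4⟩ := hreg x (ε / 2) (half_pos hε)
      refine ⟨U, h1, h2, fun _ => ?_, h4⟩
      refine (closure_mono h3).trans (Metric.closure_ball_subset_closedBall.trans ?_)
      refine (Metric.closedBall_subset_ball ?_).trans hb
      linarith
    · obtain ⟨U, h1, h2, h3, h4⟩ := hreg x 1 one_pos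
      exact ⟨U, h1, h2, fun h => absurd h hx, h4⟩
  choose U hUo hxU hUV hUf using h1
  obtain ⟨t, htK, ht⟩ := hK.isCompact.elim_nhds_subcover U (fun x _ => (hUo x).mem_nhds (hxU x))
  refine ⟨⋃ x ∈ t, U x, isOpen_biUnion fun x _ => hUo x, ht, ?_, ?_⟩
  · have := t.finite_toSet.closure_biUnion (f := U)
    simp only [Finset.mem_coe] at this
    rw [this]
    exact iUnion₂_subset fun x hx => hUV x (hKV (htK x hx))
  · clear ht htK
    classical
    induction t using Finset.induction_on with
    | empty => simp
    | insert a s ha ih =>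
      rw [Finset.set_biUnion_insert]
      exact (frontier_submod (hUo a) (isOpen_biUnion fun x _ => hUo x) (hUf a) ih).2.1

/-- L2 -/
theorem inv_sep [ConnectedSpace X] (hreg : RegC X) {f : X ≃ₜ X} {A B : Set X}
    (hA : IsClosed A) (hB : IsClosed B)
    (hAB : Disjoint A B) (hfA : IsInv f A) (hfB : IsInv f B) :
    ∃ N : Set X, IsOpen N ∧ IsInv f N ∧ A ⊆ N ∧ Disjoint N B ∧ (frontier N).Finite := by
  classical
  have := locConn hreg
  let cut : Set X → Prop := fun U => IsOpen U ∧ A ⊆ U ∧ closure U ⊆ Bᶜ ∧ (frontier U).Finite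
  have hex : ∃ n, ∃ U, cut U ∧ (frontier U).ncard = n := by
    obtain ⟨U, hU⟩ := exists_cut hreg hA hB.isOpen_compl (disjoint_left.1 hAB)
    exact ⟨_, U, hU, rfl⟩
  set ν := Nat.find hex with hν
  have hmin : ∀ U, cut U → ν ≤ (frontier U).ncard := fun U hU => Nat.find_min' hex ⟨U, hU, rfl⟩
  let mc : Set X → Prop := fun U => cut U ∧ (frontier U).ncard ≤ ν
  have hmc : ∃ U, mc U := by
    obtain ⟨U, hU, hn⟩ := Nat.find_spec hex
    exact ⟨U, hU, hn.le⟩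
  have hunion : ∀ U W, mc U → mc W → mc (U ∪ W) := by
    rintro U W ⟨⟨a1, a2, a3, a4⟩, a5⟩ ⟨⟨b1, b2, b3, b4⟩, b5⟩
    obtain ⟨h1, h2, h3⟩ := frontier_submod a1 b1 a4 b4
    have : cut (U ∩ W) := ⟨a1.inter b1, subset_inter a2 b2,
      (closure_mono inter_subset_left).trans a3, h1⟩
    have := hmin _ this
    refine ⟨⟨a1.union b1, a2.trans subset_union_left, ?_, h2⟩, by omega⟩
    rw [closure_union]; exact union_subset a3 b3
  have hpre : ∀ g : X ≃ₜ X, IsInv g A → IsInv g B → ∀ U, mc U → mc (g ⁻¹' U) := by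
    rintro g hgA hgB U ⟨⟨a1, a2, a3, a4⟩, a5⟩
    refine ⟨⟨a1.preimage g.continuous, ?_, ?_, finite_frontier_pre g a4⟩, ?_⟩
    · intro x hx; exact a2 ((hgA x).2 hx)
    · rw [← g.preimage_closure]; intro x hx; exact fun hxB => a3 hx ((hgB x).2 hxB)
    · rwa [ncard_frontier_pre]
  set N := ⋃₀ {U | mc U} with hN
  have hNo : IsOpen N := isOpen_sUnion fun U hU => hU.1.1
  refine ⟨N, hNo, ?_, ?_, ?_, ?_⟩
  · intro x
    constructor
    · rintro ⟨U, hU, hxU⟩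
      exact ⟨f ⁻¹' U, hpre f hfA hfB U hU, hxU⟩
    · rintro ⟨U, hU, hxU⟩
      refine ⟨(f⁻¹ : X ≃ₜ X) ⁻¹' U, hpre f⁻¹ hfA.inv hfB.inv U hU, ?_⟩
      have e : f⁻¹ (f x) = x := f.symm_apply_apply x
      rwa [mem_preimage, e]
  · obtain ⟨U, hU⟩ := hmc
    exact fun x hx => ⟨U, hU, hU.1.2.1 hx⟩
  · rw [disjoint_left]
    rintro x ⟨U, hU, hxU⟩ hxB
    exact hU.1.2.2.1 (subset_closure hxU) hxB
  · by_contra hinf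
    obtain ⟨T, hTs, hTc⟩ := Set.Infinite.exists_subset_card_eq hinf (ν + 1)
    obtain ⟨G, hG, hGd⟩ := T.finite_toSet.t2_separation
    have hV : ∀ t : X, ∃ V, V ⊆ G t ∧ IsOpen V ∧ t ∈ V ∧ IsConnected V := fun t =>
      locallyConnectedSpace_iff_subsets_isOpen_isConnected.1 inferInstance t (G t)
        ((hG t).2.mem_nhds (hG t).1)
    choose V hVG hVo htV hVc using hV
    have hU : ∃ U, mc U ∧ ∀ t ∈ T, (V t ∩ U).Nonempty := by
      clear hTc hGd
      induction T using Finset.induction_on with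
      | empty => obtain ⟨U, hU⟩ := hmc; exact ⟨U, hU, by simp⟩
      | insert a s ha ih =>
        obtain ⟨U, hU, hUs⟩ := ih (fun x hx => hTs (Finset.mem_coe.2 (Finset.mem_insert_of_mem hx)))
        have haN : a ∈ closure N := frontier_subset_closure (hTs (by simp))
        obtain ⟨y, hyV, W, hW, hyW⟩ := mem_closure_iff.1 haN (V a) (hVo a) (htV a)
        refine ⟨U ∪ W, hunion U W hU hW, ?_⟩
        intro t ht
        rcases Finset.mem_insert.1 ht with rfl | ht
        · exact ⟨y, hyV, Or.inr hyW⟩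
        · obtain ⟨z, hz⟩ := hUs t ht
          exact ⟨z, hz.1, Or.inl hz.2⟩
    obtain ⟨U, hU, hUT⟩ := hU
    have hpt : ∀ t ∈ T, ∃ y ∈ V t, y ∈ frontier U := by
      intro t ht
      refine preconn_meets (hVc t).isPreconnected (hUT t ht) ⟨t, htV t, fun h => ?_⟩
      have := hTs ht
      rw [hNo.frontier_eq] at this
      exact this.2 ⟨U, hU, h⟩
    choose! φ hφV hφU using hpt
    have hinj : InjOn φ T := by
      intro s hs t ht hst
      by_contra hne
      have := hGd hs ht hne
      exact disjoint_left.1 this (hVG s (hφV s hs)) (hst ▸ hVG t (hφV t ht))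
    have := Set.ncard_le_ncard_of_injOn φ (s := (T : Set X)) (t := frontier U)
      (fun t ht => hφU t ht) hinj hU.1.2.2.2
    rw [Set.ncard_coe_finset, hTc] at this
    have := hU.2
    omega
end

/-- regularly almost periodic point -/
def RAP {X : Type*} [MetricSpace X] (f : X ≃ₜ X) (x : X) : Prop :=
  ∀ ε > (0 : ℝ), ∃ r : ℕ, 0 < r ∧ ∀ k : ℤ, dist ((f ^ ((r : ℤ) * k)) x) x ≤ ε

/-- points linked to `A` in `N` -/
def linkPart {X : Type*} [TopologicalSpace X] (A N : Set X) : Set X :=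
  {y | ∃ C ⊆ N, IsPreconnected C ∧ y ∈ C ∧ (C ∩ A).Nonempty}

/-- good set -/
def Good {X : Type*} [TopologicalSpace X] (f : X ≃ₜ X) (A N : Set X) : Prop :=
  IsOpen N ∧ IsInv f N ∧ (frontier N).Finite ∧ A ⊆ N ∧ N ⊆ linkPart A N

section
variable {X : Type*} [MetricSpace X] [CompactSpace X] {f : X ≃ₜ X} {A N : Set X}

theorem linkPart_mono {N N' : Set X} (h : N ⊆ N') : linkPart A N ⊆ linkPart A N' := by
  rintro y ⟨C, hC, h1⟩
  exact ⟨C, hC.trans h, h1⟩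

theorem Good.union {N N' : Set X} (h : Good f A N) (h' : Good f A N') : Good f A (N ∪ N') := by
  refine ⟨h.1.union h'.1, h.2.1.union h'.2.1, (frontier_submod h.1 h'.1 h.2.2.1 h'.2.2.1).2.1,
    h.2.2.2.1.trans subset_union_left, ?_⟩
  refine union_subset (h.2.2.2.2.trans (linkPart_mono subset_union_left))
    (h'.2.2.2.2.trans (linkPart_mono subset_union_right))

theorem linkPart_sub : linkPart A N ⊆ N := by
  rintro y ⟨C, hC, -, hy, -⟩
  exact hC hy

theorem connNhd [LocallyConnectedSpace X] {N : Set X} (hN : IsOpen N) {x : X} (hx : x ∈ N) :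
    ∃ V ⊆ N, IsOpen V ∧ x ∈ V ∧ IsConnected V :=
  locallyConnectedSpace_iff_subsets_isOpen_isConnected.1 inferInstance x N (hN.mem_nhds hx)

theorem linkPart_good [LocallyConnectedSpace X] (hN : IsOpen N) (hI : IsInv f N)
    (hf : (frontier N).Finite) (hAN : A ⊆ N) (hA : IsInv f A) : Good f A (linkPart A N) := by
  have ext : ∀ V ⊆ N, IsPreconnected V → ∀ w ∈ V, w ∈ linkPart A N → V ⊆ linkPart A N := by
    rintro V hVN hV w hw ⟨C, hC, hCp, hwC, hCA⟩ y hy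
    refine ⟨V ∪ C, union_subset hVN hC, hV.union w hw hwC hCp, Or.inl hy, ?_⟩
    obtain ⟨a, ha⟩ := hCA
    exact ⟨a, Or.inr ha.1, ha.2⟩
  have hop : IsOpen (linkPart A N) := by
    rw [isOpen_iff_mem_nhds]
    intro y hy
    obtain ⟨V, hVN, hVo, hyV, hVc⟩ := connNhd hN (linkPart_sub hy)
    exact mem_of_superset (hVo.mem_nhds hyV) (ext V hVN hVc.isPreconnected y hyV hy)
  have himg : ∀ g : X ≃ₜ X, IsInv g N → IsInv g A → ∀ y ∈ linkPart A N, g y ∈ linkPart A N := by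
    rintro g hgN hgA y ⟨C, hC, hCp, hyC, a, haC, haA⟩
    refine ⟨g '' C, ?_, hCp.image g g.continuous.continuousOn, mem_image_of_mem g hyC,
      g a, mem_image_of_mem g haC, (hgA a).2 haA⟩
    rintro _ ⟨c, hc, rfl⟩
    exact (hgN c).2 (hC hc)
  refine ⟨hop, inv_of_image (himg f hI hA) (himg f⁻¹ hI.inv hA.inv), hf.subset ?_, ?_, ?_⟩
  · intro y hy
    rw [hop.frontier_eq] at hy
    rw [hN.frontier_eq]
    refine ⟨closure_mono linkPart_sub hy.1, fun hyN => hy.2 ?_⟩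
    obtain ⟨V, hVN, hVo, hyV, hVc⟩ := connNhd hN hyN
    obtain ⟨w, hwV, hw⟩ := mem_closure_iff.1 hy.1 V hVo hyV
    exact ext V hVN hVc.isPreconnected w hwV hw hyV
  · intro a ha
    exact ⟨{a}, singleton_subset_iff.2 (hAN ha), isPreconnected_singleton, rfl, a, rfl, ha⟩
  · rintro y ⟨C, hC, hCp, hyC, hCA⟩
    exact ⟨C, fun c hc => ⟨C, hC, hCp, hc, hCA⟩, hCp, hyC, hCA⟩


theorem comp_frontier [LocallyConnectedSpace X] {O : Set X} (hO : IsOpen O) {y w : X}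
    (hw : w ∈ frontier (connectedComponentIn O y)) : w ∉ O := by
  intro hwO
  rw [hO.connectedComponentIn.frontier_eq] at hw
  obtain ⟨V, hVO, hVo, hwV, hVc⟩ := connNhd hO hwO
  obtain ⟨v, hvV, hvE⟩ := mem_closure_iff.1 hw.1 V hVo hwV
  have h1 := hVc.isPreconnected.subset_connectedComponentIn hvV hVO
  rw [connectedComponentIn_eq hvE] at hw
  exact hw.2 (h1 hwV)

theorem lemB [LocallyConnectedSpace X] (hreg : RegC X) {N : ℕ → Set X} (hmono : Monotone N)
    (hg : ∀ l, Good f A (N l)) {z : X} (hz : z ∈ closure (⋃ l, N l))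
    (hz' : ∀ l, z ∉ closure (N l)) : RAP f z := by
  intro ε hε
  obtain ⟨F, hF, hFC⟩ := finite_net hreg (half_pos hε)
  set M := ⋃ l, N l with hM
  have hMo : IsOpen M := isOpen_iUnion fun l => (hg l).1
  have hMI : IsInv f M := by
    intro x
    simp only [hM, mem_iUnion]
    exact exists_congr fun l => (hg l).2.1 x
  obtain ⟨l, hl⟩ : ∃ l, F ∩ M ⊆ N l := by
    have hfin : (F ∩ M).Finite := hF.inter_of_left _
    have hcov : F ∩ M ⊆ ⋃ l, N l := inter_subset_right
    generalize F ∩ M = G at hfin hcov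
    lift G to Finset X using hfin
    exact (hmono.directed_le).exists_mem_subset_of_finset_subset_biUnion hcov
  obtain ⟨hNo, hNI, hNf, hAN, -⟩ := hg l
  obtain ⟨r, hr, hrS⟩ := finite_inv_periodic hNf hNI.fr
  refine ⟨r, hr, fun k => ?_⟩
  set O := M \ closure (N l) with hO
  have hOo : IsOpen O := hMo.sdiff isClosed_closure
  have hOI : IsInv f O := hMI.inter hNI.cl.compl
  let K : X → Set X := fun s => ⋃₀ {C | IsPreconnected C ∧ C ⊆ O ∧ s ∈ closure C}
  have hKb : ∀ s, closure (K s) ⊆ Metric.closedBall s (ε / 2) := by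
    intro s
    apply closure_minimal _ Metric.isClosed_closedBall
    rintro y ⟨C, ⟨hC, hCO, hsC⟩, hyC⟩
    have h1 : ∀ w ∈ C, w ∈ Metric.closedBall y (ε / 2) := by
      intro w hw
      refine (hFC C hC ?_ w hw y hyC).le
      intro u hu huF
      have := hCO hu
      exact this.2 (subset_closure (hl ⟨huF, this.1⟩))
    have h2 := closure_minimal h1 Metric.isClosed_closedBall hsC
    rw [Metric.mem_closedBall, dist_comm] at h2
    exact h2
  have hzO : z ∈ closure O := by
    rw [mem_closure_iff]
    intro V hV hzV
    obtain ⟨w, hw, hwM⟩ := mem_closure_iff.1 hz (V ∩ (closure (N l))ᶜ)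
      (hV.inter isClosed_closure.isOpen_compl) ⟨hzV, hz' l⟩
    exact ⟨w, hw.1, hwM, hw.2⟩
  have hcov : O ⊆ ⋃ s ∈ frontier (N l), K s := by
    intro y hy
    set E := connectedComponentIn O y with hE
    have hyE : y ∈ E := mem_connectedComponentIn hy
    suffices h : ∃ s ∈ frontier (N l), s ∈ closure E by
      obtain ⟨s, hs, hsE⟩ := h
      simp only [mem_iUnion]
      exact ⟨s, hs, E, ⟨isPreconnected_connectedComponentIn, connectedComponentIn_subset _ _, hsE⟩,
        hyE⟩
    obtain ⟨m, hm⟩ := mem_iUnion.1 hy.1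
    obtain ⟨C, hCN, hC, hyC, a, haC, haA⟩ := (hg m).2.2.2.2 hm
    obtain ⟨w, hwC, hwE⟩ := preconn_meets (U := E) hC ⟨y, hyC, hyE⟩
      ⟨a, haC, fun haE => (connectedComponentIn_subset _ _ haE).2 (subset_closure (hAN haA))⟩
    have hwO := comp_frontier hOo hwE
    have hwM : w ∈ M := mem_iUnion.2 ⟨m, hCN hwC⟩
    have hwcl : w ∈ closure (N l) := by
      by_contra h
      exact hwO ⟨hwM, h⟩
    refine ⟨w, ?_, frontier_subset_closure hwE⟩
    rw [hNo.frontier_eq]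
    refine ⟨hwcl, fun hwN => ?_⟩
    obtain ⟨v, hv1, hv2⟩ := mem_closure_iff.1 (frontier_subset_closure hwE) _ hNo hwN
    exact (connectedComponentIn_subset _ _ hv2).2 (subset_closure hv1)
  have hz2 := closure_mono hcov hzO
  rw [hNf.closure_biUnion] at hz2
  simp only [mem_iUnion] at hz2
  obtain ⟨s, hs, hzs⟩ := hz2
  set g := f ^ ((r : ℤ) * k) with hgdef
  have hgs : g s = s := hrS k s hs
  have hgK : ∀ y ∈ K s, g y ∈ K s := by
    rintro y ⟨C, ⟨hC, hCO, hsC⟩, hyC⟩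
    refine ⟨g '' C, ⟨hC.image g g.continuous.continuousOn, ?_, ?_⟩, mem_image_of_mem g hyC⟩
    · rintro _ ⟨c, hc, rfl⟩
      exact (hOI.mem _ c).2 (hCO hc)
    · rw [← g.image_closure]
      exact ⟨s, hsC, hgs⟩
  have hgz : g z ∈ closure (K s) :=
    map_mem_closure g.continuous hzs hgK
  have h1 := hKb s hzs
  have h2 := hKb s hgz
  rw [Metric.mem_closedBall] at h1 h2
  have := dist_triangle_right (g z) z s
  linarith

theorem RAP_of_fin {S : Set X} (hS : S.Finite) (hI : IsInv f S) {x : X} (hx : x ∈ S) : RAP f x := by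
  intro ε hε
  obtain ⟨r, hr, h⟩ := finite_inv_periodic hS hI
  exact ⟨r, hr, fun k => by rw [h k x hx, dist_self]; exact hε.le⟩

/-- L4 (a) -/
theorem lem4a [LocallyConnectedSpace X] (hreg : RegC X) {B : Set X} {z : X} (hzB : z ∈ B)
    (hz : z ∈ closure (⋃₀ {N | Good f A N ∧ Disjoint N B})) : RAP f z := by
  by_cases h : ∃ N, Good f A N ∧ Disjoint N B ∧ z ∈ closure N
  · obtain ⟨N, hN, hd, hzN⟩ := h
    refine RAP_of_fin hN.2.2.1 hN.2.1.fr ?_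
    rw [hN.1.frontier_eq]
    exact ⟨hzN, fun h => disjoint_left.1 hd h hzB⟩
  · push Not at h
    have hch : ∀ l : ℕ, ∃ N, (Good f A N ∧ Disjoint N B) ∧
        (Metric.ball z (1 / ((l : ℝ) + 1)) ∩ N).Nonempty := by
      intro l
      obtain ⟨y, hy, N, hN, hyN⟩ := mem_closure_iff.1 hz _ (Metric.isOpen_ball (x := z))
        (Metric.mem_ball_self (Nat.one_div_pos_of_nat (α := ℝ) (n := l)))
      exact ⟨N, hN, y, hy, hyN⟩
    choose N hN hNb using hch
    have hps : ∀ l, Good f A (partialSups N l) ∧ Disjoint (partialSups N l) B := by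
      intro l
      induction l with
      | zero => simpa using hN 0
      | succ k ih =>
        rw [partialSups_add_one]
        refine ⟨ih.1.union (hN _).1, ?_⟩
        exact ih.2.sup_left (hN _).2
    refine lemB hreg (partialSups N).monotone (fun l => (hps l).1) ?_
      (fun l => h _ (hps l).1 (hps l).2)
    rw [Metric.mem_closure_iff]
    intro ε hε
    obtain ⟨l, hl⟩ := exists_nat_one_div_lt hε
    obtain ⟨y, hy, hyN⟩ := hNb l
    refine ⟨y, mem_iUnion.2 ⟨l, le_partialSups N l hyN⟩, ?_⟩
    rw [Metric.mem_ball, dist_comm] at hy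
    exact hy.trans hl

/-- the set of components attached to x -/
def Cp {X : Type*} [TopologicalSpace X] (f : X ≃ₜ X) (A B : Set X) (x : X) : Set X :=
  {y | ∃ N, (Good f A N ∧ Disjoint N B) ∧ ∃ S ⊆ N, IsPreconnected S ∧ x ∈ S ∧ y ∈ S}

theorem Cp_img {B : Set X} {x y : X} (k : ℤ) (h : y ∈ Cp f A B x) :
    (f ^ k) y ∈ Cp f A B ((f ^ k) x) := by
  obtain ⟨N, hN, S, hSN, hS, hx, hy⟩ := h
  refine ⟨N, hN, (f ^ k) '' S, ?_, hS.image _ (f ^ k).continuous.continuousOn,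
    mem_image_of_mem _ hx, mem_image_of_mem _ hy⟩
  rintro _ ⟨c, hc, rfl⟩
  exact (hN.1.2.1.mem k c).2 (hSN hc)

theorem Cp_preconn {B : Set X} {x : X} : IsPreconnected (Cp f A B x) := by
  have : Cp f A B x = ⋃₀ {S | x ∈ S ∧ IsPreconnected S ∧ ∃ N, (Good f A N ∧ Disjoint N B) ∧ S ⊆ N} := by
    ext y
    constructor
    · rintro ⟨N, hN, S, hSN, hS, hx, hy⟩
      exact ⟨S, ⟨hx, hS, N, hN, hSN⟩, hy⟩
    · rintro ⟨S, ⟨hx, hS, N, hN, hSN⟩, hy⟩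
      exact ⟨N, hN, S, hSN, hS, hx, hy⟩
  rw [this]
  exact isPreconnected_sUnion x _ (fun S hS => hS.1) (fun S hS => hS.2.1)

theorem Cp_open [LocallyConnectedSpace X] {B : Set X} {x : X} : IsOpen (Cp f A B x) := by
  rw [isOpen_iff_mem_nhds]
  rintro y ⟨N, hN, S, hSN, hS, hx, hy⟩
  obtain ⟨V, hVN, hVo, hyV, hVc⟩ := connNhd hN.1.1 (hSN hy)
  refine mem_of_superset (hVo.mem_nhds hyV) fun v hv => ?_
  exact ⟨N, hN, S ∪ V, union_subset hSN hVN, hS.union y hy hyV hVc.isPreconnected, Or.inl hx,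
    Or.inr hv⟩

theorem Cp_self [ConnectedSpace X] (hreg : RegC X) {B : Set X} {x : X} (hA : IsClosed A)
    (hB : IsClosed B) (hAB : Disjoint A B) (hfA : IsInv f A) (hfB : IsInv f B) (hx : x ∈ A) :
    x ∈ Cp f A B x := by
  have := locConn hreg
  obtain ⟨N, h1, h2, h3, h4, h5⟩ := inv_sep hreg hA hB hAB hfA hfB
  have hg := linkPart_good h1 h2 h5 h3 hfA
  exact ⟨linkPart A N, ⟨hg, h4.mono_left linkPart_sub⟩, {x},
    singleton_subset_iff.2 (hg.2.2.2.1 hx), isPreconnected_singleton, rfl, rfl⟩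

/-- L4 (b) -/
theorem lem4b [ConnectedSpace X] (hreg : RegC X) {B : Set X} {x : X} (hA : IsClosed A)
    (hB : IsClosed B) (hAB : Disjoint A B) (hfA : IsInv f A) (hfB : IsInv f B) (hx : x ∈ A)
    (hBn : B.Nonempty) :
    (closure {w | ∃ k : ℤ, ∃ y ∈ Cp f A B x, (f ^ k) y = w} ∩ B).Nonempty := by
  have := locConn hreg
  by_contra hne
  rw [not_nonempty_iff_eq_empty, ← disjoint_iff_inter_eq_empty] at hne
  set O := {w | ∃ k : ℤ, ∃ y ∈ Cp f A B x, (f ^ k) y = w} with hO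
  have hOI : IsInv f O := by
    apply inv_of_image
    · rintro _ ⟨k, y, hy, rfl⟩
      exact ⟨1 + k, y, hy, by rw [zp_add, zp_one]⟩
    · rintro _ ⟨k, y, hy, rfl⟩
      exact ⟨-1 + k, y, hy, by rw [zp_add, zpow_neg_one]⟩
  obtain ⟨N, h1, h2, h3, h4, h5⟩ := inv_sep hreg (isClosed_closure.union hA) hB
    (disjoint_union_left.2 ⟨hne, hAB⟩) (hOI.cl.union hfA) hfB
  have hg := linkPart_good h1 h2 h5 (subset_union_right.trans h3) hfA
  have hself := Cp_self hreg hA hB hAB hfA hfB hx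
  have hCO : Cp f A B x ⊆ O := fun y hy => ⟨0, y, hy, zp_zero f y⟩
  have hclN : closure (Cp f A B x) ⊆ N :=
    (closure_mono hCO).trans (subset_union_left.trans h3)
  have hclosed : IsClosed (Cp f A B x) := by
    rw [← closure_subset_iff_isClosed]
    intro y hy
    refine ⟨linkPart A N, ⟨hg, h4.mono_left linkPart_sub⟩, closure (Cp f A B x), ?_,
      Cp_preconn.closure, subset_closure hself, hy⟩
    intro w hw
    exact ⟨_, hclN, Cp_preconn.closure, hw, x, subset_closure hself, hx⟩
  have huniv := IsClopen.eq_univ ⟨hclosed, Cp_open⟩ ⟨x, hself⟩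
  obtain ⟨b, hb⟩ := hBn
  obtain ⟨N', hN', S, hSN, -, -, hbS⟩ : b ∈ Cp f A B x := huniv ▸ mem_univ b
  exact disjoint_left.1 hN'.2 (hSN hbS) hb
end

/-- cut -/
def Cut {X : Type*} [TopologicalSpace X] (Q U : Set X) : Prop :=
  IsOpen U ∧ (frontier U).Finite ∧ Disjoint (closure U) Q

/-- height at least n -/
def Hgt {X : Type*} [TopologicalSpace X] (Q : Set X) (n : ℕ) (y : X) : Prop :=
  ∀ U, Cut Q U → y ∈ U → n ≤ (frontier U).ncard

/-- omega limit set -/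
def Om {X : Type*} [TopologicalSpace X] (f : X ≃ₜ X) (s : X) : Set X :=
  {a | ∀ V, IsOpen V → a ∈ V → ∀ K : ℕ, ∃ k : ℕ, K ≤ k ∧ (f ^ (k : ℤ)) s ∈ V}

/-- nonperiodic -/
def NonPer {X : Type*} [TopologicalSpace X] (f : X ≃ₜ X) (s : X) : Prop :=
  ∀ n : ℕ, 0 < n → (f ^ (n : ℤ)) s ≠ s

theorem ncard_sum {X : Type*} [DecidableEq X] (G : Finset X) (S : Set X) [DecidablePred (· ∈ S)]
    (h : S ⊆ G) : S.ncard = ∑ y ∈ G, if y ∈ S then 1 else 0 := by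
  rw [← Finset.card_filter, ← Set.ncard_coe_finset]
  congr 1
  ext y
  simp only [Finset.coe_filter, mem_ofPred_eq]
  exact ⟨fun hy => ⟨h hy, hy⟩, fun hy => hy.2⟩

section
variable {X : Type*} [TopologicalSpace X]

theorem fr_inter3 {A B C : Set X} (hA : IsOpen A) (hB : IsOpen B) (hC : IsOpen C) {y : X}
    (hy : y ∈ frontier (A ∩ B ∩ C)) : (y ∈ A ∨ y ∈ frontier A) ∧ (y ∈ B ∨ y ∈ frontier B) ∧
      (y ∈ C ∨ y ∈ frontier C) ∧ ¬ (y ∈ A ∧ y ∈ B ∧ y ∈ C) := by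
  have h0 : ∀ U : Set X, IsOpen U → y ∈ closure U → y ∈ U ∨ y ∈ frontier U := by
    intro U hU h
    rw [hU.frontier_eq]
    by_cases hh : y ∈ U
    · exact Or.inl hh
    · exact Or.inr ⟨h, hh⟩
  rw [((hA.inter hB).inter hC).frontier_eq] at hy
  refine ⟨h0 A hA (closure_mono ?_ hy.1), h0 B hB (closure_mono ?_ hy.1),
    h0 C hC (closure_mono ?_ hy.1), fun h => hy.2 ⟨⟨h.1, h.2.1⟩, h.2.2⟩⟩
  · exact fun _ h => h.1.1
  · exact fun _ h => h.1.2
  · exact fun _ h => h.2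

theorem fr_diff {A B C : Set X} (hA : IsOpen A) (hB : IsOpen B) (hC : IsOpen C) {y : X}
    (hy : y ∈ frontier (A \ closure (B ∪ C))) : (y ∈ A ∨ y ∈ frontier A) ∧ y ∉ B ∧ y ∉ C ∧
      (y ∈ A → y ∈ frontier B ∨ y ∈ frontier C) := by
  have hD : IsOpen (A \ closure (B ∪ C)) := hA.sdiff isClosed_closure
  have hdis : ∀ U : Set X, IsOpen U → U ⊆ B ∪ C → y ∉ U := by
    intro U hU hs hyU
    obtain ⟨v, hv, hv2⟩ := mem_closure_iff.1 (frontier_subset_closure hy) U hU hyU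
    exact hv2.2 (subset_closure (hs hv))
  have hyB := hdis B hB subset_union_left
  have hyC := hdis C hC subset_union_right
  rw [hD.frontier_eq] at hy
  refine ⟨?_, hyB, hyC, fun hyA => ?_⟩
  · rw [hA.frontier_eq]
    by_cases hh : y ∈ A
    · exact Or.inl hh
    · exact Or.inr ⟨closure_mono (fun _ h => h.1) hy.1, hh⟩
  · rw [hB.frontier_eq, hC.frontier_eq]
    have : y ∈ closure (B ∪ C) := by
      by_contra h
      exact hy.2 ⟨hyA, h⟩
    rw [closure_union] at this
    rcases this with h | h
    · exact Or.inl ⟨h, hyB⟩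
    · exact Or.inr ⟨h, hyC⟩

open Classical in
theorem prop_count {p0 p1 p2 p3 a b c a' b' c' : Prop}
    (t0 : p0 → (a' ∨ a) ∧ (b' ∨ b) ∧ (c' ∨ c) ∧ ¬ (a' ∧ b' ∧ c'))
    (t1 : p1 → (a' ∨ a) ∧ ¬ b' ∧ ¬ c' ∧ (a' → b ∨ c))
    (t2 : p2 → (b' ∨ b) ∧ ¬ a' ∧ ¬ c' ∧ (b' → a ∨ c))
    (t3 : p3 → (c' ∨ c) ∧ ¬ a' ∧ ¬ b' ∧ (c' → a ∨ b))
    (d1 : a' → ¬ a) (d2 : b' → ¬ b) (d3 : c' → ¬ c) :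
    (if p0 then 1 else 0) + (if p1 then 1 else 0) + (if p2 then 1 else 0) + (if p3 then 1 else 0)
    ≤ (if a then 1 else 0) + (if b then 1 else 0) + (if c then 1 else 0) +
      (if (a ∧ b) ∧ c then 1 else 0) := by
  by_cases ha : a <;> by_cases hb : b <;> by_cases hc : c <;>
    simp only [ha, hb, hc, true_and, and_true, and_false, false_and, if_true, if_false,
      not_true_eq_false, not_false_eq_true, or_true, or_false, imp_false, imp_true_iff] at * <;> grind

theorem three_ineq {A B C : Set X} (hA : IsOpen A) (hB : IsOpen B) (hC : IsOpen C)
    (fA : (frontier A).Finite) (fB : (frontier B).Finite) (fC : (frontier C).Finite) :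
    ((frontier (A ∩ B ∩ C)).Finite ∧ (frontier (A \ closure (B ∪ C))).Finite ∧
    (frontier (B \ closure (A ∪ C))).Finite ∧ (frontier (C \ closure (A ∪ B))).Finite) ∧
    (frontier (A ∩ B ∩ C)).ncard + (frontier (A \ closure (B ∪ C))).ncard +
    (frontier (B \ closure (A ∪ C))).ncard + (frontier (C \ closure (A ∪ B))).ncard ≤
    (frontier A).ncard + (frontier B).ncard + (frontier C).ncard +
      (frontier A ∩ frontier B ∩ frontier C).ncard := by
  classical
  have hG : (frontier A ∪ frontier B ∪ frontier C).Finite := (fA.union fB).union fC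
  obtain ⟨G, hGe⟩ := hG.exists_finset_coe
  have dj : ∀ U : Set X, IsOpen U → ∀ y, y ∈ U → y ∉ frontier U := by
    intro U hU y hy h; rw [hU.frontier_eq] at h; exact h.2 hy
  have s0 : frontier (A ∩ B ∩ C) ⊆ G := by
    rw [hGe]; intro y hy
    have := fr_inter3 hA hB hC hy
    simp only [mem_union]; tauto
  have s1 : frontier (A \ closure (B ∪ C)) ⊆ G := by
    rw [hGe]; intro y hy
    have := fr_diff hA hB hC hy
    simp only [mem_union]; tauto
  have s2 : frontier (B \ closure (A ∪ C)) ⊆ G := by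
    rw [hGe]; intro y hy
    have := fr_diff hB hA hC hy
    simp only [mem_union]; tauto
  have s3 : frontier (C \ closure (A ∪ B)) ⊆ G := by
    rw [hGe]; intro y hy
    have := fr_diff hC hA hB hy
    simp only [mem_union]; tauto
  refine ⟨⟨G.finite_toSet.subset s0, G.finite_toSet.subset s1, G.finite_toSet.subset s2,
    G.finite_toSet.subset s3⟩, ?_⟩
  rw [ncard_sum G _ s0, ncard_sum G _ s1, ncard_sum G _ s2, ncard_sum G _ s3,
    ncard_sum G (frontier A) (by rw [hGe]; intro y hy; exact Or.inl (Or.inl hy)),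
    ncard_sum G (frontier B) (by rw [hGe]; intro y hy; exact Or.inl (Or.inr hy)),
    ncard_sum G (frontier C) (by rw [hGe]; intro y hy; exact (Or.inr hy)),
    ncard_sum G (frontier A ∩ frontier B ∩ frontier C)
      (by rw [hGe]; intro y hy; exact (Or.inr hy.2))]
  simp only [← Finset.sum_add_distrib]
  apply Finset.sum_le_sum
  intro y _
  have t0 := fr_inter3 (y := y) hA hB hC
  have t1 := fr_diff (y := y) hA hB hC
  have t2 := fr_diff (y := y) hB hA hC
  have t3 := fr_diff (y := y) hC hA hB
  have d1 := dj A hA y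
  have d2 := dj B hB y
  have d3 := dj C hC y
  have e : y ∈ frontier A ∩ frontier B ∩ frontier C ↔
    (y ∈ frontier A ∧ y ∈ frontier B) ∧ y ∈ frontier C := Iff.rfl
  rw [if_congr e rfl rfl]
  exact prop_count t0 t1 t2 t3 d1 d2 d3

theorem three_set {Q : Set X} {n : ℕ} {A B C : Set X} (hA : Cut Q A) (hB : Cut Q B) (hC : Cut Q C)
    (nA : (frontier A).ncard ≤ n) (nB : (frontier B).ncard ≤ n) (nC : (frontier C).ncard ≤ n)
    (pA : IsPreconnected A) {c α β γ : X} (hc : c ∈ A ∩ B ∩ C)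
    (hα : α ∈ A \ closure (B ∪ C)) (hβ : β ∈ B \ closure (A ∪ C)) (hγ : γ ∈ C \ closure (A ∪ B))
    (gc : Hgt Q n c) (gα : Hgt Q n α) (gβ : Hgt Q n β) (gγ : Hgt Q n γ) : False := by
  obtain ⟨⟨f0, f1, f2, f3⟩, hle⟩ := three_ineq hA.1 hB.1 hC.1 hA.2.1 hB.2.1 hC.2.1
  have q0 := gc _ ⟨(hA.1.inter hB.1).inter hC.1, f0,
    hA.2.2.mono_left (closure_mono fun _ h => h.1.1)⟩ hc
  have q1 := gα _ ⟨hA.1.sdiff isClosed_closure, f1,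
    hA.2.2.mono_left (closure_mono fun _ h => h.1)⟩ hα
  have q2 := gβ _ ⟨hB.1.sdiff isClosed_closure, f2,
    hB.2.2.mono_left (closure_mono fun _ h => h.1)⟩ hβ
  have q3 := gγ _ ⟨hC.1.sdiff isClosed_closure, f3,
    hC.2.2.mono_left (closure_mono fun _ h => h.1)⟩ hγ
  have hn : n ≤ (frontier A ∩ frontier B ∩ frontier C).ncard := by omega
  have e1 : frontier A ∩ frontier B ∩ frontier C = frontier A :=
    Set.eq_of_subset_of_ncard_le (fun _ h => h.1.1) (nA.trans hn) hA.2.1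
  have e2 : frontier A ∩ frontier B ∩ frontier C = frontier B :=
    Set.eq_of_subset_of_ncard_le (fun _ h => h.1.2) (nB.trans hn) hB.2.1
  obtain ⟨y, hyA, hyB⟩ := preconn_meets pA ⟨c, hc.1⟩ ⟨α, hα.1, fun h =>
    hα.2 (subset_closure (Or.inl h))⟩
  rw [← e2, e1, hA.1.frontier_eq] at hyB
  exact hyB.2 hyA
end

theorem comb {R Rb : ℕ → Prop} (hinf : ∀ K, ∃ r, K ≤ r ∧ R r) (hsub : ∀ r, R r → Rb r)
    (hfin : ∃ K0, ∀ k, K0 ≤ k → Rb k → R k)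
    (hgap : ∀ l K, ∃ g, K ≤ g ∧ ∀ t, t < l → ¬ Rb (g + t)) :
    ∃ k1 k2 k3 m1 m2 m3, R k1 ∧ R k2 ∧ R k3 ∧ R (m1 + k1) ∧ R (m2 + k2) ∧ R (m3 + k3) ∧
      ¬ Rb (m1 + k2) ∧ ¬ Rb (m1 + k3) ∧ ¬ Rb (m2 + k1) ∧ ¬ Rb (m2 + k3) ∧
      ¬ Rb (m3 + k1) ∧ ¬ Rb (m3 + k2) := by
  classical
  obtain ⟨K0, hK0⟩ := hfin
  have LA : ∀ l K, ∃ r, K ≤ r ∧ R r ∧ ∀ t, 1 ≤ t → t ≤ l → ¬ Rb (r + t) := by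
    intro l K
    obtain ⟨r0, h1, h2⟩ := hinf (max K K0)
    obtain ⟨g, hg, hgl⟩ := hgap (l + 1) (r0 + 1)
    have hle : r0 ≤ Nat.findGreatest Rb g := Nat.le_findGreatest (by omega) (hsub _ h2)
    have hsp : Rb (Nat.findGreatest Rb g) :=
      Nat.findGreatest_spec (P := Rb) (m := r0) (n := g) (by omega) (hsub _ h2)
    set r := Nat.findGreatest Rb g with hr
    refine ⟨r, by omega, hK0 r (by omega) hsp, ?_⟩
    intro t ht1 ht2 hRb
    have hrg : r ≤ g := Nat.findGreatest_le g
    by_cases hh : r + t ≤ g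
    · have := Nat.le_findGreatest hh hRb
      omega
    · have := hgl (r + t - g) (by omega)
      rw [show g + (r + t - g) = r + t by omega] at this
      exact this hRb
  have FI : ∀ l K, ∃ r, K ≤ r ∧ R r ∧ ∀ s t, 1 ≤ t → t ≤ l → s + t = r → ¬ Rb s := by
    intro l K
    obtain ⟨g, hg, hgl⟩ := hgap (l + 1) (max K K0)
    have hex : ∃ r, g ≤ r ∧ Rb r := by
      obtain ⟨r, h1, h2⟩ := hinf g
      exact ⟨r, h1, hsub _ h2⟩
    have hsp := Nat.find_spec hex
    set r := Nat.find hex with hr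
    refine ⟨r, by omega, hK0 r (by omega) hsp.2, ?_⟩
    intro s t h1 h2 h3 hRb
    have hrg : g + l < r := by
      by_contra hcon
      have := hgl (r - g) (by omega)
      rw [show g + (r - g) = r by omega] at this
      exact this hsp.2
    exact Nat.find_min hex (m := s) (by omega) ⟨by omega, hRb⟩
  obtain ⟨k1, -, hk1⟩ := hinf 0
  obtain ⟨k2, hk12, hk2⟩ := hinf (k1 + 1)
  obtain ⟨r2, a1, a2, a3⟩ := FI (k2 - k1) (k2 + 1)
  obtain ⟨k3, b1, b2, b3⟩ := LA (r2 - k2) (k2 + 1)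
  obtain ⟨r1, c1, c2, c3⟩ := LA (k3 - k1) k1
  obtain ⟨r3, d1, d2, d3⟩ := FI (k3 - k1) k3
  refine ⟨k1, k2, k3, r1 - k1, r2 - k2, r3 - k3, hk1, hk2, b2, ?_, ?_, ?_, ?_, ?_, ?_, ?_, ?_, ?_⟩
  · rwa [show r1 - k1 + k1 = r1 by omega]
  · rwa [show r2 - k2 + k2 = r2 by omega]
  · rwa [show r3 - k3 + k3 = r3 by omega]
  · rw [show r1 - k1 + k2 = r1 + (k2 - k1) by omega]; exact c3 _ (by omega) (by omega)
  · rw [show r1 - k1 + k3 = r1 + (k3 - k1) by omega]; exact c3 _ (by omega) (by omega)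
  · exact a3 _ (k2 - k1) (by omega) (by omega) (by omega)
  · rw [show r2 - k2 + k3 = k3 + (r2 - k2) by omega]; exact b3 _ (by omega) (by omega)
  · exact d3 _ (k3 - k1) (by omega) (by omega) (by omega)
  · exact d3 _ (k3 - k2) (by omega) (by omega) (by omega)

/-- full orbit -/
def Orb {X : Type*} [TopologicalSpace X] (f : X ≃ₜ X) (x : X) : Set X :=
  {w | ∃ k : ℤ, (f ^ k) x = w}

section
variable {X : Type*} [TopologicalSpace X] {f : X ≃ₜ X}

theorem Orb_self (x : X) : x ∈ Orb f x := ⟨0, zp_zero f x⟩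

theorem inv_zp (f : X ≃ₜ X) (k : ℤ) (x : X) : (f⁻¹ ^ k) x = (f ^ (-k)) x := by
  rw [inv_zpow, zpow_neg]

theorem inv_ap (f : X ≃ₜ X) (x : X) : f⁻¹ x = (f ^ (-1 : ℤ)) x := by
  rw [zpow_neg_one]

theorem Orb_inv (x : X) : IsInv f (Orb f x) := by
  apply inv_of_image
  · rintro _ ⟨k, rfl⟩
    exact ⟨1 + k, by rw [zp_add, zp_one]⟩
  · rintro _ ⟨k, rfl⟩
    exact ⟨-1 + k, by rw [zp_add, zpow_neg_one]⟩

theorem Orb_sub {S : Set X} (h : IsInv f S) {x : X} (hx : x ∈ S) : Orb f x ⊆ S := by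
  rintro _ ⟨k, rfl⟩
  exact (h.mem k x).2 hx

theorem Om_closed (s : X) : IsClosed (Om f s) := by
  rw [← closure_subset_iff_isClosed]
  intro a ha V hV haV K
  obtain ⟨b, hbV, hb⟩ := mem_closure_iff.1 ha V hV haV
  exact hb V hV hbV K

theorem Om_inv (s : X) : IsInv f (Om f s) := by
  apply inv_of_image
  · intro a ha V hV haV K
    obtain ⟨k, hk, h⟩ := ha (f ⁻¹' V) (hV.preimage f.continuous) haV K
    refine ⟨k + 1, by omega, ?_⟩
    have : (f ^ ((k + 1 : ℕ) : ℤ)) s = f ((f ^ (k : ℤ)) s) := by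
      rw [← zp_one f ((f ^ (k : ℤ)) s), ← zp_add]; push_cast; rw [add_comm]
    rw [this]; exact h
  · intro a ha V hV haV K
    obtain ⟨k, hk, h⟩ := ha ((f⁻¹ : X ≃ₜ X) ⁻¹' V) (hV.preimage (f⁻¹).continuous) haV (K + 1)
    refine ⟨k - 1, by omega, ?_⟩
    have : (f ^ ((k - 1 : ℕ) : ℤ)) s = f⁻¹ ((f ^ (k : ℤ)) s) := by
      rw [inv_ap, ← zp_add]; congr 2; omega
    rw [this]; exact h

theorem Hgt_inv {Q : Set X} (hQ : IsInv f Q) {n : ℕ} {s : X} (h : Hgt Q n s) (k : ℤ) :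
    Hgt Q n ((f ^ k) s) := by
  intro U hU hs
  rw [← ncard_frontier_pre (f ^ k) U]
  refine h _ ⟨hU.1.preimage (f ^ k).continuous, finite_frontier_pre _ hU.2.1, ?_⟩ hs
  rw [← (f ^ k).preimage_closure, disjoint_left]
  intro x hx hxQ
  exact disjoint_left.1 hU.2.2 hx ((hQ.mem k x).2 hxQ)

theorem Cut_pre {Q : Set X} (hQ : IsInv f Q) {U : Set X} (hU : Cut Q U) (k : ℤ) :
    Cut Q ((f ^ k) ⁻¹' U) := by
  refine ⟨hU.1.preimage (f ^ k).continuous, finite_frontier_pre _ hU.2.1, ?_⟩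
  rw [← (f ^ k).preimage_closure, disjoint_left]
  intro x hx hxQ
  exact disjoint_left.1 hU.2.2 hx ((hQ.mem k x).2 hxQ)

theorem NonPer.inj {s : X} (h : NonPer f s) {a b : ℕ} (he : (f ^ (a : ℤ)) s = (f ^ (b : ℤ)) s) :
    a = b := by
  by_contra hab
  rcases lt_or_gt_of_ne hab with hl | hl
  · apply h (b - a) (by omega)
    have : ((b - a : ℕ) : ℤ) = -a + b := by omega
    rw [this, zp_add, ← he, zp_neg]
  · apply h (a - b) (by omega)
    have : ((a - b : ℕ) : ℤ) = -b + a := by omega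
    rw [this, zp_add, he, zp_neg]
end

section
variable {X : Type*} [MetricSpace X] [CompactSpace X] {f : X ≃ₜ X}

theorem thmT [LocallyConnectedSpace X] {Q : Set X} (hQ : IsInv f Q) {s a z : X} {n : ℕ} {U : Set X}
    (hs : NonPer f s) (ha : a ∈ Om f s) (hzQ : z ∈ Q) (hz : z ∈ Om f s) (hU : Cut Q U) (haU : a ∈ U)
    (hn : (frontier U).ncard ≤ n) (hh : Hgt Q n s) : False := by
  set U' := connectedComponentIn U a with hU'
  have hfr : frontier U' ⊆ frontier U := by
    intro w hw
    rw [hU.1.frontier_eq]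
    exact ⟨closure_mono (connectedComponentIn_subset _ _) (frontier_subset_closure hw),
      comp_frontier hU.1 hw⟩
  have hcut : Cut Q U' := ⟨hU.1.connectedComponentIn, hU.2.1.subset hfr,
    hU.2.2.mono_left (closure_mono (connectedComponentIn_subset _ _))⟩
  have hn' : (frontier U').ncard ≤ n := (Set.ncard_le_ncard hfr hU.2.1).trans hn
  have haU' : a ∈ U' := mem_connectedComponentIn haU
  have hpc : IsPreconnected U' := isPreconnected_connectedComponentIn
  clear_value U'
  obtain ⟨k1, k2, k3, m1, m2, m3, h1, h2, h3, h4, h5, h6, h7, h8, h9, h10, h11, h12⟩ :=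
    comb (R := fun k => (f ^ (k : ℤ)) s ∈ U') (Rb := fun k => (f ^ (k : ℤ)) s ∈ closure U')
    (fun K => ha U' hcut.1 haU' K) (fun r h => subset_closure h)
    (by
      have hfin : {k : ℕ | (f ^ (k : ℤ)) s ∈ frontier U'}.Finite :=
        hcut.2.1.preimage (f := fun k : ℕ => (f ^ (k : ℤ)) s) (fun a _ b _ h => hs.inj h)
      obtain ⟨K, hK⟩ := hfin.bddAbove
      refine ⟨K + 1, fun k hk hcl => ?_⟩
      by_contra hno
      have : k ≤ K := hK (by
        change (f ^ (k : ℤ)) s ∈ frontier U'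
        rw [hcut.1.frontier_eq]; exact ⟨hcl, hno⟩)
      omega)
    (by
      intro l K
      obtain ⟨g, hg, hgV⟩ := hz (⋂ t ∈ Finset.range l, (f ^ (t : ℤ)) ⁻¹' (closure U')ᶜ)
        (isOpen_biInter_finset fun t _ =>
          isClosed_closure.isOpen_compl.preimage (f ^ (t : ℤ)).continuous)
        (by
          simp only [mem_iInter]
          intro t _ hcl
          exact disjoint_left.1 hcut.2.2 hcl ((hQ.mem t z).2 hzQ)) K
      refine ⟨g, hg, fun t ht hcl => ?_⟩
      simp only [mem_iInter] at hgV
      apply hgV t (Finset.mem_range.2 ht)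
      rw [← zp_add]
      rw [add_comm]
      exact_mod_cast hcl)
  have ex : ∀ m k : ℕ, (f ^ ((m + k : ℕ) : ℤ)) s = (f ^ (k : ℤ)) ((f ^ (m : ℤ)) s) := by
    intro m k
    rw [← zp_add]; push_cast; rw [add_comm]
  simp only [ex] at h4 h5 h6 h7 h8 h9 h10 h11 h12
  have cl2 : ∀ (m k k' : ℕ), (f ^ (k : ℤ)) ((f ^ (m : ℤ)) s) ∉ closure U' →
      (f ^ (k' : ℤ)) ((f ^ (m : ℤ)) s) ∉ closure U' →
      (f ^ (m : ℤ)) s ∉ closure ((f ^ (k : ℤ)) ⁻¹' U' ∪ (f ^ (k' : ℤ)) ⁻¹' U') := by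
    intro m k k' hk hk' hm
    rw [closure_union, ← Homeomorph.preimage_closure, ← Homeomorph.preimage_closure] at hm
    rcases hm with h | h
    · exact hk h
    · exact hk' h
  refine three_set (c := s) (α := (f ^ (m1 : ℤ)) s) (β := (f ^ (m2 : ℤ)) s) (γ := (f ^ (m3 : ℤ)) s)
    (Cut_pre hQ hcut k1) (Cut_pre hQ hcut k2) (Cut_pre hQ hcut k3)
    (by rwa [ncard_frontier_pre]) (by rwa [ncard_frontier_pre]) (by rwa [ncard_frontier_pre])
    ?_ ⟨⟨h1, h2⟩, h3⟩ ⟨h4, cl2 _ _ _ h7 h8⟩ ⟨h5, cl2 _ _ _ h9 h10⟩ ⟨h6, cl2 _ _ _ h11 h12⟩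
    hh (Hgt_inv hQ hh _) (Hgt_inv hQ hh _) (Hgt_inv hQ hh _)
  exact ((f ^ (k1 : ℤ)).isPreconnected_preimage).2 hpc

theorem lem5 [ConnectedSpace X] (hreg : RegC X) {P B : Set X} (hPf : P.Finite) (hPn : P.Nonempty)
    (hPI : IsInv f P) (hB : IsClosed B) (hBI : IsInv f B) (hBn : B.Nonempty) :
    ∃ Z ⊆ B, Z.Nonempty ∧ IsClosed Z ∧ IsInv f Z ∧ ∀ z ∈ Z, RAP f z := by
  have := locConn hreg
  by_cases hPB : (P ∩ B).Nonempty
  · have hI := hPI.inter hBI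
    have hF : (P ∩ B).Finite := hPf.inter_of_left _
    exact ⟨P ∩ B, inter_subset_right, hPB, hF.isClosed, hI, fun z hz => RAP_of_fin hF hI hz⟩
  · rw [not_nonempty_iff_eq_empty, ← disjoint_iff_inter_eq_empty] at hPB
    set G := ⋃₀ {N | Good f P N ∧ Disjoint N B} with hG
    have hGI : IsInv f G := by
      intro x
      constructor
      · rintro ⟨N, hN, hx⟩
        exact ⟨N, hN, (hN.1.2.1 x).1 hx⟩
      · rintro ⟨N, hN, hx⟩
        exact ⟨N, hN, (hN.1.2.1 x).2 hx⟩
    refine ⟨B ∩ closure G, inter_subset_left, ?_, hB.inter isClosed_closure, hBI.inter hGI.cl,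
      fun z hz => lem4a hreg hz.1 hz.2⟩
    obtain ⟨p, hp⟩ := hPn
    obtain ⟨z, hz, hzB⟩ := lem4b hreg hPf.isClosed hB hPB hPI hBI hp hBn
    refine ⟨z, hzB, closure_mono ?_ hz⟩
    rintro _ ⟨k, y, ⟨N, hN, S, hSN, -, -, hy⟩, rfl⟩
    exact ⟨N, hN, (hN.1.2.1.mem k y).2 (hSN hy)⟩

theorem RAP_of_not_nonPer {x : X} (h : ¬ NonPer f x) : RAP f x := by
  unfold NonPer at h
  push Not at h
  obtain ⟨n, hn, he⟩ := h
  intro ε hε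
  refine ⟨n, hn, fun k => ?_⟩
  have hI : IsInv (f ^ (n : ℤ)) {x} := by
    intro y
    simp only [mem_singleton_iff]
    constructor
    · intro hx; apply (f ^ (n : ℤ)).injective; rw [hx, he]
    · rintro rfl; exact he
  have : (f ^ ((n : ℤ) * k)) x = x := by
    rw [zp_mul]; exact (hI.mem k x).2 rfl
  rw [this, dist_self]; exact hε.le

theorem exists_min_cut (hreg : RegC X) {Z : Set X} (hZ : IsClosed Z) {a : X} (ha : a ∉ Z) :
    ∃ U, Cut Z U ∧ a ∈ U := by
  obtain ⟨U, h1, h2, h3, h4⟩ := exists_cut hreg (isClosed_singleton (x := a)) hZ.isOpen_compl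
    (singleton_subset_iff.2 ha)
  exact ⟨U, ⟨h1, h4, disjoint_left.2 h3⟩, h2 rfl⟩

theorem lemR [ConnectedSpace X] (hreg : RegC X) {P : Set X} (hPf : P.Finite) (hPn : P.Nonempty)
    (hPI : IsInv f P) {a : X} (ha : a ∈ Om f a) : RAP f a := by
  have := locConn hreg
  by_contra hno
  obtain ⟨Z, hZB, ⟨z, hz⟩, hZc, hZI, hZR⟩ := lem5 hreg hPf hPn hPI (Om_closed a) (Om_inv (f := f) a) ⟨a, ha⟩
  have haZ : a ∉ Z := fun h => hno (hZR a h)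
  have hnp : NonPer f a := by
    by_contra h; exact hno (RAP_of_not_nonPer h)
  classical
  have hex : ∃ n, ∃ U, Cut Z U ∧ a ∈ U ∧ (frontier U).ncard = n := by
    obtain ⟨U, hU, haU⟩ := exists_min_cut hreg hZc haZ
    exact ⟨_, U, hU, haU, rfl⟩
  obtain ⟨U, hU, haU, hn⟩ := Nat.find_spec hex
  exact thmT hZI hnp ha hz (hZB hz) hU haU hn.le
    (fun V hV haV => Nat.find_min' hex ⟨V, hV, haV, rfl⟩)

theorem RAP_inv {x : X} : RAP f⁻¹ x ↔ RAP f x := by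
  constructor
  · intro h ε hε
    obtain ⟨r, hr, h⟩ := h ε hε
    refine ⟨r, hr, fun k => ?_⟩
    have := h (-k)
    rw [inv_zp] at this
    rwa [show -((r : ℤ) * -k) = r * k by ring] at this
  · intro h ε hε
    obtain ⟨r, hr, h⟩ := h ε hε
    refine ⟨r, hr, fun k => ?_⟩
    rw [inv_zp, show -((r : ℤ) * k) = r * -k by ring]
    exact h _

theorem RAP_isInv : IsInv f {x | RAP f x} := by
  have key : ∀ g : X ≃ₜ X, (∀ k : ℤ, g * f ^ k = f ^ k * g) → ∀ x, RAP f x → RAP f (g x) := by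
    intro g hg x hx ε hε
    have huc := CompactSpace.uniformContinuous_of_continuous g.continuous
    obtain ⟨δ, hδ, h⟩ := Metric.uniformContinuous_iff.1 huc ε hε
    obtain ⟨r, hr, h2⟩ := hx (δ / 2) (half_pos hδ)
    refine ⟨r, hr, fun k => ?_⟩
    have e : (f ^ ((r : ℤ) * k)) (g x) = g ((f ^ ((r : ℤ) * k)) x) :=
      (DFunLike.congr_fun (hg ((r : ℤ) * k)) x).symm
    rw [e]
    exact (h (lt_of_le_of_lt (h2 k) (half_lt_self hδ))).le
  apply inv_of_image
  · exact key f (fun k => (Commute.refl f).zpow_right k)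
  · exact key f⁻¹ (fun k => ((Commute.refl f).zpow_right k).inv_left)

theorem zp_mod (f : X ≃ₜ X) {r : ℕ} (hr : 0 < r) (k : ℤ) (x : X) :
    ∃ j ∈ Finset.range r, ∃ m : ℤ, (f ^ k) x = (f ^ (j : ℤ)) ((f ^ ((r : ℤ) * m)) x) := by
  have hr' : (0 : ℤ) < r := by exact_mod_cast hr
  refine ⟨(k % r).toNat, ?_, k / r, ?_⟩
  · rw [Finset.mem_range]
    have := Int.emod_lt_of_pos k hr'
    have := Int.emod_nonneg k hr'.ne'
    omega
  · rw [← zp_add]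
    congr 2
    have := Int.emod_nonneg k hr'.ne'
    have := Int.emod_add_mul_ediv k r
    omega

theorem RAP_min {x w : X} (hx : RAP f x) (hw : w ∈ closure (Orb f x)) : x ∈ closure (Orb f w) := by
  rw [Metric.mem_closure_iff]
  intro ε hε
  obtain ⟨r, hr, h⟩ := hx (ε / 2) (half_pos hε)
  have hsub : Orb f x ⊆ ⋃ j ∈ Finset.range r, (f ^ (j : ℤ)) '' Metric.closedBall x (ε / 2) := by
    rintro _ ⟨k, rfl⟩
    obtain ⟨j, hj, m, e⟩ := zp_mod f hr k x
    simp only [mem_iUnion]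
    exact ⟨j, hj, _, h m, e.symm⟩
  have hcl : IsClosed (⋃ j ∈ Finset.range r, (f ^ (j : ℤ)) '' Metric.closedBall x (ε / 2)) :=
    isClosed_biUnion_finset fun j _ =>
      (f ^ (j : ℤ)).isClosed_image.2 Metric.isClosed_closedBall
  have := closure_minimal hsub hcl hw
  simp only [mem_iUnion] at this
  obtain ⟨j, hj, v, hv, rfl⟩ := this
  refine ⟨v, ⟨-j, zp_neg f j v⟩, ?_⟩
  rw [Metric.mem_closedBall, dist_comm] at hv
  linarith

theorem Cp_trans {A B : Set X} {x p y : X} (h : p ∈ Cp f A B x) (h' : y ∈ Cp f A B p) :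
    y ∈ Cp f A B x := by
  obtain ⟨N, hN, S, hSN, hS, hx, hp⟩ := h
  obtain ⟨N', hN', S', hSN', hS', hp', hy⟩ := h'
  exact ⟨N ∪ N', ⟨hN.1.union hN'.1, disjoint_union_left.2 ⟨hN.2, hN'.2⟩⟩, S ∪ S',
    union_subset_union hSN hSN', hS.union p hp hp' hS', Or.inl hx, Or.inr hy⟩
end

section
variable {X : Type*} [MetricSpace X] [CompactSpace X] {f : X ≃ₜ X}

theorem not_Om {s a : X} (h : a ∉ Om f s) : ∃ V, IsOpen V ∧ a ∈ V ∧ ∃ K : ℕ, ∀ k : ℕ, K ≤ k →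
    (f ^ (k : ℤ)) s ∉ V := by
  by_contra hno
  push Not at hno
  apply h
  intro V hV haV K
  obtain ⟨k, hk, h⟩ := hno V hV haV K
  exact ⟨k, hk, h⟩

theorem isolated {a : X} (h1 : a ∉ Om f a) (h2 : a ∉ Om f⁻¹ a) :
    ∃ δ > 0, ∀ y ∈ closure (Orb f a), dist y a < δ → y = a := by
  obtain ⟨V1, o1, m1, K1, hK1⟩ := not_Om h1
  obtain ⟨V2, o2, m2, K2, hK2⟩ := not_Om h2
  set T : Set X := (fun k : ℤ => (f ^ k) a) '' (Set.Icc (-(K2 : ℤ)) K1) \ {a} with hT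
  have hTf : T.Finite := ((Set.finite_Icc _ _).image _).subset diff_subset
  set V := (V1 ∩ V2) \ T with hV
  have hVo : IsOpen V := (o1.inter o2).sdiff hTf.isClosed
  have haV : a ∈ V := ⟨⟨m1, m2⟩, fun h => h.2 rfl⟩
  have key : ∀ y ∈ Orb f a, y ∈ V → y = a := by
    rintro _ ⟨k, rfl⟩ hk
    by_contra hne
    by_cases hk1 : (K1 : ℤ) ≤ k
    · obtain ⟨n, rfl⟩ := Int.eq_ofNat_of_zero_le (by omega : (0 : ℤ) ≤ k)
      exact hK1 n (by omega) hk.1.1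
    by_cases hk2 : k ≤ -(K2 : ℤ)
    · obtain ⟨n, hn⟩ := Int.eq_ofNat_of_zero_le (by omega : (0 : ℤ) ≤ -k)
      apply hK2 n (by omega)
      rw [inv_zp, ← hn, neg_neg]
      exact hk.1.2
    · exact hk.2 ⟨⟨k, ⟨by omega, by omega⟩, rfl⟩, hne⟩
  obtain ⟨δ, hδ, hb⟩ := Metric.isOpen_iff.1 hVo a haV
  refine ⟨δ, hδ, fun y hy hd => ?_⟩
  by_contra hne
  obtain ⟨w, hw, hwO⟩ := mem_closure_iff.1 hy (V \ {a}) (hVo.sdiff isClosed_singleton)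
    ⟨hb hd, hne⟩
  exact hw.2 (key w hwO hw.1)

theorem RAP_closed [ConnectedSpace X] (hreg : RegC X) {P : Set X} (hPf : P.Finite)
    (hPn : P.Nonempty) (hPI : IsInv f P) : IsClosed {x | RAP f x} := by
  have := locConn hreg
  rw [← closure_subset_iff_isClosed]
  intro a ha
  by_contra hno
  change ¬ RAP f a at hno
  have n1 : a ∉ Om f a := fun h => hno (lemR hreg hPf hPn hPI h)
  have n2 : a ∉ Om f⁻¹ a := fun h => hno (RAP_inv.1 (lemR hreg hPf hPn hPI.inv h))
  obtain ⟨δ, hδ, hiso⟩ := isolated n1 n2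
  set B := closure (Orb f a) with hB
  have hBc : IsClosed B := isClosed_closure
  have hBI : IsInv f B := (Orb_inv a).cl
  have haB : a ∈ B := subset_closure (Orb_self a)
  obtain ⟨F, hF, hFC⟩ := finite_net hreg (half_pos hδ)
  let Xq : X → Set X := fun q => {x | ∃ N, IsOpen N ∧ IsInv f N ∧ (frontier N).Finite ∧
    Disjoint N B ∧ ∃ S ⊆ N, IsPreconnected S ∧ x ∈ S ∧ q ∈ S}
  have main : ∀ x, RAP f x → dist x a < δ / 2 → x ∈ ⋃ q ∈ F, Xq q := by
    intro x hx hxa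
    have hxB : x ∉ B := by
      intro h
      have := hiso x h (by linarith)
      subst this
      exact hno hx
    set O := closure (Orb f x) with hO
    have hOI : IsInv f O := (Orb_inv x).cl
    have hxO : x ∈ O := subset_closure (Orb_self x)
    have hOB : Disjoint O B := by
      rw [disjoint_left]
      intro w hwO hwB
      have h1 := RAP_min hx hwO
      exact hxB (closure_minimal (Orb_sub hBI hwB) hBc h1)
    obtain ⟨z, hz, hzB⟩ := lem4b hreg isClosed_closure hBc hOB hOI hBI hxO ⟨a, haB⟩
    have hself := Cp_self hreg isClosed_closure hBc hOB hOI hBI hxO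
    obtain ⟨ε, hε, hεb⟩ := Metric.isOpen_iff.1 (Cp_open (f := f) (A := O) (B := B) (x := x)) x hself
    obtain ⟨r, hr, hrk⟩ := hx (ε / 2) (half_pos hε)
    have hinv : ∀ m : ℤ, ∀ y ∈ Cp f O B x, (f ^ ((r : ℤ) * m)) y ∈ Cp f O B x := by
      intro m y hy
      refine Cp_trans (hεb ?_) (Cp_img ((r : ℤ) * m) hy)
      rw [Metric.mem_ball]
      have := hrk m
      linarith
    have hsub : {w | ∃ k : ℤ, ∃ y ∈ Cp f O B x, (f ^ k) y = w} ⊆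
        ⋃ j ∈ Finset.range r, (f ^ (j : ℤ)) '' Cp f O B x := by
      rintro _ ⟨k, y, hy, rfl⟩
      obtain ⟨j, hj, m, e⟩ := zp_mod f hr k y
      simp only [mem_iUnion]
      exact ⟨j, hj, _, hinv m y hy, e.symm⟩
    have hz2 := closure_mono hsub hz
    have e := (Finset.range r).finite_toSet.closure_biUnion
      (f := fun j : ℕ => (f ^ (j : ℤ)) '' Cp f O B x)
    simp only [Finset.mem_coe] at e
    rw [e] at hz2
    simp only [mem_iUnion] at hz2
    obtain ⟨j, hj, hz3⟩ := hz2
    rw [← Homeomorph.image_closure] at hz3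
    obtain ⟨z', hz', rfl⟩ := hz3
    have hz'B : z' ∈ B := (hBI.mem j z').1 hzB
    have hz'R : RAP f z' := by
      refine lem4a (A := O) hreg hz'B (closure_mono ?_ hz')
      rintro y ⟨N, hN, S, hSN, -, -, hy⟩
      exact ⟨N, hN, hSN hy⟩
    have hmeet : ∃ q ∈ Cp f O B x, q ∈ F := by
      by_contra hcon
      push Not at hcon
      have h1 : ∀ y ∈ Cp f O B x, y ∈ Metric.closedBall x (δ / 2) := fun y hy =>
        (hFC _ Cp_preconn hcon y hy x hself).le
      have h2 := closure_minimal h1 Metric.isClosed_closedBall hz'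
      rw [Metric.mem_closedBall] at h2
      have := dist_triangle z' x a
      have := hiso z' hz'B (by linarith)
      subst this
      exact hno hz'R
    obtain ⟨q, ⟨N, hN, S, hSN, hS, hxS, hqS⟩, hqF⟩ := hmeet
    simp only [mem_iUnion]
    exact ⟨q, hqF, N, hN.1.1, hN.1.2.1, hN.1.2.2.1, hN.2, S, hSN, hS, hxS, hqS⟩
  have hacl : a ∈ closure (⋃ q ∈ F, Xq q) := by
    rw [mem_closure_iff]
    intro V hV haV
    obtain ⟨x, hxV, hx⟩ := mem_closure_iff.1 ha (V ∩ Metric.ball a (δ / 2))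
      (hV.inter Metric.isOpen_ball) ⟨haV, Metric.mem_ball_self (half_pos hδ)⟩
    exact ⟨x, hxV.1, main x hx hxV.2⟩
  rw [hF.closure_biUnion] at hacl
  simp only [mem_iUnion] at hacl
  obtain ⟨q, -, hq⟩ := hacl
  apply hno
  refine lem4a (A := Orb f q) hreg haB (closure_mono ?_ hq)
  rintro x ⟨N, h1, h2, h3, h4, S, hSN, hS, hxS, hqS⟩
  refine ⟨linkPart (Orb f q) N, ⟨linkPart_good h1 h2 h3 (Orb_sub h2 (hSN hqS)) (Orb_inv q),
    h4.mono_left linkPart_sub⟩, S, hSN, hS, hxS, q, hqS, Orb_self q⟩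
end

theorem mem_nw {X : Type*} [TopologicalSpace X] {f : X ≃ₜ X} {x : X} :
    x ∈ nonwandering (⇑f) ↔ ∀ U, IsOpen U → x ∈ U → ∃ n : ℕ, 0 < n ∧ ∃ y ∈ U, (f ^ (n : ℤ)) y ∈ U := by
  constructor
  · intro h U hU hx
    obtain ⟨n, hn, y, hy1, hy2⟩ := h U (hU.mem_nhds hx)
    exact ⟨n, hn, y, hy2, by rw [zp_nat]; exact hy1⟩
  · intro h U hU
    obtain ⟨V, hVU, hV, hx⟩ := mem_nhds_iff.1 hU
    obtain ⟨n, hn, y, hy1, hy2⟩ := h V hV hx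
    refine ⟨n, hn, y, ?_, hVU hy1⟩
    rw [zp_nat] at hy2
    exact hVU hy2

theorem nw_inv {X : Type*} [TopologicalSpace X] {f : X ≃ₜ X} {x : X} 
    (h : x ∈ nonwandering (⇑f)) : x ∈ nonwandering (⇑(f⁻¹ : X ≃ₜ X)) := by
  rw [mem_nw] at *
  intro U hU hx
  obtain ⟨n, hn, y, h1, h2⟩ := h U hU hx
  refine ⟨n, hn, _, h2, ?_⟩
  rw [inv_zp, zp_neg]
  exact h1

/-- asymptotic -/
def Asy {X : Type*} [MetricSpace X] (g : X ≃ₜ X) (u v : X) : Prop :=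
  ∀ ε > (0 : ℝ), ∃ K : ℕ, ∀ k : ℕ, K ≤ k → dist ((g ^ (k : ℤ)) u) ((g ^ (k : ℤ)) v) < ε

section
variable {X : Type*} [MetricSpace X] [CompactSpace X] {g : X ≃ₜ X}

theorem Asy.symm {u v : X} (h : Asy g u v) : Asy g v u := by
  intro ε hε
  obtain ⟨K, hK⟩ := h ε hε
  exact ⟨K, fun k hk => by rw [dist_comm]; exact hK k hk⟩

theorem Asy.trans {u v w : X} (h : Asy g u v) (h' : Asy g v w) : Asy g u w := by
  intro ε hε
  obtain ⟨K, hK⟩ := h (ε / 2) (half_pos hε)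
  obtain ⟨K', hK'⟩ := h' (ε / 2) (half_pos hε)
  refine ⟨max K K', fun k hk => ?_⟩
  have h1 := hK k (le_trans (le_max_left _ _) hk)
  have h2 := hK' k (le_trans (le_max_right _ _) hk)
  have := dist_triangle ((g ^ (k : ℤ)) u) ((g ^ (k : ℤ)) v) ((g ^ (k : ℤ)) w)
  linarith

theorem Asy.shift {u v : X} (h : Asy g u v) (r : ℕ) :
    Asy g ((g ^ (r : ℤ)) u) ((g ^ (r : ℤ)) v) := by
  intro ε hε
  obtain ⟨K, hK⟩ := h ε hε
  refine ⟨K, fun k hk => ?_⟩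
  have := hK (k + r) (by omega)
  rw [← zp_add, ← zp_add]
  exact_mod_cast this

theorem Asy.om {u v a : X} (h : Asy g u v) (ha : a ∈ Om g u) : a ∈ Om g v := by
  intro V hV haV K
  obtain ⟨ε, hε, hb⟩ := Metric.isOpen_iff.1 hV a haV
  obtain ⟨K', hK'⟩ := h (ε / 2) (half_pos hε)
  obtain ⟨k, hk, hku⟩ := ha (Metric.ball a (ε / 2)) Metric.isOpen_ball
    (Metric.mem_ball_self (half_pos hε)) (max K K')
  refine ⟨k, le_trans (le_max_left _ _) hk, hb ?_⟩
  have h1 := hK' k (le_trans (le_max_right _ _) hk)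
  rw [Metric.mem_ball] at hku ⊢
  have := dist_triangle_left ((g ^ (k : ℤ)) v) a ((g ^ (k : ℤ)) u)
  linarith

theorem disj_null (hreg : RegC X) {C : ℕ → Set X} (hC : ∀ k, IsPreconnected (C k))
    (hd : ∀ i j, i ≠ j → Disjoint (C i) (C j)) {ε : ℝ} (hε : 0 < ε) :
    ∃ K, ∀ k, K ≤ k → ∀ u ∈ C k, ∀ v ∈ C k, dist u v < ε := by
  obtain ⟨F, hF, hFC⟩ := finite_net hreg hε
  have hfin : {k | ∃ q ∈ C k, q ∈ F}.Finite := by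
    refine (hF.biUnion (t := fun q => {k | q ∈ C k}) (fun q _ => Set.Subsingleton.finite ?_)).subset ?_
    · intro i hi j hj
      by_contra hne
      exact disjoint_left.1 (hd i j hne) hi hj
    · rintro k ⟨q, hq, hqF⟩
      exact mem_biUnion hqF hq
  obtain ⟨K, hK⟩ := hfin.bddAbove
  refine ⟨K + 1, fun k hk => hFC (C k) (hC k) ?_⟩
  intro y hy hyF
  have : k ≤ K := hK ⟨y, hy, hyF⟩
  omega

theorem wander_null (hreg : RegC X) {C : Set X} (hC : IsPreconnected C)
    (hw : ∀ n : ℕ, 0 < n → ∀ y ∈ C, (g ^ (n : ℤ)) y ∉ C) {ε : ℝ} (hε : 0 < ε) :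
    ∃ K : ℕ, ∀ k : ℕ, K ≤ k → ∀ u ∈ C, ∀ v ∈ C,
      dist ((g ^ (k : ℤ)) u) ((g ^ (k : ℤ)) v) < ε := by
  have hlt : ∀ i j : ℕ, i < j → Disjoint ((g ^ (i : ℤ)) '' C) ((g ^ (j : ℤ)) '' C) := by
    intro i j hij
    rw [disjoint_left]
    rintro _ ⟨u, hu, rfl⟩ ⟨v, hv, he⟩
    apply hw (j - i) (by omega) v hv
    have : ((j - i : ℕ) : ℤ) = -i + j := by omega
    rw [this, zp_add, he, zp_neg]
    exact hu
  obtain ⟨K, hK⟩ := disj_null hreg (C := fun k : ℕ => (g ^ (k : ℤ)) '' C)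
    (fun k => hC.image _ (g ^ (k : ℤ)).continuous.continuousOn)
    (fun i j hij => by
      rcases lt_or_gt_of_ne hij with h | h
      · exact hlt i j h
      · exact (hlt j i h).symm) hε
  exact ⟨K, fun k hk u hu v hv => hK k hk _ (mem_image_of_mem _ hu) _ (mem_image_of_mem _ hv)⟩

theorem loc_asy [LocallyConnectedSpace X] (hreg : RegC X) {y : X} (hy : y ∉ nonwandering (⇑g)) :
    ∃ V, IsOpen V ∧ y ∈ V ∧ ∀ v ∈ V, Asy g y v := by
  rw [mem_nw] at hy
  push Not at hy
  obtain ⟨U, hU, hyU, h⟩ := hy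
  obtain ⟨V, hVU, hVo, hyV, hVc⟩ := connNhd hU hyU
  refine ⟨V, hVo, hyV, fun v hv ε hε => ?_⟩
  obtain ⟨K, hK⟩ := wander_null (g := g) hreg hVc.isPreconnected
    (fun n hn w hw hw' => h n hn w (hVU hw) (hVU hw')) hε
  exact ⟨K, fun k hk => hK k hk y hyV v hv⟩

theorem asy_period {s a : X} {r : ℕ} (h : Asy g s ((g ^ (r : ℤ)) s)) (ha : a ∈ Om g s) :
    (g ^ (r : ℤ)) a = a := by
  by_contra hne
  have hpos := dist_pos.2 hne
  set ε := dist ((g ^ (r : ℤ)) a) a / 3 with hε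
  have hε0 : 0 < ε := by positivity
  obtain ⟨K, hK⟩ := h ε hε0
  obtain ⟨k, hk, h1, h2⟩ := ha (Metric.ball a ε ∩ (g ^ (r : ℤ)) ⁻¹' Metric.ball ((g ^ (r : ℤ)) a) ε)
    (Metric.isOpen_ball.inter (Metric.isOpen_ball.preimage (g ^ (r : ℤ)).continuous))
    ⟨Metric.mem_ball_self hε0, Metric.mem_ball_self hε0⟩ K
  have h3 := hK k hk
  rw [Metric.mem_ball] at h1
  rw [mem_preimage, Metric.mem_ball, ← zp_add, add_comm, zp_add] at h2
  have t1 := dist_triangle ((g ^ (r : ℤ)) a) ((g ^ (k : ℤ)) s) a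
  have t2 := dist_triangle_right ((g ^ (r : ℤ)) a) ((g ^ (k : ℤ)) s) ((g ^ (k : ℤ)) ((g ^ (r : ℤ)) s))
  rw [dist_comm] at h2
  linarith

theorem step2 [ConnectedSpace X] (hreg : RegC X) {Q : Set X} (hQc : IsClosed Q) (hQI : IsInv g Q)
    (hQP : ∀ x, ¬ NonPer g x → x ∈ Q)
    (hZ : ∀ B : Set X, IsClosed B → IsInv g B → B.Nonempty → (B ∩ Q).Nonempty)
    {a s : X} {U : Set X} {n : ℕ} (hU : Cut Q U) (haU : a ∈ U) (hn : (frontier U).ncard ≤ n)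
    (hmin : ∀ V, Cut Q V → (frontier V).ncard < n → ∀ y ∈ V, y ∉ nonwandering (⇑g))
    (hsQ : s ∉ Q) (ha : a ∈ Om g s) : False := by
  have := locConn hreg
  have haQ : a ∉ Q := fun h => disjoint_left.1 hU.2.2 (subset_closure haU) h
  have hap : NonPer g a := by
    by_contra h; exact haQ (hQP a h)
  have fin : ∀ b, b ∉ Q → a ∈ Om g b → Hgt Q n b → False := by
    intro b hb hab hH
    obtain ⟨z, hz, hzQ⟩ := hZ _ (Om_closed b) (Om_inv (f := g) b) ⟨a, hab⟩
    exact thmT hQI (by by_contra h; exact hb (hQP b h)) hab hzQ hz hU haU hn hH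
  set H := ⋃₀ {V | Cut Q V ∧ (frontier V).ncard < n} with hH
  have hHo : IsOpen H := isOpen_sUnion fun V hV => hV.1.1
  have hHQ : ∀ y ∈ H, y ∉ Q := by
    rintro y ⟨V, hV, hy⟩ hyQ
    exact disjoint_left.1 hV.1.2.2 (subset_closure hy) hyQ
  have hgt : ∀ y, y ∉ H → Hgt Q n y := by
    intro y hy V hV hyV
    by_contra hlt
    exact hy ⟨V, ⟨hV, not_le.1 hlt⟩, hyV⟩
  by_cases hsH : s ∈ H
  swap
  · exact fin s hsQ ha (hgt s hsH)
  set L := connectedComponentIn H s with hL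
  have hsL : s ∈ L := mem_connectedComponentIn hsH
  have hLH : L ⊆ H := connectedComponentIn_subset _ _
  have hLp : IsPreconnected L := isPreconnected_connectedComponentIn
  have hLasy : ∀ u ∈ L, ∀ v ∈ L, Asy g u v := by
    intro u hu v hv
    refine hLp.induction₂ (Asy g) ?_ ?_ ?_ hu hv
    · intro y hy
      obtain ⟨V, hV, hyV⟩ := hLH hy
      obtain ⟨W, hW, hyW, hWa⟩ := loc_asy (g := g) hreg (hmin V hV.1 hV.2 y hyV)
      exact mem_nhdsWithin_of_mem_nhds (mem_of_superset (hW.mem_nhds hyW) hWa)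
    · intro x y z _ _ _ h h'
      exact h.trans h'
    · intro x y _ _ h
      exact h.symm
  by_cases hret : ∃ r : ℕ, 0 < r ∧ ∃ u ∈ L, (g ^ (r : ℤ)) u ∈ L
  · obtain ⟨r, hr, u, hu, hru⟩ := hret
    have h1 : Asy g s ((g ^ (r : ℤ)) s) :=
      (hLasy s hsL _ hru).trans ((hLasy u hu s hsL).shift r)
    exact hap r hr (asy_period h1 ha)
  · push Not at hret
    obtain ⟨z, -, hzQ⟩ := hZ _ (Om_closed s) (Om_inv (f := g) s) ⟨a, ha⟩
    have hfr : (frontier L).Nonempty := by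
      rw [nonempty_frontier_iff]
      refine ⟨⟨s, hsL⟩, fun h => hHQ z (hLH (h ▸ mem_univ z)) hzQ⟩
    obtain ⟨b, hb⟩ := hfr
    have hbH : b ∉ H := comp_frontier hHo hb
    have hasy : Asy g s b := by
      intro ε hε
      obtain ⟨K, hK⟩ := wander_null (g := g) hreg hLp hret (half_pos hε)
      refine ⟨K, fun k hk => ?_⟩
      have h1 : L ⊆ {v | dist ((g ^ (k : ℤ)) s) ((g ^ (k : ℤ)) v) ≤ ε / 2} :=
        fun v hv => (hK k hk s hsL v hv).le
      have h2 : IsClosed {v | dist ((g ^ (k : ℤ)) s) ((g ^ (k : ℤ)) v) ≤ ε / 2} :=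
        isClosed_le (continuous_const.dist (g ^ (k : ℤ)).continuous) continuous_const
      have h3 : dist ((g ^ (k : ℤ)) s) ((g ^ (k : ℤ)) b) ≤ ε / 2 :=
        closure_minimal h1 h2 (frontier_subset_closure hb)
      linarith
    have hab := hasy.om ha
    have hbQ : b ∉ Q := by
      intro h
      apply haQ
      rw [← hQc.closure_eq, mem_closure_iff]
      intro V hV haV
      obtain ⟨k, -, hk⟩ := hab V hV haV 0
      exact ⟨_, hk, (hQI.mem k b).2 h⟩
    exact fin b hbQ hab (hgt b hbH)
end

theorem late_return {X : Type*} [MetricSpace X] {f : X ≃ₜ X} {a : X}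
    (ha : a ∈ nonwandering (⇑f)) (hp : NonPer f a) {W : Set X} (hW : IsOpen W) (haW : a ∈ W) (K : ℕ) :
    ∃ k : ℕ, K ≤ k ∧ ∃ y ∈ W, (f ^ (k : ℤ)) y ∈ W := by
  have sep : ∀ j : ℕ, ∃ O, IsOpen O ∧ a ∈ O ∧ (0 < j → ∀ y ∈ O, (f ^ (j : ℤ)) y ∉ O) := by
    intro j
    by_cases hj : 0 < j
    · obtain ⟨A, B, hA, hB, h1, h2, hd⟩ := t2_separation (hp j hj)
      refine ⟨B ∩ (f ^ (j : ℤ)) ⁻¹' A, hB.inter (hA.preimage (f ^ (j : ℤ)).continuous), ⟨h2, h1⟩,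
        fun _ y hy hy' => ?_⟩
      exact disjoint_left.1 hd hy.2 hy'.1
    · exact ⟨univ, isOpen_univ, mem_univ _, fun h => absurd h hj⟩
  choose O hO haO hsep using sep
  have hW' : IsOpen (W ∩ ⋂ j ∈ Finset.range K, O j) :=
    hW.inter (isOpen_biInter_finset fun j _ => hO j)
  obtain ⟨k, hk, y, hy, hky⟩ := mem_nw.1 ha _ hW' ⟨haW, mem_iInter₂.2 fun j _ => haO j⟩
  refine ⟨k, ?_, y, hy.1, hky.1⟩
  by_contra hlt
  have hk' : k ∈ Finset.range K := Finset.mem_range.2 (not_le.1 hlt)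
  exact hsep k hk y (mem_iInter₂.1 hy.2 k hk') (mem_iInter₂.1 hky.2 k hk')

section
variable {X : Type*} [MetricSpace X] [CompactSpace X] {f : X ≃ₜ X}

theorem nonPer_inv {x : X} (h : NonPer f x) : NonPer f⁻¹ x := by
  intro n hn he
  rw [inv_zp] at he
  apply h n hn
  have := zp_neg' f n x
  rwa [he] at this

theorem nw_RAP [ConnectedSpace X] (hreg : RegC X) {P : Set X} (hPf : P.Finite) (hPn : P.Nonempty)
    (hPI : IsInv f P) {a0 : X} (ha0 : a0 ∈ nonwandering (⇑f)) : RAP f a0 := by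
  classical
  have := locConn hreg
  by_contra hno
  have hQc := RAP_closed hreg hPf hPn hPI
  have hQI := RAP_isInv (f := f)
  set Q : Set X := {x | RAP f x} with hQ
  have hex : ∃ n : ℕ, ∃ U a, Cut Q U ∧ a ∈ U ∧ a ∈ nonwandering (⇑f) ∧ (frontier U).ncard = n := by
    obtain ⟨U, hU, haU⟩ := exists_min_cut hreg hQc (a := a0) hno
    exact ⟨_, U, a0, hU, haU, ha0, rfl⟩
  obtain ⟨U, a, hU, haU, ha, hcard⟩ := Nat.find_spec hex
  have hmin : ∀ V, Cut Q V → (frontier V).ncard < Nat.find hex → ∀ y ∈ V, y ∉ nonwandering (⇑f) :=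
    fun V hV hlt y hy hyn => Nat.find_min hex hlt ⟨V, y, hV, hy, hyn, rfl⟩
  have haQ : a ∉ Q := fun h => disjoint_left.1 hU.2.2 (subset_closure haU) h
  have hap : NonPer f a := by
    by_contra h
    exact haQ (RAP_of_not_nonPer h)
  have hao : a ∉ Om f a := fun h => haQ (lemR hreg hPf hPn hPI h)
  obtain ⟨V0, hV0, haV0, K0, hK0⟩ := not_Om hao
  obtain ⟨V, hVo, haV, hVc, hVf⟩ := exists_cut hreg (isClosed_singleton (x := a))
    (hV0.inter hQc.isOpen_compl) (singleton_subset_iff.2 ⟨haV0, haQ⟩)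
  rw [singleton_subset_iff] at haV
  have key : ∀ W, IsOpen W → a ∈ W → ∀ K : ℕ, ∃ k : ℕ, K ≤ k ∧ ∃ v ∈ W, (f ^ (k : ℤ)) v ∈ frontier V := by
    intro W hW haW K
    obtain ⟨V', hV', hV'o, haV', hV'c⟩ := connNhd (hW.inter hVo) ⟨haW, haV⟩
    obtain ⟨k, hk, y, hy, hky⟩ := late_return ha hap hV'o haV' (max K K0)
    obtain ⟨_, ⟨v, hv, rfl⟩, hvf⟩ := preconn_meets
      (hV'c.isPreconnected.image _ (f ^ (k : ℤ)).continuous.continuousOn) (U := V)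
      ⟨_, mem_image_of_mem _ hy, (hV' hky).2⟩
      ⟨_, mem_image_of_mem _ haV', fun h => hK0 k (le_trans (le_max_right _ _) hk)
        (hVc (subset_closure h)).1⟩
    exact ⟨k, le_trans (le_max_left _ _) hk, v, (hV' hv).1, hvf⟩
  have hs : ∃ s ∈ frontier V, a ∈ Om f⁻¹ s := by
    by_contra hcon
    push Not at hcon
    have hch : ∀ s, ∃ W, IsOpen W ∧ a ∈ W ∧ ∃ K : ℕ, s ∈ frontier V → ∀ k : ℕ, K ≤ k →
        (f⁻¹ ^ (k : ℤ)) s ∉ W := by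
      intro s
      by_cases h : s ∈ frontier V
      · obtain ⟨W, h1, h2, K, h3⟩ := not_Om (hcon s h)
        exact ⟨W, h1, h2, K, fun _ => h3⟩
      · exact ⟨univ, isOpen_univ, mem_univ _, 0, fun h' => absurd h' h⟩
    choose W hW haW K hK using hch
    obtain ⟨k, hk, v, hv, hvf⟩ := key (⋂ s ∈ hVf.toFinset, W s)
      (isOpen_biInter_finset fun s _ => hW s) (mem_iInter₂.2 fun s _ => haW s)
      (hVf.toFinset.sup K)
    have hmem : (f ^ (k : ℤ)) v ∈ hVf.toFinset := hVf.mem_toFinset.2 hvf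
    apply hK _ hvf k (le_trans (Finset.le_sup hmem) hk)
    rw [inv_zp, zp_neg]
    exact mem_iInter₂.1 hv _ hmem
  obtain ⟨s, hsf, hsa⟩ := hs
  have hsQ : s ∉ Q := (hVc (frontier_subset_closure hsf)).2
  refine step2 (g := f⁻¹) hreg hQc hQI.inv ?_ ?_ hU haU hcard.le ?_ hsQ hsa
  · intro x hx
    exact RAP_inv.1 (RAP_of_not_nonPer hx)
  · intro B hB hBI hBn
    obtain ⟨Z, hZB, ⟨z, hz⟩, -, -, hZR⟩ := lem5 hreg hPf hPn hPI.inv hB hBI hBn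
    exact ⟨z, hZB hz, RAP_inv.1 (hZR z hz)⟩
  · intro V1 h1 h2 y hy hyn
    have := nw_inv hyn
    rw [inv_inv] at this
    exact hmin V1 h1 h2 y hy this

theorem per_zp {x : X} {n : ℕ} (he : (f ^ (n : ℤ)) x = x) (k : ℤ) : (f ^ ((n : ℤ) * k)) x = x := by
  have hI : IsInv (f ^ (n : ℤ)) {x} := by
    apply inv_of_image
    · rintro _ rfl; exact he
    · intro y hy
      have := zp_neg f n x
      rw [he] at this
      rw [mem_singleton_iff.1 hy, ← zpow_neg]
      exact this
  rw [zp_mul]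
  exact (hI.mem k x).2 rfl

theorem Orb_per_finite {x : X} {n : ℕ} (hn : 0 < n) (he : (f ^ (n : ℤ)) x = x) : (Orb f x).Finite := by
  refine ((Finset.range n).finite_toSet.image (fun j : ℕ => (f ^ (j : ℤ)) x)).subset ?_
  rintro _ ⟨k, rfl⟩
  obtain ⟨j, hj, m, e⟩ := zp_mod f hn k x
  rw [per_zp he] at e
  exact ⟨j, hj, e.symm⟩

theorem per_nw {x : X} {n : ℕ} (hn : 0 < n) (he : (f ^ (n : ℤ)) x = x) : x ∈ nonwandering (⇑f) :=
  mem_nw.2 fun _ _ hx => ⟨n, hn, x, hx, by rwa [he]⟩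

theorem RAP_cl {x : X} {ε : ℝ} {r : ℤ} (h : ∀ k : ℤ, dist ((f ^ (r * k)) x) x ≤ ε) :
    closure (Orb (f ^ r) x) ⊆ Metric.closedBall x ε := by
  refine closure_minimal ?_ Metric.isClosed_closedBall
  rintro _ ⟨k, rfl⟩
  rw [← zp_mul]
  exact h k

theorem sep_final [ConnectedSpace X] (hreg : RegC X) {D : Set X} (hD : IsPreconnected D)
    (hDn : ∀ y ∈ D, y ∉ nonwandering (⇑f)) {a b : X} (haD : a ∈ closure D) (hbD : b ∈ closure D)
    (ha : RAP f a) (hb : RAP f b) (hap : NonPer f a) : b = a := by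
  by_contra hne
  have hpos := dist_pos.2 hne
  have hε0 : 0 < dist b a / 3 := by positivity
  obtain ⟨r1, hr1, h1⟩ := ha _ hε0
  obtain ⟨r2, hr2, h2⟩ := hb _ hε0
  set g := f ^ ((r1 : ℤ) * r2) with hg
  have hA : closure (Orb g a) ⊆ Metric.closedBall a (dist b a / 3) :=
    RAP_cl fun k => by rw [mul_assoc]; exact h1 _
  have hB : closure (Orb g b) ⊆ Metric.closedBall b (dist b a / 3) :=
    RAP_cl fun k => by rw [mul_comm (r1 : ℤ), mul_assoc]; exact h2 _
  have hd : Disjoint (closure (Orb g b)) (closure (Orb g a)) := by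
    rw [disjoint_left]
    intro y hy1 hy2
    have e1 := hB hy1
    have e2 := hA hy2
    rw [Metric.mem_closedBall] at e1 e2
    have := dist_triangle_left b a y
    linarith
  obtain ⟨N, hNo, hNI, hbN, hNd, hNf⟩ := inv_sep (f := g) hreg isClosed_closure isClosed_closure hd
    (Orb_inv b).cl (Orb_inv a).cl
  obtain ⟨r, hr, hper⟩ := finite_inv_periodic hNf hNI.fr
  have hfp : ∀ y ∈ frontier N, (f ^ ((r1 * r2 * r : ℕ) : ℤ)) y = y := by
    intro y hy
    have := hper 1 y hy
    rw [hg, mul_one, ← zp_mul] at this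
    push_cast
    exact this
  have hrpos : 0 < r1 * r2 * r := by positivity
  have hDN : D ⊆ N := by
    refine preconn_sub hD ?_ fun y hy hyf => hDn y hy (per_nw hrpos (hfp y hyf))
    obtain ⟨y, hy1, hy2⟩ := mem_closure_iff.1 hbD N hNo (hbN (subset_closure (Orb_self b)))
    exact ⟨y, hy2, hy1⟩
  have haf : a ∈ frontier N := by
    rw [hNo.frontier_eq]
    exact ⟨closure_mono hDN haD, fun h => disjoint_left.1 hNd h (subset_closure (Orb_self a))⟩
  exact hap _ hrpos (hfp a haf)
end

end Helpers

/-- Let `f` be a homeomorphism of a regular curve `X` with `P(f) ≠ ∅`, and let `D` be a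
connected component of `X \ Ω(f)` whose closure meets `Ω(f)` in a non-periodic point.
Then `closure D ∩ Ω(f)` is a single point. -/
theorem closure_component_meets_nonwandering_in_single_point {X : Type*}
    [MetricSpace X] [CompactSpace X] [ConnectedSpace X] [Nonempty X]
    (hreg : ∀ x : X, ∀ ε > (0 : ℝ), ∃ U : Set X,
      IsOpen U ∧ x ∈ U ∧ U ⊆ Metric.ball x ε ∧ (frontier U).Finite)
    (f : X ≃ₜ X) (hP : ∃ p : X, ∃ n : ℕ, 0 < n ∧ (⇑f)^[n] p = p)
    (x : X) (hx : x ∈ (nonwandering (⇑f))ᶜ)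
    (D : Set X) (hD : D = connectedComponentIn (nonwandering (⇑f))ᶜ x)
    (hnp : ∃ a ∈ closure D ∩ nonwandering (⇑f), ∀ n : ℕ, 0 < n → (⇑f)^[n] a ≠ a) :
    ∃ a : X, closure D ∩ nonwandering (⇑f) = {a} := by
  obtain ⟨a, ⟨haD, han⟩, hap⟩ := hnp
  obtain ⟨p, n, hn, hp⟩ := hP
  rw [← zp_nat] at hp
  have hPf := Orb_per_finite (f := f) hn hp
  have hR : ∀ y ∈ nonwandering (⇑f), RAP f y := fun y hy =>
    nw_RAP hreg hPf ⟨p, Orb_self p⟩ (Orb_inv p) hy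
  refine ⟨a, Set.Subset.antisymm ?_ (Set.singleton_subset_iff.2 ⟨haD, han⟩)⟩
  rintro b ⟨hbD, hbn⟩
  have hDc : IsPreconnected D := by
    rw [hD]
    exact isPreconnected_connectedComponentIn
  have hDn : ∀ y ∈ D, y ∉ nonwandering (⇑f) := by
    intro y hy
    rw [hD] at hy
    exact connectedComponentIn_subset _ _ hy
  refine sep_final hreg hDc hDn haD hbD (hR a han) (hR b hbn) ?_
  intro m hm h
  rw [zp_nat] at h
  exact hap m hm h
end
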